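/- There is at most one fundamental discriminant D < 0 with |D| ≥ 200560490130 (the product of the first 11 primes) such that the exponent E(D) of the class group Cl(D) of ℚ(√D) equals 2. -/

import Mathlib

open NumberField

/-- `D` is a fundamental discriminant: either `D ≡ 1 (mod 4)` and `D` is squarefree,
or `D = 4m` for a squarefree integer `m ≡ 2` or `3 (mod 4)`. (We exclude the degenerate
case `D = 1`, so that `D` is the discriminant of a quadratic number field.) -/
def IsFundamentalDiscriminant (D : ℤ) : Prop :=
  D ≠ 1 ∧ ((D % 4 = 1 ∧ Squarefree D) ∨
    ∃ m : ℤ, D = 4 * m ∧ Squarefree m ∧ (m % 4 = 2 ∨ m % 4 = 3))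

namespace ExponentTwo

/-- `ω` generates `R` over `ℤ` as a free module with basis `1, ω`, and `ω ^ 2 = a + b * ω`. -/
structure IsQuadGen {R : Type*} [CommRing R] (a b : ℤ) (ω : R) : Prop where
  sq : ω * ω = a + b * ω
  rep : ∀ x : R, ∃ m n : ℤ, x = m + n * ω
  inj : ∀ m n : ℤ, (m : R) + n * ω = 0 → m = 0 ∧ n = 0

theorem den_eq_one_of_sq_dvd {D : ℤ} (hD : IsFundamentalDiscriminant D) {v : ℚ} {T k : ℤ}
    (h : (D : ℚ) * v ^ 2 = T ^ 2 - 4 * k) (hT : Even D → Even T) : v.den = 1 := by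
  have hden : (v.den : ℚ) ≠ 0 := by exact_mod_cast v.den_nz
  have h1 : D * v.num ^ 2 = (T ^ 2 - 4 * k) * (v.den : ℤ) ^ 2 := by
    have h2 : (v.num : ℚ) = v * v.den := (Rat.mul_den_eq_num v).symm
    have : ((D * v.num ^ 2 : ℤ) : ℚ) = (((T ^ 2 - 4 * k) * (v.den : ℤ) ^ 2 : ℤ) : ℚ) := by
      push_cast
      rw [h2, ← h]; ring
    exact_mod_cast this
  have hcop : IsCoprime ((v.den : ℤ) ^ 2) (v.num ^ 2) := by
    apply IsCoprime.pow
    exact (Int.isCoprime_iff_gcd_eq_one.2 (by simpa [Int.gcd] using v.reduced)).symm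
  have hdvd : (v.den : ℤ) ^ 2 ∣ D := hcop.dvd_of_dvd_mul_right (Dvd.intro_left _ h1.symm)
  have unit_case : ∀ s : ℤ, IsUnit s → s = 1 ∨ s = -1 := fun s hs => Int.isUnit_iff.1 hs
  rcases hD.2 with ⟨h4, hsq⟩ | ⟨m, rfl, hsq, hm⟩
  · rcases unit_case _ (hsq _ (by simpa [sq] using hdvd)) with h | h <;> omega
  · rcases Nat.even_or_odd' v.den with ⟨s, hs | hs⟩
    · have hs1 : (s : ℤ) * s ∣ m := by
        obtain ⟨c, hc⟩ := hdvd
        refine ⟨c, ?_⟩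
        rw [hs] at hc; push_cast at hc; nlinarith
      have hs2 : s = 1 := by rcases unit_case _ (hsq _ hs1) with h | h <;> omega
      have hd2 : v.den = 2 := by omega
      exfalso
      have hodd : v.num % 2 = 1 := by
        have := v.reduced
        rw [hd2] at this
        have h3 : v.num.natAbs % 2 = 1 := Nat.odd_iff.1 (Nat.coprime_two_right.1 this)
        omega
      rw [hd2] at h1
      push_cast at h1
      obtain ⟨t, ht⟩ := hT (by rw [show (4 * m : ℤ) = 2 * m + 2 * m by ring]; exact ⟨_, rfl⟩)
      obtain ⟨w, hw⟩ : ∃ w, v.num = 2 * w + 1 := ⟨v.num / 2, by omega⟩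
      rw [hw, ht] at h1
      have h5 : m * (4 * (w * w + w) + 1) = 4 * (t * t - k) := by nlinarith
      have h6 : m = 4 * (t * t - k - m * (w * w + w)) := by nlinarith
      omega
    · have hs1 : (v.den : ℤ) * v.den ∣ m := by
        have : IsCoprime ((v.den : ℤ) ^ 2) 4 := by
          rw [show (4 : ℤ) = 2 ^ 2 by norm_num]
          apply IsCoprime.pow
          rw [Int.isCoprime_iff_gcd_eq_one]
          simpa [Int.gcd] using (Nat.coprime_two_right.2 ⟨s, hs⟩ : Nat.Coprime v.den 2)
        rw [← sq]
        exact this.dvd_of_dvd_mul_left hdvd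
      rcases unit_case _ (hsq _ hs1) with h | h <;> omega

theorem integral_coords {D a b : ℤ} (hD : IsFundamentalDiscriminant D) (hb : b = D % 2)
    (ha : D = b ^ 2 + 4 * a) {u v : ℚ} {T k : ℤ} (hT : 2 * u + b * v = T)
    (hN : u ^ 2 + b * u * v - a * v ^ 2 = k) : ∃ m n : ℤ, u = m ∧ v = n := by
  have key : (D : ℚ) * v ^ 2 = T ^ 2 - 4 * k := by
    rw [← hT, ← hN, ha]; push_cast; ring
  by_cases hE : D % 2 = 0
  · -- here `b = 0`, so `T = 2 u`; treat `2 u` first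
    have hb0 : b = 0 := by omega
    subst hb0
    rcases hD.2 with ⟨h4, -⟩ | ⟨m, hm4, hsq, hm⟩
    · omega
    have ham : a = m := by omega
    subst ham
    have h4 : (((4 : ℤ) * a : ℤ) : ℚ) * v ^ 2 = T ^ 2 - 4 * k := by
      rw [← key, ha]; push_cast; ring
    -- show `2 * v` is an integer, then that `T` is even
    have hDq : IsFundamentalDiscriminant (4 * a) := by rwa [← hm4]
    have hTe : Even T := by
      -- `a * (2 v) ^ 2 = T ^ 2 - 4 k` with `2 v` an integer
      set w : ℚ := 2 * v with hw
      have hw1 : (a : ℚ) * w ^ 2 = T ^ 2 - 4 * k := by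
        rw [← h4, hw]; push_cast; ring
      have hwden : w.den = 1 := by
        have hden : (w.den : ℚ) ≠ 0 := by exact_mod_cast w.den_nz
        have h1 : a * w.num ^ 2 = (T ^ 2 - 4 * k) * (w.den : ℤ) ^ 2 := by
          have h2 : (w.num : ℚ) = w * w.den := (Rat.mul_den_eq_num w).symm
          have : ((a * w.num ^ 2 : ℤ) : ℚ) = (((T ^ 2 - 4 * k) * (w.den : ℤ) ^ 2 : ℤ) : ℚ) := by
            push_cast
            rw [h2, ← hw1]; ring
          exact_mod_cast this
        have hcop : IsCoprime ((w.den : ℤ) ^ 2) (w.num ^ 2) := by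
          apply IsCoprime.pow
          exact (Int.isCoprime_iff_gcd_eq_one.2 (by simpa [Int.gcd] using w.reduced)).symm
        have hdvd : (w.den : ℤ) ^ 2 ∣ a := hcop.dvd_of_dvd_mul_right (Dvd.intro_left _ h1.symm)
        rcases Int.isUnit_iff.1 (hsq _ (by simpa [sq] using hdvd)) with h | h <;> omega
      have hwn : w = w.num := ((Rat.den_eq_one_iff w).1 hwden).symm
      rw [hwn] at hw1
      have hz : a * w.num ^ 2 = T ^ 2 - 4 * k := by exact_mod_cast hw1
      by_contra hTo
      rw [Int.not_even_iff_odd] at hTo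
      obtain ⟨t, rfl⟩ := hTo
      rcases Int.even_or_odd' w.num with ⟨c, hc | hc⟩
      · rw [hc] at hz
        have : 4 * (a * c ^ 2) = 4 * (t ^ 2 + t - k) + 1 := by nlinarith
        omega
      · rw [hc] at hz
        have : 4 * (a * (c ^ 2 + c)) + a = 4 * (t ^ 2 + t - k) + 1 := by nlinarith
        omega
    obtain ⟨t, ht⟩ := hTe
    have hu : u = t := by
      have : (2 : ℚ) * u = 2 * t := by
        have := hT; rw [ht] at this; push_cast at this; linarith
      linarith
    have hv := den_eq_one_of_sq_dvd hD key (fun _ => ⟨t, ht⟩)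
    exact ⟨t, v.num, hu, ((Rat.den_eq_one_iff v).1 hv).symm⟩
  · have hb1 : b = 1 := by omega
    subst hb1
    have hv := den_eq_one_of_sq_dvd hD key (fun h => absurd (Int.even_iff.1 h) hE)
    have hvn : v = v.num := ((Rat.den_eq_one_iff v).1 hv).symm
    rw [hvn] at key hT
    have hz : D * v.num ^ 2 = T ^ 2 - 4 * k := by exact_mod_cast key
    have hpar : Even (T - v.num) := by
      rw [ha] at hz
      have h1 : v.num ^ 2 - T ^ 2 = 2 * (-2 * k - 2 * a * v.num ^ 2) := by linarith
      have h2 : Even (v.num ^ 2 - T ^ 2) := ⟨-2 * k - 2 * a * v.num ^ 2, by linarith⟩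
      have h3 : Even ((v.num - T) * (v.num + T)) := by convert h2 using 1; ring
      rcases Int.even_mul.1 h3 with h | h <;> rw [Int.even_iff] at h ⊢ <;> omega
    obtain ⟨t, ht⟩ := hpar
    refine ⟨t, v.num, ?_, hvn⟩
    have : (2 : ℚ) * u = 2 * t := by
      have h5 : (T : ℚ) - v.num = t + t := by exact_mod_cast ht
      push_cast at hT
      linarith
    linarith

theorem quadForm_irreducible {D a b : ℤ} (hneg : D < 0) (ha : D = b ^ 2 + 4 * a) (r : ℚ) :
    r ^ 2 ≠ (a : ℚ) + (b : ℚ) * r := by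
  intro h
  have hq : (D : ℚ) = (2 * r - b) ^ 2 := by
    rw [ha]; push_cast; linear_combination (-4) * h
  have : (D : ℚ) < 0 := by exact_mod_cast hneg
  nlinarith [sq_nonneg (2 * r - (b : ℚ))]

theorem isQuadGen_of_coords {D a b : ℤ} (hD : IsFundamentalDiscriminant D)
    (hb : b = D % 2) (ha : D = b ^ 2 + 4 * a) {K : Type*} [Field K] [NumberField K] (θ : K)
    (hsq : θ * θ = a + b * θ) (hrep : ∀ x : K, ∃ u v : ℚ, x = u + v * θ)
    (hinj : ∀ u v : ℚ, (u : K) + v * θ = 0 → u = 0 ∧ v = 0) (σ : K →+* K)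
    (hσ : σ θ = b - θ) : ∃ ω : 𝓞 K, IsQuadGen a b ω := by
  have hfint : IsIntegral ℤ θ := by
    refine ⟨Polynomial.X ^ 2 - Polynomial.C b * Polynomial.X - Polynomial.C a, ?_, ?_⟩
    · monicity!
    · simp only [Polynomial.eval₂_sub, Polynomial.eval₂_mul,
        Polynomial.eval₂_X, Polynomial.eval₂_C, pow_two, hsq]
      simp
  obtain ⟨ω, rfl⟩ : ∃ ω : 𝓞 K, (ω : K) = θ := ⟨⟨θ, hfint⟩, rfl⟩
  refine ⟨ω, ?_, ?_, ?_⟩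
  · apply RingOfIntegers.ext
    simpa using hsq
  · intro x
    have hx : IsIntegral ℤ (x : K) := x.2
    have hsx : IsIntegral ℤ (σ (x : K)) := hx.map σ.toIntAlgHom
    obtain ⟨u, v, huv⟩ := hrep (x : K)
    have hσx : σ (x : K) = u + v * (b - (ω : K)) := by rw [huv]; simp [hσ]
    have hTr : IsIntegral ℤ (2 * u + b * v : ℚ) := by
      have h1 := hx.add hsx
      rw [hσx, huv, show (u : K) + v * (ω : K) + (u + v * (b - (ω : K))) =
        algebraMap ℚ K (2 * u + b * v) by simp; ring] at h1
      exact (isIntegral_algebraMap_iff (algebraMap ℚ K).injective).1 h1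
    have hNm : IsIntegral ℤ (u ^ 2 + b * u * v - a * v ^ 2 : ℚ) := by
      have h1 := hx.mul hsx
      rw [hσx, huv, show ((u : K) + v * (ω : K)) * (u + v * (b - (ω : K))) =
        algebraMap ℚ K (u ^ 2 + b * u * v - a * v ^ 2) by
          simp; linear_combination (-(v : K) ^ 2) * hsq] at h1
      exact (isIntegral_algebraMap_iff (algebraMap ℚ K).injective).1 h1
    obtain ⟨T, hT⟩ := IsIntegrallyClosed.isIntegral_iff.1 hTr
    obtain ⟨k, hk⟩ := IsIntegrallyClosed.isIntegral_iff.1 hNm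
    obtain ⟨m, n, hm, hn⟩ := integral_coords hD hb ha (u := u) (v := v)
      (T := T) (k := k) (by simpa using hT.symm) (by simpa using hk.symm)
    refine ⟨m, n, ?_⟩
    apply RingOfIntegers.ext
    rw [hm, hn] at huv
    simpa using huv
  · intro m n h
    have h' := congrArg (algebraMap (𝓞 K) K) h
    have := hinj m n (by simpa using h')
    exact ⟨by exact_mod_cast this.1, by exact_mod_cast this.2⟩

/-- The field `ℚ(√D)`, with the generator `ω` of its ring of integers. -/
theorem exists_quadField {D a b : ℤ} (hD : IsFundamentalDiscriminant D) (hneg : D < 0)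
    (hb : b = D % 2) (ha : D = b ^ 2 + 4 * a) :
    ∃ (K : Type) (_ : Field K) (_ : NumberField K) (ω : 𝓞 K), IsQuadGen a b ω := by
  have : Fact (∀ r : ℚ, r ^ 2 ≠ (a : ℚ) + (b : ℚ) * r) := ⟨quadForm_irreducible hneg ha⟩
  have hc : CharZero (QuadraticAlgebra ℚ (a : ℚ) (b : ℚ)) := inferInstance
  have hfd : @FiniteDimensional ℚ (QuadraticAlgebra ℚ (a : ℚ) (b : ℚ)) _ _
      (DivisionRing.toRatAlgebra.toModule) := by
    have h : Module.Finite ℚ (QuadraticAlgebra ℚ (a : ℚ) (b : ℚ)) := inferInstance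
    convert h
  have hnf : NumberField (QuadraticAlgebra ℚ (a : ℚ) (b : ℚ)) :=
    { to_charZero := hc, to_finiteDimensional := hfd }
  obtain ⟨ω, hω⟩ := isQuadGen_of_coords hD hb ha
    (⟨0, 1⟩ : QuadraticAlgebra ℚ (a : ℚ) (b : ℚ)) (by ext <;> simp)
    (fun x => ⟨x.re, x.im, by ext <;> simp⟩)
    (fun u v h => by
      have h1 := congrArg QuadraticAlgebra.re h
      have h2 := congrArg QuadraticAlgebra.im h
      simp at h1 h2
      exact ⟨h1, h2⟩)
    (starRingEnd _) (by ext <;> simp [starRingEnd_apply])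
  exact ⟨_, inferInstance, hnf, ω, hω⟩

end ExponentTwo

namespace ExponentTwo

section

variable {K : Type*} [Field K] [NumberField K] {a b : ℤ} {ω : 𝓞 K}

theorem IsQuadGen.coord_inj (h : IsQuadGen a b ω) {m n m' n' : ℤ}
    (he : (m : 𝓞 K) + n * ω = m' + n' * ω) : m = m' ∧ n = n' := by
  have := h.inj (m - m') (n - n') (by push_cast; linear_combination he)
  omega

/-- The `ℤ`-basis `1, ω` of the ring of integers. -/
theorem IsQuadGen.exists_basis (h : IsQuadGen a b ω) :
    ∃ B : Module.Basis (Fin 2) ℤ (𝓞 K), B 0 = 1 ∧ B 1 = ω := by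
  have hli : LinearIndependent ℤ ![(1 : 𝓞 K), ω] := by
    rw [LinearIndependent.pair_iff]
    intro s t hst
    exact h.inj s t (by simpa using hst)
  have hsp : ⊤ ≤ Submodule.span ℤ (Set.range ![(1 : 𝓞 K), ω]) := by
    intro x _
    obtain ⟨m, n, rfl⟩ := h.rep x
    have h1 : (1 : 𝓞 K) ∈ Submodule.span ℤ (Set.range ![(1 : 𝓞 K), ω]) :=
      Submodule.subset_span ⟨0, rfl⟩
    have h2 : ω ∈ Submodule.span ℤ (Set.range ![(1 : 𝓞 K), ω]) :=
      Submodule.subset_span ⟨1, rfl⟩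
    have := Submodule.add_mem _ (Submodule.smul_mem _ m h1) (Submodule.smul_mem _ n h2)
    simpa using this
  exact ⟨Module.Basis.mk hli hsp, by simp, by simp⟩

theorem IsQuadGen.finrank_eq (h : IsQuadGen a b ω) : Module.finrank ℚ K = 2 := by
  obtain ⟨B, -, -⟩ := h.exists_basis
  rw [← RingOfIntegers.rank, Module.finrank_eq_card_basis B]
  simp

theorem repr_add {B : Module.Basis (Fin 2) ℤ (𝓞 K)}
    (h0 : B 0 = 1) (h1 : B 1 = ω) (m n : ℤ) :
    B.repr ((m : 𝓞 K) + n * ω) 0 = m ∧ B.repr ((m : 𝓞 K) + n * ω) 1 = n := by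
  have : (m : 𝓞 K) + n * ω = m • B 0 + n • B 1 := by rw [h0, h1]; simp
  rw [this, map_add, map_zsmul, map_zsmul, B.repr_self, B.repr_self]
  simp

theorem IsQuadGen.leftMulMatrix (h : IsQuadGen a b ω) {B : Module.Basis (Fin 2) ℤ (𝓞 K)}
    (h0 : B 0 = 1) (h1 : B 1 = ω) (m n : ℤ) :
    Algebra.leftMulMatrix B ((m : 𝓞 K) + n * ω) = !![m, a * n; n, m + b * n] := by
  have e0 : ((m : 𝓞 K) + n * ω) * B 0 = (m : 𝓞 K) + n * ω := by rw [h0]; ring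
  have e1 : ((m : 𝓞 K) + n * ω) * B 1 = ((a * n : ℤ) : 𝓞 K) + ((m + b * n : ℤ) : 𝓞 K) * ω := by
    rw [h1]; push_cast; linear_combination (n : 𝓞 K) * h.sq
  ext i j
  rw [Algebra.leftMulMatrix_eq_repr_mul]
  fin_cases i <;> fin_cases j
  · simpa [e0] using (repr_add h0 h1 m n).1
  · simpa [e1] using (repr_add h0 h1 (a * n) (m + b * n)).1
  · simpa [e0] using (repr_add h0 h1 m n).2
  · simpa [e1] using (repr_add h0 h1 (a * n) (m + b * n)).2

theorem IsQuadGen.norm_eq (h : IsQuadGen a b ω) (m n : ℤ) :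
    Algebra.norm ℤ ((m : 𝓞 K) + n * ω) = m ^ 2 + b * m * n - a * n ^ 2 := by
  obtain ⟨B, h0, h1⟩ := h.exists_basis
  rw [Algebra.norm_eq_matrix_det B, h.leftMulMatrix h0 h1, Matrix.det_fin_two_of]
  ring

theorem IsQuadGen.trace_eq (h : IsQuadGen a b ω) (m n : ℤ) :
    Algebra.trace ℤ (𝓞 K) ((m : 𝓞 K) + n * ω) = 2 * m + b * n := by
  obtain ⟨B, h0, h1⟩ := h.exists_basis
  rw [Algebra.trace_eq_matrix_trace B, h.leftMulMatrix h0 h1, Matrix.trace_fin_two_of]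
  ring

theorem IsQuadGen.discr_eq (h : IsQuadGen a b ω) : discr K = b ^ 2 + 4 * a := by
  obtain ⟨B, h0, h1⟩ := h.exists_basis
  rw [← discr_eq_discr K B, Algebra.discr_def]
  have e00 : (1 : 𝓞 K) = ((1 : ℤ) : 𝓞 K) + ((0 : ℤ) : 𝓞 K) * ω := by simp
  have e01 : ω = ((0 : ℤ) : 𝓞 K) + ((1 : ℤ) : 𝓞 K) * ω := by simp
  have t0 : Algebra.trace ℤ (𝓞 K) 1 = 2 := by rw [e00, h.trace_eq]; ring
  have t1 : Algebra.trace ℤ (𝓞 K) ω = b := by rw [e01, h.trace_eq]; ring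
  have t2 : Algebra.trace ℤ (𝓞 K) (ω * ω) = 2 * a + b * b := by rw [h.sq, h.trace_eq]
  rw [Matrix.det_fin_two]
  simp only [Algebra.traceMatrix_apply, Algebra.traceForm_apply, h0, h1, one_mul, mul_one, t0, t1,
    t2]
  ring

end

end ExponentTwo

namespace ExponentTwo

theorem ideal_dvd_of_sq_dvd_sq {R : Type*} [CommRing R] [IsDedekindDomain R] {I J : Ideal R}
    (hI : I ≠ 0) (hJ : J ≠ 0) (h : I * I ∣ J * J) : I ∣ J := by
  classical
  rw [UniqueFactorizationMonoid.dvd_iff_normalizedFactors_le_normalizedFactors hI hJ,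
    Multiset.le_iff_count]
  rw [UniqueFactorizationMonoid.dvd_iff_normalizedFactors_le_normalizedFactors
    (mul_ne_zero hI hI) (mul_ne_zero hJ hJ), UniqueFactorizationMonoid.normalizedFactors_mul hI hI,
    UniqueFactorizationMonoid.normalizedFactors_mul hJ hJ, Multiset.le_iff_count] at h
  intro P
  have := h P
  simp only [Multiset.count_add] at this
  omega

/-- The square of the ideal `J` is generated by the positive integer `z`. -/
def SqEqNat {R : Type*} [CommRing R] (J : Ideal R) (z : ℕ) : Prop :=
  z ≠ 0 ∧ J * J = Ideal.span {(z : R)}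

section

variable {R : Type*} [CommRing R] [IsDedekindDomain R] [CharZero R]

theorem SqEqNat.ne_zero {J : Ideal R} {z : ℕ} (h : SqEqNat J z) : J ≠ 0 := by
  rintro rfl
  have h2 := h.2
  rw [zero_mul, eq_comm, Ideal.zero_eq_bot, Ideal.span_singleton_eq_bot] at h2
  exact h.1 (by exact_mod_cast h2)

theorem SqEqNat.unique {J J' : Ideal R} {z : ℕ} (h : SqEqNat J z) (h' : SqEqNat J' z) :
    J = J' := by
  have e : J * J = J' * J' := h.2.trans h'.2.symm
  exact dvd_antisymm (ideal_dvd_of_sq_dvd_sq h.ne_zero h'.ne_zero e.dvd)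
    (ideal_dvd_of_sq_dvd_sq h'.ne_zero h.ne_zero e.symm.dvd)

theorem SqEqNat.exists_div {J : Ideal R} {k w : ℕ} (h : SqEqNat J (k ^ 2 * w)) :
    ∃ J' : Ideal R, SqEqNat J' w ∧ J = Ideal.span {(k : R)} * J' := by
  have hk : k ≠ 0 := by rintro rfl; exact h.1 (by simp)
  have hkR : (k : R) ≠ 0 := by exact_mod_cast hk
  have hk0 : Ideal.span {(k : R)} ≠ 0 := by
    rw [Ne, Ideal.zero_eq_bot, Ideal.span_singleton_eq_bot]; exact hkR
  have e : J * J = (Ideal.span {(k : R)} * Ideal.span {(k : R)}) * Ideal.span {(w : R)} := by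
    rw [h.2, Ideal.span_singleton_mul_span_singleton, Ideal.span_singleton_mul_span_singleton]
    push_cast; rw [sq]
  obtain ⟨J', rfl⟩ := ideal_dvd_of_sq_dvd_sq hk0 h.ne_zero (Dvd.intro _ e.symm)
  refine ⟨J', ⟨?_, ?_⟩, rfl⟩
  · rintro rfl; exact h.1 (by simp)
  · have e2 : (Ideal.span {(k : R)} * Ideal.span {(k : R)}) * (J' * J') =
        (Ideal.span {(k : R)} * Ideal.span {(k : R)}) * Ideal.span {(w : R)} := by
      rw [← e]; ring
    exact mul_left_cancel₀ (mul_ne_zero hk0 hk0) e2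

theorem SqEqNat.dvd_of_mem {J : Ideal R} {z : ℕ} (h : SqEqNat J z) {x : R} (hx : x ∈ J) :
    (z : R) ∣ x * x := by
  rw [← Ideal.mem_span_singleton, ← h.2]
  exact Ideal.mul_mem_mul hx hx

end

section

variable {K : Type*} [Field K] [NumberField K] {a b : ℤ} {ω : 𝓞 K}

theorem IsQuadGen.intCast_dvd (h : IsQuadGen a b ω) {k m n : ℤ}
    (hd : (k : 𝓞 K) ∣ m + n * ω) : k ∣ m ∧ k ∣ n := by
  obtain ⟨c, hc⟩ := hd
  obtain ⟨u, v, rfl⟩ := h.rep c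
  have := h.coord_inj (m := m) (n := n) (m' := k * u) (n' := k * v)
    (by rw [hc]; push_cast; ring)
  exact ⟨⟨u, this.1⟩, ⟨v, this.2⟩⟩

theorem IsQuadGen.natCast_dvd (h : IsQuadGen a b ω) {k m : ℕ} (hd : (k : 𝓞 K) ∣ m) : k ∣ m := by
  have := h.intCast_dvd (k := k) (m := m) (n := 0) (by simpa using hd)
  exact_mod_cast this.1

theorem SqEqNat.exists_not_dvd (hω : IsQuadGen a b ω) {J : Ideal (𝓞 K)} {z p : ℕ}
    (h : SqEqNat J z) (hz : Squarefree z) (hp : p.Prime) (hpz : p ∣ z) :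
    ∃ x : 𝓞 K, ¬ (p : 𝓞 K) ∣ x ∧ (p : 𝓞 K) ∣ x * x := by
  by_contra! hcon
  have hsub : ∀ x ∈ J, (p : 𝓞 K) ∣ x := by
    intro x hx
    by_contra hnd
    exact hcon x hnd (((Nat.cast_dvd_cast hpz).trans (h.dvd_of_mem hx)))
  have hdvd : Ideal.span {(p : 𝓞 K)} ∣ J := by
    rw [Ideal.dvd_iff_le]
    intro x hx
    exact Ideal.mem_span_singleton.2 (hsub x hx)
  obtain ⟨J', rfl⟩ := hdvd
  have e : (z : 𝓞 K) ∈ Ideal.span {((p * p : ℕ) : 𝓞 K)} := by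
    have hm : (z : 𝓞 K) ∈ Ideal.span {(z : 𝓞 K)} := Ideal.mem_span_singleton_self _
    have e3 : Ideal.span {(p : 𝓞 K)} * J' * (Ideal.span {(p : 𝓞 K)} * J') =
        Ideal.span {((p * p : ℕ) : 𝓞 K)} * (J' * J') := by
      push_cast
      rw [← Ideal.span_singleton_mul_span_singleton]; ring
    rw [← h.2, e3] at hm
    exact Ideal.mul_le_right (I := J' * J') (by rwa [mul_comm] at hm)
  have h2 := hω.natCast_dvd (Ideal.mem_span_singleton.1 e)
  exact hp.one_lt.ne' (Nat.isUnit_iff.1 (hz p h2))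

theorem SqEqNat.prime_dvd_discr (hω : IsQuadGen a b ω) {J : Ideal (𝓞 K)} {z p : ℕ}
    (h : SqEqNat J z) (hz : Squarefree z) (hp : p.Prime) (hpz : p ∣ z) :
    (p : ℤ) ∣ b ^ 2 + 4 * a := by
  obtain ⟨x, hx, hxx⟩ := h.exists_not_dvd hω hz hp hpz
  obtain ⟨m, n, rfl⟩ := hω.rep x
  have e : ((m : 𝓞 K) + n * ω) * (m + n * ω) =
      ((m ^ 2 + a * n ^ 2 : ℤ) : 𝓞 K) + ((2 * m * n + b * n ^ 2 : ℤ) : 𝓞 K) * ω := by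
    push_cast; linear_combination (n : 𝓞 K) ^ 2 * hω.sq
  rw [e] at hxx
  obtain ⟨h1, h2⟩ := hω.intCast_dvd (k := p) (by exact_mod_cast hxx)
  have hpp : Prime (p : ℤ) := Nat.prime_iff_prime_int.1 hp
  have hpn : ¬ (p : ℤ) ∣ n := by
    intro hn
    have hm : (p : ℤ) ∣ m := by
      apply hpp.dvd_of_dvd_pow (n := 2)
      have h3 : (p : ℤ) ∣ a * n ^ 2 := (hn.pow two_ne_zero).mul_left a
      exact (Int.dvd_add_left h3).1 h1
    obtain ⟨u, rfl⟩ := hm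
    obtain ⟨v, rfl⟩ := hn
    exact hx ⟨u + v * ω, by push_cast; ring⟩
  have h4 : (p : ℤ) ∣ 2 * m + b * n := by
    have : (p : ℤ) ∣ n * (2 * m + b * n) := by convert h2 using 1; ring
    exact (hpp.dvd_or_dvd this).resolve_left hpn
  have h5 : (p : ℤ) ∣ n ^ 2 * (b ^ 2 + 4 * a) := by
    have : n ^ 2 * (b ^ 2 + 4 * a) =
        (2 * m + b * n) * (b * n - 2 * m) + 4 * (m ^ 2 + a * n ^ 2) := by ring
    rw [this]
    exact dvd_add (h4.mul_right _) (h1.mul_left _)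
  exact (hpp.dvd_or_dvd h5).resolve_left fun h => hpn (hpp.dvd_of_dvd_pow h)

/-- If the square of an ideal class is trivial, the class contains an ideal whose square is
generated by a positive integer. -/
theorem IsQuadGen.exists_sqEqNat (hω : IsQuadGen a b ω) (hneg : b ^ 2 + 4 * a < 0)
    {I : Ideal (𝓞 K)} (hI : I ≠ 0) {g : 𝓞 K} (hg : I * I = Ideal.span {g}) :
    ∃ (x : 𝓞 K) (z : ℕ), x ≠ 0 ∧ SqEqNat (Ideal.span {x} * I) z := by
  obtain ⟨m, n, rfl⟩ := hω.rep g
  set A := Ideal.absNorm I with hA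
  have hA0 : A ≠ 0 := by
    rw [hA, Ne, Ideal.absNorm_eq_zero_iff]; exact hI
  have hN : (m ^ 2 + b * m * n - a * n ^ 2 : ℤ) = A ^ 2 := by
    have h1 := congrArg Ideal.absNorm hg
    rw [map_mul, Ideal.absNorm_span_singleton, hω.norm_eq] at h1
    have h2 : 0 ≤ m ^ 2 + b * m * n - a * n ^ 2 := by
      nlinarith [sq_nonneg (2 * m + b * n), sq_nonneg n]
    have h3 : ((m ^ 2 + b * m * n - a * n ^ 2).natAbs : ℤ) = A * A := by
      rw [← h1]; push_cast; rfl
    rw [Int.natAbs_of_nonneg h2] at h3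
    rw [h3, pow_two]
  set g : 𝓞 K := m + n * ω with hgdef
  set g' : 𝓞 K := m + b * n - n * ω with hg'
  have hgg : g * g' = (A : 𝓞 K) ^ 2 := by
    have : ((m ^ 2 + b * m * n - a * n ^ 2 : ℤ) : 𝓞 K) = ((A ^ 2 : ℤ) : 𝓞 K) := by rw [hN]
    push_cast at this
    rw [← this]
    linear_combination (-(n : 𝓞 K) ^ 2) * hω.sq
  have htr : g + g' = ((2 * m + b * n : ℤ) : 𝓞 K) := by push_cast; rw [hgdef, hg']; ring
  have sqform : ∀ (x : 𝓞 K) (k : ℤ), k ≠ 0 → x * x * g = k →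
      SqEqNat (Ideal.span {x} * I) k.natAbs := by
    intro x k hk hxk
    refine ⟨Int.natAbs_ne_zero.2 hk, ?_⟩
    rw [show Ideal.span {x} * I * (Ideal.span {x} * I) =
      Ideal.span {x} * Ideal.span {x} * (I * I) by ring, hg,
      Ideal.span_singleton_mul_span_singleton, Ideal.span_singleton_mul_span_singleton, hxk,
      Ideal.span_singleton_eq_span_singleton]
    rcases Int.natAbs_eq k with h | h
    · have : (k : 𝓞 K) = (k.natAbs : 𝓞 K) := by rw [h]; simp
      rw [this]
    · have : (k : 𝓞 K) = -(k.natAbs : 𝓞 K) := by rw [h]; simp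
      rw [this]
      exact (Associated.refl _).neg_left
  by_cases hx : g' + A = 0
  · refine ⟨1, A, one_ne_zero, ?_⟩
    have := sqform 1 (-(A : ℤ)) (by simpa using hA0) ?_
    · simpa using this
    · have h0 : g' = -(A : 𝓞 K) := by linear_combination hx
      rw [h0] at hgg
      have hA0' : (A : 𝓞 K) ≠ 0 := by exact_mod_cast hA0
      have : (A : 𝓞 K) * (g + A) = 0 := by linear_combination -hgg
      have := (mul_eq_zero.1 this).resolve_left hA0'
      push_cast
      linear_combination this
  · have e : (g' + A) * (g' + A) * g = ((A ^ 2 * (2 * m + b * n + 2 * A) : ℤ) : 𝓞 K) := by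
      push_cast at htr ⊢
      linear_combination (g' + 2 * (A : 𝓞 K)) * hgg + (A : 𝓞 K) ^ 2 * htr
    have hg0 : g ≠ 0 := by
      intro h0
      rw [h0, zero_mul] at hgg
      have : (A : 𝓞 K) ≠ 0 := by exact_mod_cast hA0
      exact pow_ne_zero 2 this hgg.symm
    refine ⟨g' + A, _, hx, sqform (g' + A) _ ?_ e⟩
    intro h0
    rw [h0] at e
    exact mul_ne_zero (mul_ne_zero hx hx) hg0 (by simpa using e)

theorem IsQuadGen.sqEqNat_mul_discr (hω : IsQuadGen a b ω) {q : ℕ} (hq0 : q ≠ 0)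
    (hq : (q : ℤ) = -(b ^ 2 + 4 * a)) {J : Ideal (𝓞 K)} {z : ℕ} (h : SqEqNat J z) :
    SqEqNat (Ideal.span {2 * ω - b} * J) (z * q) := by
  refine ⟨mul_ne_zero h.1 hq0, ?_⟩
  have hq' : (q : 𝓞 K) = -((b : 𝓞 K) ^ 2 + 4 * a) := by exact_mod_cast congrArg (Int.cast : ℤ → 𝓞 K) hq
  rw [show Ideal.span {2 * ω - (b : 𝓞 K)} * J * (Ideal.span {2 * ω - (b : 𝓞 K)} * J) =
      Ideal.span {2 * ω - (b : 𝓞 K)} * Ideal.span {2 * ω - (b : 𝓞 K)} * (J * J) by ring, h.2,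
      Ideal.span_singleton_mul_span_singleton, Ideal.span_singleton_mul_span_singleton,
      show (2 * ω - (b : 𝓞 K)) * (2 * ω - b) * z = -((z * q : ℕ) : 𝓞 K) by
        push_cast; rw [hq']; linear_combination 4 * (z : 𝓞 K) * hω.sq, Ideal.span_singleton_neg]

end

end ExponentTwo

namespace ExponentTwo

/-- The nonzero ideal `I` belongs to the ideal class `C`. -/
def InClass {R : Type*} [CommRing R] [IsDedekindDomain R] (I : Ideal R) (C : ClassGroup R) : Prop :=
  ∃ h : I ∈ nonZeroDivisors (Ideal R), ClassGroup.mk0 ⟨I, h⟩ = C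

section

variable {R : Type*} [CommRing R] [IsDedekindDomain R]

theorem InClass.ne_zero {I : Ideal R} {C : ClassGroup R} (h : InClass I C) : I ≠ 0 := by
  obtain ⟨h1, -⟩ := h
  exact nonZeroDivisors.ne_zero h1

theorem inClass_unique {I : Ideal R} {C C' : ClassGroup R} (h : InClass I C) (h' : InClass I C') :
    C = C' := by
  obtain ⟨h1, rfl⟩ := h
  obtain ⟨h2, rfl⟩ := h'
  rfl

theorem inClass_span_mul {I : Ideal R} {C : ClassGroup R} {x : R} (hx : x ≠ 0) :
    InClass (Ideal.span {x} * I) C ↔ InClass I C := by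
  have hx0 : Ideal.span {x} ≠ 0 := by
    rw [Ne, Ideal.zero_eq_bot, Ideal.span_singleton_eq_bot]; exact hx
  constructor
  · rintro ⟨h, rfl⟩
    have hI : I ∈ nonZeroDivisors (Ideal R) := by
      rw [mem_nonZeroDivisors_iff_ne_zero] at h ⊢
      exact (mul_ne_zero_iff.1 h).2
    refine ⟨hI, ?_⟩
    rw [ClassGroup.mk0_eq_mk0_iff]
    exact ⟨x, 1, hx, one_ne_zero, by simp⟩
  · rintro ⟨h, rfl⟩
    have hI : Ideal.span {x} * I ∈ nonZeroDivisors (Ideal R) := by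
      rw [mem_nonZeroDivisors_iff_ne_zero] at h ⊢
      exact mul_ne_zero hx0 h
    refine ⟨hI, ?_⟩
    rw [ClassGroup.mk0_eq_mk0_iff]
    exact ⟨1, x, one_ne_zero, hx, by simp⟩

theorem InClass.mul {I I' : Ideal R} {C C' : ClassGroup R} (h : InClass I C) (h' : InClass I' C') :
    InClass (I * I') (C * C') := by
  obtain ⟨h1, rfl⟩ := h
  obtain ⟨h2, rfl⟩ := h'
  exact ⟨mul_mem h1 h2, by rw [← map_mul]; rfl⟩

theorem InClass.exists_span {I : Ideal R} (h : InClass I 1) : ∃ g : R, I = Ideal.span {g} := by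
  obtain ⟨h1, h2⟩ := h
  rw [ClassGroup.mk0_eq_one_iff] at h2
  exact h2.principal

theorem exists_inClass (C : ClassGroup R) : ∃ I : Ideal R, InClass I C := by
  obtain ⟨⟨I, h⟩, hI⟩ := ClassGroup.mk0_surjective C
  exact ⟨I, h, hI⟩

end

theorem dvd_of_squarefree_of_prime_dvd {z q : ℕ} (hz : Squarefree z) (hq : q ≠ 0)
    (h : ∀ p : ℕ, p.Prime → p ∣ z → p ∣ q) : z ∣ q := by
  rw [← Nat.prod_primeFactors_of_squarefree hz]
  exact (Finset.prod_dvd_prod_of_subset _ _ _ fun p hp => Nat.mem_primeFactors.2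
    ⟨Nat.prime_of_mem_primeFactors hp, h p (Nat.prime_of_mem_primeFactors hp)
      (Nat.dvd_of_mem_primeFactors hp), hq⟩).trans (Nat.prod_primeFactors_dvd q)

section

variable {K : Type*} [Field K] [NumberField K] {a b : ℤ} {ω : 𝓞 K}

/-- For each ideal class of order at most two, a small ramified ideal in it. -/
theorem IsQuadGen.exists_ramified (hω : IsQuadGen a b ω) {q : ℕ} (hq0 : q ≠ 0)
    (hq : (q : ℤ) = -(b ^ 2 + 4 * a)) (hsq : ¬ IsSquare q) (C : ClassGroup (𝓞 K))
    (hC : C * C = 1) :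
    ∃ (J J' : Ideal (𝓞 K)) (z w : ℕ), SqEqNat J z ∧ SqEqNat J' w ∧ InClass J C ∧ InClass J' C ∧
      Squarefree z ∧ Squarefree w ∧ z ∣ q ∧ w ∣ q ∧ z ^ 2 ≤ q ∧ z ≠ w := by
  classical
  have hq0' : (0 : ℤ) < q := by exact_mod_cast Nat.pos_of_ne_zero hq0
  have hdvd : ∀ {J : Ideal (𝓞 K)} {z : ℕ}, SqEqNat J z → Squarefree z → z ∣ q := by
    intro J z h hz
    refine dvd_of_squarefree_of_prime_dvd hz hq0 fun p hp hpz => ?_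
    have := h.prime_dvd_discr hω hz hp hpz
    rw [← dvd_neg, ← hq] at this
    exact_mod_cast this
  have hex : ∃ z : ℕ, ∃ J : Ideal (𝓞 K), SqEqNat J z ∧ InClass J C := by
    obtain ⟨I, hI⟩ := exists_inClass C
    have h2 := hI.mul hI
    rw [hC] at h2
    obtain ⟨g, hg⟩ := h2.exists_span
    obtain ⟨x, z, hx, hz⟩ := hω.exists_sqEqNat (by omega) hI.ne_zero hg
    exact ⟨z, _, hz, (inClass_span_mul hx).2 hI⟩
  have hreduce : ∀ {k w : ℕ} {J : Ideal (𝓞 K)}, SqEqNat J (k ^ 2 * w) → InClass J C →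
      ∃ J', SqEqNat J' w ∧ InClass J' C := by
    intro k w J h hJ
    obtain ⟨J', hJ', rfl⟩ := h.exists_div
    refine ⟨J', hJ', (inClass_span_mul ?_).1 hJ⟩
    have := h.1
    intro h0
    rw [Nat.cast_eq_zero] at h0
    simp [h0] at this
  set z := Nat.find hex with hz
  obtain ⟨J, hJ, hJC⟩ := Nat.find_spec hex
  rw [← hz] at hJ
  have hzsq : Squarefree z := by
    obtain ⟨w, k, hk, hw⟩ := Nat.sq_mul_squarefree z
    rw [← hk] at hJ
    have h1 := Nat.find_min' hex (hreduce hJ hJC)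
    rw [← hz] at h1
    have h2 : z = w := by
      apply le_antisymm h1
      apply Nat.le_of_dvd (Nat.pos_of_ne_zero (hk ▸ hJ.1))
      exact Dvd.intro_left _ hk
    rwa [h2]
  have hzq := hdvd hJ hzsq
  obtain ⟨r, hr⟩ := hzq
  have hδ : (2 * ω - b : 𝓞 K) ≠ 0 := by
    intro h0
    have := hω.inj (-b) 2 (by push_cast; linear_combination h0)
    omega
  have hJr := hω.sqEqNat_mul_discr hq0 hq hJ
  rw [hr, ← mul_assoc, ← pow_two] at hJr
  obtain ⟨J₁, hJ₁, hJ₁C⟩ := hreduce hJr ((inClass_span_mul hδ).2 hJC)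
  have hzr : z ≤ r := Nat.find_min' hex ⟨J₁, hJ₁, hJ₁C⟩
  obtain ⟨w, k, hk, hw⟩ := Nat.sq_mul_squarefree r
  rw [← hk] at hJ₁
  obtain ⟨J₂, hJ₂, hJ₂C⟩ := hreduce hJ₁ hJ₁C
  refine ⟨J, J₂, z, w, hJ, hJ₂, hJC, hJ₂C, hzsq, hw, ⟨r, hr⟩, hdvd hJ₂ hw, ?_, ?_⟩
  · rw [hr, pow_two]; exact Nat.mul_le_mul_left _ hzr
  · rintro h
    apply hsq
    rw [hr, ← hk, ← h]
    exact ⟨z * k, by ring⟩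

/-- If the class group is killed by two, every class contains a small ramified ideal, and the class
number is bounded in terms of the number of prime divisors of the discriminant. -/
theorem IsQuadGen.exists_ramified_system (hω : IsQuadGen a b ω) {q : ℕ} (hq0 : q ≠ 0)
    (hq : (q : ℤ) = -(b ^ 2 + 4 * a)) (hsq : ¬ IsSquare q)
    (hC : ∀ C : ClassGroup (𝓞 K), C * C = 1) :
    (∃ (J : ClassGroup (𝓞 K) → Ideal (𝓞 K)) (z : ClassGroup (𝓞 K) → ℕ),
      Function.Injective z ∧ ∀ C, SqEqNat (J C) (z C) ∧ InClass (J C) C ∧ Squarefree (z C) ∧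
        z C ∣ q ∧ (z C) ^ 2 ≤ q) ∧
    2 * Fintype.card (ClassGroup (𝓞 K)) ≤ 2 ^ q.primeFactors.card := by
  classical
  choose J J' z w h using fun C => hω.exists_ramified hq0 hq hsq C (hC C)
  have huniq : ∀ {I I' : Ideal (𝓞 K)} {u v : ℕ} {C C' : ClassGroup (𝓞 K)}, SqEqNat I u →
      SqEqNat I' v → InClass I C → InClass I' C' → u = v → C = C' := by
    rintro I I' u v C C' h1 h2 h3 h4 rfl
    obtain rfl := h1.unique h2
    exact inClass_unique h3 h4
  refine ⟨⟨J, z, fun C C' hCC => huniq (h C).1 (h C').1 (h C).2.2.1 (h C').2.2.1 hCC,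
    fun C => ⟨(h C).1, (h C).2.2.1, (h C).2.2.2.2.1, (h C).2.2.2.2.2.2.1,
      (h C).2.2.2.2.2.2.2.2.1⟩⟩, ?_⟩
  let φ : Bool × ClassGroup (𝓞 K) → ℕ := fun p => if p.1 then z p.2 else w p.2
  have hφ : Function.Injective φ := by
    rintro ⟨i, C⟩ ⟨i', C'⟩ he
    obtain ⟨h1, h2, h3, h4, -, -, -, -, -, h5⟩ := h C
    obtain ⟨h1', h2', h3', h4', -, -, -, -, -, h5'⟩ := h C'
    cases i <;> cases i' <;> simp only [φ, if_true, if_false, Bool.false_eq_true] at he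
    · rw [huniq h2 h2' h4 h4' he]
    · obtain rfl := huniq h2 h1' h4 h3' he
      exact absurd he.symm h5
    · obtain rfl := huniq h1 h2' h3 h4' he
      exact absurd he h5
    · rw [huniq h1 h1' h3 h3' he]
  have hprop : ∀ p, Squarefree (φ p) ∧ φ p ∣ q := by
    rintro ⟨i, C⟩
    obtain ⟨-, -, -, -, h1, h2, h3, h4, -, -⟩ := h C
    cases i
    · exact ⟨h2, h4⟩
    · exact ⟨h1, h3⟩
  have : Fintype.card (Bool × ClassGroup (𝓞 K)) ≤ (q.primeFactors.powerset).card := by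
    rw [← Finset.card_univ]
    apply Finset.card_le_card_of_injOn (fun p => (φ p).primeFactors)
    · intro p _
      simp only [Finset.coe_powerset, Set.mem_preimage, Set.mem_powerset_iff, Finset.coe_subset]
      exact Nat.primeFactors_mono (hprop p).2 hq0
    · intro p _ p' _ he
      apply hφ
      rw [← Nat.prod_primeFactors_of_squarefree (hprop p).1,
        ← Nat.prod_primeFactors_of_squarefree (hprop p').1]
      simp only at he
      rw [he]
  simpa using this

end

end ExponentTwo

namespace ExponentTwo

theorem card_le_of_dvd_sub {S : Finset ℤ} {z : ℕ} (hz : 0 < z) {A B : ℝ}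
    (hAB : A ≤ B) (hS : ∀ m ∈ S, A ≤ m ∧ (m : ℝ) ≤ B) (hd : ∀ m ∈ S, ∀ m' ∈ S, (z : ℤ) ∣ m - m') :
    (S.card : ℝ) ≤ (B - A) / z + 1 := by
  have hz' : (0 : ℝ) < z := by exact_mod_cast hz
  have h0 : 0 ≤ (B - A) / z := div_nonneg (by linarith) hz'.le
  rcases S.eq_empty_or_nonempty with rfl | hne
  · simp; linarith
  set m₀ := S.min' hne with hm₀
  have hm₀S : m₀ ∈ S := S.min'_mem hne
  have hmap : ∀ m ∈ S, (m - m₀) / z ∈ Finset.Icc (0 : ℤ) ⌊(B - A) / z⌋ := by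
    intro m hm
    have h1 : m₀ ≤ m := S.min'_le m hm
    obtain ⟨k, hk⟩ := hd m hm m₀ hm₀S
    have hzz : (z : ℤ) ≠ 0 := by exact_mod_cast hz.ne'
    rw [hk, Int.mul_ediv_cancel_left _ hzz, Finset.mem_Icc]
    constructor
    · by_contra! hneg
      have : (z : ℤ) * k < 0 := mul_neg_of_pos_of_neg (by exact_mod_cast hz) hneg
      omega
    · rw [Int.le_floor, le_div_iff₀ hz']
      have h2 : ((m : ℝ) - m₀) = z * k := by exact_mod_cast hk
      have := hS m hm
      have := hS m₀ hm₀S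
      linarith
  have hinj : Set.InjOn (fun m => (m - m₀) / (z : ℤ)) S := by
    intro m hm m' hm' he
    obtain ⟨k, hk⟩ := hd m hm m₀ hm₀S
    obtain ⟨k', hk'⟩ := hd m' hm' m₀ hm₀S
    have hzz : (z : ℤ) ≠ 0 := by exact_mod_cast hz.ne'
    simp only [hk, hk', Int.mul_ediv_cancel_left _ hzz] at he
    rw [he] at hk
    omega
  have hc := Finset.card_le_card_of_injOn _ hmap hinj
  rw [Int.card_Icc] at hc
  have hfl : (0 : ℤ) ≤ ⌊(B - A) / z⌋ := Int.floor_nonneg.2 h0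
  have : (S.card : ℤ) ≤ ⌊(B - A) / z⌋ + 1 := by omega
  have h3 : (S.card : ℝ) ≤ ⌊(B - A) / z⌋ + 1 := by exact_mod_cast this
  have := Int.floor_le ((B - A) / z)
  linarith

theorem card_lattice_le {P : Finset (ℤ × ℤ)} {b : ℤ} {q z : ℕ} {X : ℝ} (hz : 0 < z)
    (hzq : z ^ 2 ≤ q) (hX : 0 ≤ X)
    (hP : ∀ p ∈ P, 1 ≤ p.2 ∧ (2 * p.1 + b * p.2 : ℝ) ^ 2 + q * (p.2 : ℝ) ^ 2 ≤ 4 * z * X)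
    (hd : ∀ p ∈ P, ∀ p' ∈ P, p.2 = p'.2 → (z : ℤ) ∣ p.1 - p'.1) :
    (P.card : ℝ) ≤ 8 * X / √q := by
  have hz' : (0 : ℝ) < z := by exact_mod_cast hz
  have hz1 : (1 : ℝ) ≤ z := by exact_mod_cast hz
  have hzq' : (z : ℝ) ^ 2 ≤ q := by exact_mod_cast hzq
  have hq' : (0 : ℝ) < q := by nlinarith
  set T := 2 * √(z * X / q) with hT
  have hT0 : 0 ≤ T := by positivity
  have hT2 : T ^ 2 = 4 * z * X / q := by
    rw [hT, mul_pow, Real.sq_sqrt (by positivity)]; ring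
  have hmem : ∀ p ∈ P, p.2 ∈ Finset.Icc (1 : ℤ) ⌊T⌋ := by
    intro p hp
    obtain ⟨h1, h2⟩ := hP p hp
    rw [Finset.mem_Icc]
    refine ⟨h1, ?_⟩
    rw [Int.le_floor]
    refine le_of_sq_le_sq ?_ hT0
    rw [hT2, le_div_iff₀ hq']
    nlinarith [sq_nonneg (2 * p.1 + b * p.2 : ℝ)]
  have hfib : ∀ n ∈ Finset.Icc (1 : ℤ) ⌊T⌋,
      ((P.filter (fun p => p.2 = n)).card : ℝ) ≤ 2 * √(X / z) + 1 := by
    intro n hn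
    have hinj : Set.InjOn (Prod.fst : ℤ × ℤ → ℤ) (P.filter (fun p => p.2 = n)) := by
      intro p hp p' hp' he
      simp only [Finset.coe_filter, Set.mem_ofPred_eq] at hp hp'
      exact Prod.ext he (hp.2.trans hp'.2.symm)
    rw [← Finset.card_image_of_injOn hinj]
    have hs : √(z * X) / z = √(X / z) := by
      rw [Real.sqrt_mul hz'.le, Real.sqrt_div hX, div_eq_div_iff hz'.ne' (by positivity)]
      have := Real.mul_self_sqrt hz'.le
      linear_combination √X * this
    have := card_le_of_dvd_sub (S := (P.filter (fun p => p.2 = n)).image Prod.fst) hz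
      (A := - (b * n : ℝ) / 2 - √(z * X)) (B := - (b * n : ℝ) / 2 + √(z * X))
      (by linarith [Real.sqrt_nonneg (z * X)]) ?_ ?_
    · rw [← hs]
      calc _ ≤ _ := this
        _ = _ := by ring
    · intro m hm
      simp only [Finset.mem_image, Finset.mem_filter] at hm
      obtain ⟨p, ⟨hp, rfl⟩, rfl⟩ := hm
      obtain ⟨-, h2⟩ := hP p hp
      have h3 : ((p.1 : ℝ) + b * p.2 / 2) ^ 2 ≤ z * X := by
        nlinarith [mul_nonneg hq'.le (sq_nonneg (p.2 : ℝ))]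
      have := Real.abs_le_sqrt h3
      rw [abs_le] at this
      constructor <;> linarith [this.1, this.2]
    · intro m hm m' hm'
      simp only [Finset.mem_image, Finset.mem_filter] at hm hm'
      obtain ⟨p, ⟨hp, hpn⟩, rfl⟩ := hm
      obtain ⟨p', ⟨hp', hpn'⟩, rfl⟩ := hm'
      exact hd p hp p' hp' (hpn.trans hpn'.symm)
  rw [Finset.card_eq_sum_card_fiberwise (f := Prod.snd) (t := Finset.Icc (1 : ℤ) ⌊T⌋)
    (fun p hp => hmem p hp)]
  push_cast
  have hsum := Finset.sum_le_sum hfib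
  refine hsum.trans ?_
  rw [Finset.sum_const, nsmul_eq_mul, Int.card_Icc]
  have hfl0 : (0 : ℤ) ≤ ⌊T⌋ := Int.floor_nonneg.2 hT0
  have hcast : (((⌊T⌋ + 1 - 1).toNat : ℕ) : ℝ) = ⌊T⌋ := by
    have : (((⌊T⌋ + 1 - 1).toNat : ℕ) : ℤ) = ⌊T⌋ := by omega
    exact_mod_cast this
  rw [hcast]
  have hsq : 0 < √(q : ℝ) := Real.sqrt_pos.2 hq'
  have hss : √(q : ℝ) * √q = q := Real.mul_self_sqrt hq'.le
  rcases lt_or_ge T 1 with h1 | h1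
  · have : ⌊T⌋ = 0 := by rw [Int.floor_eq_iff]; constructor <;> norm_num <;> assumption
    rw [this]; simp; positivity
  · have hTX : T * (2 * √(X / z)) = 4 * X / √q := by
      rw [hT, eq_div_iff hsq.ne', show z * X / (q : ℝ) = (z * X) / q from rfl, Real.sqrt_div' _ hq'.le,
        Real.sqrt_div hX, Real.sqrt_mul hz'.le]
      have := Real.mul_self_sqrt hX
      have hzs : √(z : ℝ) ≠ 0 := (Real.sqrt_pos.2 hz').ne'
      field_simp
      linarith
    have hX4 : (z : ℝ) ≤ 4 * X := by
      have : 1 ≤ T ^ 2 := by nlinarith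
      rw [hT2, le_div_iff₀ hq'] at this
      nlinarith
    have hTle : T ≤ 4 * X / √q := by
      refine le_of_sq_le_sq ?_ (by positivity)
      rw [hT2, div_pow, Real.sq_sqrt hq'.le]
      gcongr
      nlinarith
    calc (⌊T⌋ : ℝ) * (2 * √(X / z) + 1) ≤ T * (2 * √(X / z) + 1) := by
          gcongr; exact Int.floor_le T
      _ = T * (2 * √(X / z)) + T := by ring
      _ ≤ 4 * X / √q + 4 * X / √q := by rw [hTX]; gcongr
      _ = _ := by ring

end ExponentTwo

namespace ExponentTwo

/-- The number of ideals of norm `n`. -/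
noncomputable def idealCount (K : Type*) [Field K] [NumberField K] (n : ℕ) : ℕ :=
  Nat.card {I : Ideal (𝓞 K) // Ideal.absNorm I = n}

section

variable {K : Type*} [Field K] [NumberField K] {a b : ℤ} {ω : 𝓞 K}

theorem absNorm_of_sqEqNat (hω : IsQuadGen a b ω) {J : Ideal (𝓞 K)} {z : ℕ} (h : SqEqNat J z) :
    Ideal.absNorm J = z := by
  have h2 := congrArg Ideal.absNorm h.2
  rw [map_mul, Ideal.absNorm_span_natCast, RingOfIntegers.rank, hω.finrank_eq, ← pow_two] at h2
  exact Nat.pow_left_injective (n := 2) (by norm_num) h2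

theorem IsQuadGen.ideal_cases (hω : IsQuadGen a b ω) {q : ℕ} (hq : (q : ℤ) = -(b ^ 2 + 4 * a))
    (hC : ∀ C : ClassGroup (𝓞 K), C * C = 1)
    {J : ClassGroup (𝓞 K) → Ideal (𝓞 K)} {z : ClassGroup (𝓞 K) → ℕ}
    (hJ : ∀ C, SqEqNat (J C) (z C) ∧ InClass (J C) C ∧ Squarefree (z C) ∧
        z C ∣ q ∧ (z C) ^ 2 ≤ q) {I : Ideal (𝓞 K)} (hI : I ≠ 0) :
    ∃ C, (∃ k : ℕ, I = Ideal.span {(k : 𝓞 K)} * J C) ∨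
      ∃ m n : ℤ, 1 ≤ n ∧ I * J C = Ideal.span {(m : 𝓞 K) + n * ω} ∧
        (2 * m + b * n) ^ 2 + q * n ^ 2 = 4 * z C * (Ideal.absNorm I : ℤ) := by
  have hI' : I ∈ nonZeroDivisors (Ideal (𝓞 K)) := mem_nonZeroDivisors_iff_ne_zero.2 hI
  set C := ClassGroup.mk0 ⟨I, hI'⟩ with hCdef
  have hIC : InClass I C := ⟨hI', rfl⟩
  obtain ⟨hsq, hin, hsf, hzq, hz2⟩ := hJ C
  have h1 := hIC.mul hin
  rw [hC] at h1
  obtain ⟨g, hg⟩ := h1.exists_span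
  obtain ⟨m, n, hmn⟩ := hω.rep g
  refine ⟨C, ?_⟩
  have hnorm : (2 * m + b * n) ^ 2 + q * n ^ 2 = 4 * z C * (Ideal.absNorm I : ℤ) := by
    have h2 := congrArg Ideal.absNorm hg
    rw [map_mul, absNorm_of_sqEqNat hω hsq, Ideal.absNorm_span_singleton, hmn, hω.norm_eq] at h2
    have h3 : (0 : ℤ) ≤ m ^ 2 + b * m * n - a * n ^ 2 := by
      have : 4 * (m ^ 2 + b * m * n - a * n ^ 2) = (2 * m + b * n) ^ 2 + q * n ^ 2 := by
        rw [hq]; ring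
      have h5 : (0 : ℤ) ≤ (2 * m + b * n) ^ 2 + q * n ^ 2 := by positivity
      omega
    have h4 : ((Ideal.absNorm I * z C : ℕ) : ℤ) = m ^ 2 + b * m * n - a * n ^ 2 := by
      rw [h2]; exact Int.natAbs_of_nonneg h3
    push_cast at h4
    rw [hq]
    linear_combination (-4) * h4
  rcases lt_trichotomy n 0 with hn | hn | hn
  · right
    refine ⟨-m, -n, by omega, ?_, by rw [← hnorm]; ring⟩
    rw [hg, hmn, ← Ideal.span_singleton_neg]
    congr 2; push_cast; ring
  · left
    subst hn
    have hg' : I * J C = Ideal.span {(m.natAbs : 𝓞 K)} := by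
      rw [hg, hmn]
      rcases Int.natAbs_eq m with h | h
      · conv_lhs => rw [h]
        simp
      · conv_lhs => rw [h]
        rw [← Ideal.span_singleton_neg]; simp
    have hmem : (m.natAbs : 𝓞 K) ∈ J C := by
      have : (m.natAbs : 𝓞 K) ∈ I * J C := by rw [hg']; exact Ideal.mem_span_singleton_self _
      have hle : I * J C ≤ J C := Ideal.mul_le_right
      exact hle this
    have hd : z C ∣ m.natAbs := by
      have := hsq.dvd_of_mem hmem
      have h2 : (z C : 𝓞 K) ∣ ((m.natAbs * m.natAbs : ℕ) : 𝓞 K) := by push_cast; exact this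
      have h3 := hω.natCast_dvd h2
      rw [← pow_two] at h3
      exact (hsf.dvd_pow_iff_dvd two_ne_zero).1 h3
    obtain ⟨k, hk⟩ := hd
    refine ⟨k, ?_⟩
    apply mul_right_cancel₀ hsq.ne_zero
    rw [hg', mul_assoc, hsq.2, Ideal.span_singleton_mul_span_singleton, hk]
    push_cast
    rw [mul_comm]
  · right
    exact ⟨m, n, by omega, by rw [hg, hmn], hnorm⟩

theorem IsQuadGen.card_ideals_le (hω : IsQuadGen a b ω) {q : ℕ} {J : Ideal (𝓞 K)} {z : ℕ}
    (hJ : SqEqNat J z) (hsf : Squarefree z) (hzq : z ^ 2 ≤ q) {N : ℕ} {S : Finset (Ideal (𝓞 K))}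
    (hS : ∀ I ∈ S, Ideal.absNorm I ≤ N ∧
      ∃ m n : ℤ, 1 ≤ n ∧ I * J = Ideal.span {(m : 𝓞 K) + n * ω} ∧
        (2 * m + b * n) ^ 2 + q * n ^ 2 = 4 * z * (Ideal.absNorm I : ℤ)) :
    (S.card : ℝ) ≤ 8 * N / √q := by
  classical
  choose! hN m n hn hsp heq using hS
  have hinj : Set.InjOn (fun I => (m I, n I)) S := by
    intro I hI I' hI' he
    simp only [Prod.mk.injEq] at he
    apply mul_right_cancel₀ hJ.ne_zero
    rw [hsp I hI, hsp I' hI', he.1, he.2]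
  rw [← Finset.card_image_of_injOn hinj]
  have hmem : ∀ I ∈ S, (m I : 𝓞 K) + n I * ω ∈ J := by
    intro I hI
    have : (m I : 𝓞 K) + n I * ω ∈ I * J := by
      rw [hsp I hI]; exact Ideal.mem_span_singleton_self _
    have hle : I * J ≤ J := Ideal.mul_le_right
    exact hle this
  refine card_lattice_le (b := b) (Nat.pos_of_ne_zero hJ.1) hzq (Nat.cast_nonneg N) ?_ ?_
  · intro p hp
    rw [Finset.mem_image] at hp
    obtain ⟨I, hI, rfl⟩ := hp
    refine ⟨hn I hI, ?_⟩
    have h1 : ((2 * m I + b * n I : ℝ)) ^ 2 + q * (n I : ℝ) ^ 2 = 4 * z * (Ideal.absNorm I : ℝ) := by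
      exact_mod_cast heq I hI
    have h2 : (Ideal.absNorm I : ℝ) ≤ N := by exact_mod_cast hN I hI
    simp only
    rw [h1]
    gcongr
  · intro p hp p' hp' he
    rw [Finset.mem_image] at hp hp'
    obtain ⟨I, hI, rfl⟩ := hp
    obtain ⟨I', hI', rfl⟩ := hp'
    simp only at he ⊢
    have h3 : ((m I - m I' : ℤ) : 𝓞 K) ∈ J := by
      have := J.sub_mem (hmem I hI) (hmem I' hI')
      rw [he] at this
      have e : ((m I - m I' : ℤ) : 𝓞 K) = m I + n I' * ω - (m I' + n I' * ω) := by push_cast; ring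
      rw [e]; exact this
    have h4 := hJ.dvd_of_mem h3
    have h5 : ((z : ℤ) : 𝓞 K) ∣ (((m I - m I') * (m I - m I') : ℤ) : 𝓞 K) + ((0 : ℤ) : 𝓞 K) * ω := by
      push_cast at h4 ⊢
      simpa using h4
    have h6 := (hω.intCast_dvd h5).1
    rw [← pow_two] at h6
    exact ((Int.squarefree_natCast.2 hsf).dvd_pow_iff_dvd two_ne_zero).1 h6

open Classical in
theorem IsQuadGen.idealCount_le (hω : IsQuadGen a b ω) {q : ℕ}
    (hq : (q : ℤ) = -(b ^ 2 + 4 * a)) (hC : ∀ C : ClassGroup (𝓞 K), C * C = 1)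
    {J : ClassGroup (𝓞 K) → Ideal (𝓞 K)} {z : ClassGroup (𝓞 K) → ℕ} (hz : Function.Injective z)
    (hJ : ∀ C, SqEqNat (J C) (z C) ∧ InClass (J C) C ∧ Squarefree (z C) ∧
        z C ∣ q ∧ (z C) ^ 2 ≤ q) :
    ∃ (Z : Finset ℕ) (g : ℕ → ℝ), (∀ w ∈ Z, Squarefree w ∧ w ∣ q ∧ w ^ 2 ≤ q) ∧ (∀ n, 0 ≤ g n) ∧
      (∀ N : ℕ, ∑ n ∈ Finset.Icc 1 N, g n ≤ 8 * Fintype.card (ClassGroup (𝓞 K)) / √q * N) ∧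
      ∀ n : ℕ, n ≠ 0 → (idealCount K n : ℝ) ≤ {w ∈ Z | ∃ k, n = w * k ^ 2}.card + g n := by
  let T1 : Ideal (𝓞 K) → Prop := fun I => ∃ C, ∃ k : ℕ, I = Ideal.span {(k : 𝓞 K)} * J C
  let S : ℕ → Finset (Ideal (𝓞 K)) := fun n =>
    if h : n = 0 then ∅ else (Ideal.finite_setOfPred_absNorm_eq (S := 𝓞 K) n).toFinset
  have hS : ∀ n, n ≠ 0 → ∀ I, I ∈ S n ↔ Ideal.absNorm I = n := by
    intro n hn I
    simp [S, hn]
  refine ⟨Finset.univ.image z, fun n => ((S n).filter (fun I => ¬ T1 I)).card, ?_, ?_, ?_, ?_⟩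
  · intro w hw
    rw [Finset.mem_image] at hw
    obtain ⟨C, -, rfl⟩ := hw
    exact (hJ C).2.2
  · intro n; positivity
  · intro N
    have hdisj : ((Finset.Icc 1 N : Finset ℕ) : Set ℕ).PairwiseDisjoint
        (fun n => (S n).filter (fun I => ¬ T1 I)) := by
      intro n hn n' hn' hne
      rw [Function.onFun, Finset.disjoint_left]
      intro I hI hI'
      have h1 : n ≠ 0 := by simp at hn; omega
      have h2 : n' ≠ 0 := by simp at hn'; omega
      rw [Finset.mem_filter, hS _ h1] at hI
      rw [Finset.mem_filter, hS _ h2] at hI'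
      exact hne (hI.1.symm.trans hI'.1)
    rw [← Nat.cast_sum, ← Finset.card_biUnion hdisj]
    set U := (Finset.Icc 1 N).biUnion (fun n => (S n).filter (fun I => ¬ T1 I)) with hU
    have hUm : ∀ I ∈ U, I ≠ 0 ∧ Ideal.absNorm I ≤ N ∧ ¬ T1 I := by
      intro I hI
      rw [hU, Finset.mem_biUnion] at hI
      obtain ⟨n, hn, hI⟩ := hI
      rw [Finset.mem_Icc] at hn
      have h1 : n ≠ 0 := by omega
      rw [Finset.mem_filter, hS _ h1] at hI
      refine ⟨?_, by omega, hI.2⟩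
      rintro rfl
      rw [Ideal.zero_eq_bot, Ideal.absNorm_bot] at hI
      omega
    let P : ClassGroup (𝓞 K) → Ideal (𝓞 K) → Prop := fun C I =>
      ∃ m n : ℤ, 1 ≤ n ∧ I * J C = Ideal.span {(m : 𝓞 K) + n * ω} ∧
        (2 * m + b * n) ^ 2 + q * n ^ 2 = 4 * z C * (Ideal.absNorm I : ℤ)
    have hsub : U ⊆ Finset.univ.biUnion (fun C => U.filter (P C)) := by
      intro I hI
      obtain ⟨h0, hN, hT⟩ := hUm I hI
      obtain ⟨C, h | h⟩ := hω.ideal_cases hq hC hJ h0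
      · exact absurd ⟨C, h⟩ hT
      · rw [Finset.mem_biUnion]
        exact ⟨C, Finset.mem_univ _, Finset.mem_filter.2 ⟨hI, h⟩⟩
    have hle : (U.card : ℝ) ≤ ∑ C : ClassGroup (𝓞 K), ((U.filter (P C)).card : ℝ) := by
      exact_mod_cast (Finset.card_le_card hsub).trans Finset.card_biUnion_le
    refine hle.trans ?_
    have : ∀ C ∈ (Finset.univ : Finset (ClassGroup (𝓞 K))),
        ((U.filter (P C)).card : ℝ) ≤ 8 * N / √q := by
      intro C _
      obtain ⟨hsq, -, hsf, -, hzq⟩ := hJ C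
      refine hω.card_ideals_le hsq hsf hzq ?_
      intro I hI
      rw [Finset.mem_filter] at hI
      exact ⟨(hUm I hI.1).2.1, hI.2⟩
    refine (Finset.sum_le_sum this).trans (le_of_eq ?_)
    rw [Finset.sum_const, Finset.card_univ, nsmul_eq_mul]
    ring
  · intro n hn
    have h1 : idealCount K n = (S n).card := by
      rw [idealCount, ← Nat.card_eq_finsetCard]
      exact Nat.card_congr (Equiv.subtypeEquivRight fun I => (hS n hn I).symm)
    rw [h1, ← Finset.card_filter_add_card_filter_not (s := S n) T1]
    push_cast
    gcongr
    choose! C k hk using fun I (h : T1 I) => h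
    refine Finset.card_le_card_of_injOn (fun I => z (C I)) ?_ ?_
    · intro I hI
      rw [Finset.mem_coe, Finset.mem_filter, hS n hn] at hI
      obtain ⟨hI, hT⟩ := hI
      simp only [Finset.coe_filter, Finset.mem_image, Finset.mem_univ, true_and]
      refine ⟨⟨C I, rfl⟩, k I, ?_⟩
      have h2 := congrArg Ideal.absNorm (hk I hT)
      rw [hI, map_mul, absNorm_of_sqEqNat hω (hJ _).1, Ideal.absNorm_span_natCast,
        RingOfIntegers.rank, hω.finrank_eq] at h2
      rw [h2, mul_comm]
    · intro I hI I' hI' he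
      rw [Finset.mem_coe, Finset.mem_filter, hS n hn] at hI hI'
      have hCC : C I = C I' := hz he
      have h2 := congrArg Ideal.absNorm (hk I hI.2)
      have h3 := congrArg Ideal.absNorm (hk I' hI'.2)
      rw [hI.1, map_mul, absNorm_of_sqEqNat hω (hJ _).1, Ideal.absNorm_span_natCast,
        RingOfIntegers.rank, hω.finrank_eq] at h2
      rw [hI'.1, map_mul, absNorm_of_sqEqNat hω (hJ _).1, Ideal.absNorm_span_natCast,
        RingOfIntegers.rank, hω.finrank_eq, ← hCC] at h3
      have hkk : k I = k I' := by
        apply Nat.pow_left_injective (n := 2) (by norm_num)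
        exact Nat.eq_of_mul_eq_mul_right (Nat.pos_of_ne_zero (hJ (C I)).1.1) (h2.symm.trans h3)
      rw [hk I hI.2, hk I' hI'.2, ← hCC, hkk]

end

end ExponentTwo

namespace ExponentTwo

section

variable {K : Type*} [Field K] [NumberField K] {a b : ℤ} {ω : 𝓞 K}

theorem finite_idealCount {n : ℕ} (hn : n ≠ 0) :
    Finite {I : Ideal (𝓞 K) // Ideal.absNorm I = n} :=
  Ideal.finite_setOfPred_absNorm_eq (S := 𝓞 K) n

theorem one_le_idealCount {n : ℕ} (hn : n ≠ 0) {I : Ideal (𝓞 K)} (hI : Ideal.absNorm I = n) :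
    1 ≤ idealCount K n := by
  have := finite_idealCount (K := K) hn
  rw [Nat.one_le_iff_ne_zero, idealCount]
  have : Nonempty {I : Ideal (𝓞 K) // Ideal.absNorm I = n} := ⟨⟨I, hI⟩⟩
  exact Nat.card_pos.ne'

theorem one_le_idealCount_one : 1 ≤ idealCount K 1 :=
  one_le_idealCount one_ne_zero (I := ⊤) (Ideal.absNorm_top)

theorem idealCount_mul_le {m n : ℕ} (hm : m ≠ 0) (hn : n ≠ 0) (hmn : m.Coprime n) :
    idealCount K m * idealCount K n ≤ idealCount K (m * n) := by
  have := finite_idealCount (K := K) (mul_ne_zero hm hn)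
  rw [idealCount, idealCount, idealCount, ← Nat.card_prod]
  have key : ∀ {m n : ℕ}, m.Coprime n → ∀ {I J : Ideal (𝓞 K)}, Ideal.absNorm I = m →
      Ideal.absNorm J = n → I = I * J ⊔ Ideal.span {(m : 𝓞 K)} := by
    intro m n hmn I J hI hJ
    have hmI : (m : 𝓞 K) ∈ I := by rw [← hI]; exact Ideal.absNorm_mem I
    have hnJ : (n : 𝓞 K) ∈ J := by rw [← hJ]; exact Ideal.absNorm_mem J
    apply le_antisymm
    · intro x hx
      obtain ⟨u, v, huv⟩ := Nat.isCoprime_iff_coprime.2 hmn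
      have h1 : (u : 𝓞 K) * m + v * n = 1 := by exact_mod_cast congrArg (Int.cast : ℤ → 𝓞 K) huv
      have h2 : x = x * (v * n) + (u * x) * m := by linear_combination x * (-h1)
      rw [h2]
      refine Submodule.add_mem_sup (Ideal.mul_mem_mul hx (J.mul_mem_left _ hnJ)) ?_
      exact Ideal.mul_mem_left _ _ (Ideal.mem_span_singleton_self _)
    · refine sup_le Ideal.mul_le_left ?_
      rw [Ideal.span_singleton_le_iff_mem]; exact hmI
  refine Nat.card_le_card_of_injective (fun p => ⟨p.1.1 * p.2.1, by
    rw [map_mul, p.1.2, p.2.2]⟩) ?_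
  rintro ⟨⟨I, hI⟩, ⟨J, hJ⟩⟩ ⟨⟨I', hI'⟩, ⟨J', hJ'⟩⟩ he
  simp only [Subtype.mk.injEq] at he
  have h1 : I = I' := by rw [key hmn hI hJ, key hmn hI' hJ', he]
  have h2 : J = J' := by
    rw [key hmn.symm hJ hI, key hmn.symm hJ' hI', mul_comm J, mul_comm J', he]
  simp only [h1, h2]

theorem le_idealCount_of_prime_pow {r : ℕ → ℝ} (h1 : r 1 ≤ 1) (h0 : ∀ n, 0 ≤ r n)
    (hmul : ∀ m n, m.Coprime n → r (m * n) = r m * r n)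
    (hp : ∀ p k : ℕ, p.Prime → 0 < k → r (p ^ k) ≤ idealCount K (p ^ k)) {n : ℕ} (hn : n ≠ 0) :
    r n ≤ idealCount K n := by
  induction n using Nat.recOnPosPrimePosCoprime with
  | prime_pow p k hpp hk => exact hp p k hpp hk
  | zero => exact absurd rfl hn
  | one => exact h1.trans (by exact_mod_cast one_le_idealCount_one)
  | coprime m n hm hn' hmn ihm ihn =>
    rw [hmul m n hmn]
    have := idealCount_mul_le (K := K) (by omega : m ≠ 0) (by omega : n ≠ 0) hmn
    have h3 : (idealCount K m : ℝ) * idealCount K n ≤ idealCount K (m * n) := by exact_mod_cast this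
    exact (mul_le_mul (ihm (by omega)) (ihn (by omega)) (h0 n) (by positivity)).trans h3

theorem IsQuadGen.absNorm_root (hω : IsQuadGen a b ω) {p : ℕ} (hp : p.Prime) {x : ℤ}
    (hx : (p : ℤ) ∣ x ^ 2 - b * x - a) :
    Ideal.absNorm (Ideal.span {(p : 𝓞 K), ω - x}) = p := by
  set P : Ideal (𝓞 K) := Ideal.span {(p : 𝓞 K), ω - x} with hP
  have hle : Ideal.span {(p : 𝓞 K)} ≤ P := Ideal.span_mono (by simp)
  have hnd : ∀ y : ℤ, ¬ ((p : 𝓞 K) ∣ ω - y) := by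
    intro y hy
    have h1 : ((p : ℤ) : 𝓞 K) ∣ ((-y : ℤ) : 𝓞 K) + ((1 : ℤ) : 𝓞 K) * ω := by
      push_cast
      convert hy using 1; ring
    have h2 := (hω.intCast_dvd h1).2
    have := Int.eq_one_of_dvd_one (by positivity) h2
    exact hp.one_lt.ne' (by exact_mod_cast this)
  have hmul : ∀ y ∈ P, (p : 𝓞 K) ∣ y * (ω - ((b - x : ℤ) : 𝓞 K)) := by
    intro y hy
    rw [hP, Ideal.mem_span_pair] at hy
    obtain ⟨u, v, rfl⟩ := hy
    obtain ⟨c, hc⟩ := hx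
    have hc' : (x : 𝓞 K) ^ 2 - b * x - a = p * c := by exact_mod_cast congrArg (Int.cast : ℤ → 𝓞 K) hc
    refine ⟨u * (ω - ((b - x : ℤ) : 𝓞 K)) - v * c, ?_⟩
    push_cast
    linear_combination v * hω.sq - v * hc'
  have hne1 : Ideal.absNorm P ≠ 1 := by
    rw [Ne, Ideal.absNorm_eq_one_iff]
    intro h
    have := hmul 1 (by rw [h]; trivial)
    rw [one_mul] at this
    exact hnd _ this
  have hnp : Ideal.absNorm (Ideal.span {(p : 𝓞 K)}) = p ^ 2 := by
    rw [Ideal.absNorm_span_natCast, RingOfIntegers.rank, hω.finrank_eq]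
  have hdvd : Ideal.absNorm P ∣ p ^ 2 := by
    rw [← hnp]; exact Ideal.absNorm_dvd_absNorm_of_le hle
  obtain ⟨k, hk, hk2⟩ := (Nat.dvd_prime_pow hp).1 hdvd
  have hk0 : k ≠ 0 := by rintro rfl; exact hne1 (by simpa using hk2)
  have hk3 : k ≠ 2 := by
    rintro rfl
    obtain ⟨Q, hQ⟩ := Ideal.dvd_iff_le.2 hle
    have h1 := congrArg Ideal.absNorm hQ
    rw [map_mul, hk2, hnp] at h1
    have hQ1 : Ideal.absNorm Q = 1 := by
      have : 0 < p ^ 2 := pow_pos hp.pos 2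
      exact Nat.eq_of_mul_eq_mul_left this (by rw [← h1, mul_one])
    rw [Ideal.absNorm_eq_one_iff] at hQ1
    rw [hQ1, Ideal.mul_top] at hQ
    have : ω - x ∈ P := Ideal.subset_span (by simp)
    rw [← hQ, Ideal.mem_span_singleton] at this
    exact hnd x this
  have : k = 1 := by omega
  rw [hk2, this, pow_one]

theorem IsQuadGen.one_le_idealCount_of_root (hω : IsQuadGen a b ω) {p : ℕ} (hp : p.Prime) {x : ℤ}
    (hx : (p : ℤ) ∣ x ^ 2 - b * x - a) (k : ℕ) : 1 ≤ idealCount K (p ^ k) := by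
  refine one_le_idealCount (pow_ne_zero _ hp.ne_zero)
    (I := Ideal.span {(p : 𝓞 K), ω - x} ^ k) ?_
  rw [map_pow, hω.absNorm_root hp hx]

theorem IsQuadGen.one_le_idealCount_even (hω : IsQuadGen a b ω) {p : ℕ} (hp : p.Prime) {k : ℕ}
    (hk : Even k) : 1 ≤ idealCount K (p ^ k) := by
  obtain ⟨l, rfl⟩ := hk
  refine one_le_idealCount (pow_ne_zero _ hp.ne_zero) (I := Ideal.span {((p ^ l : ℕ) : 𝓞 K)}) ?_
  rw [Ideal.absNorm_span_natCast, RingOfIntegers.rank, hω.finrank_eq]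
  ring

theorem IsQuadGen.succ_le_idealCount (hω : IsQuadGen a b ω) {p : ℕ} (hp : p.Prime) {x y : ℤ}
    (hx : (p : ℤ) ∣ x ^ 2 - b * x - a) (hy : (p : ℤ) ∣ y ^ 2 - b * y - a)
    (hxy : ¬ (p : ℤ) ∣ x - y) (k : ℕ) : k + 1 ≤ idealCount K (p ^ k) := by
  have hpk := pow_ne_zero k hp.ne_zero
  have := finite_idealCount (K := K) hpk
  set P : Ideal (𝓞 K) := Ideal.span {(p : 𝓞 K), ω - x} with hP
  set Q : Ideal (𝓞 K) := Ideal.span {(p : 𝓞 K), ω - y} with hQ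
  have nP : Ideal.absNorm P = p := hω.absNorm_root hp hx
  have nQ : Ideal.absNorm Q = p := hω.absNorm_root hp hy
  have hcop : IsCoprime P Q := by
    rw [Ideal.isCoprime_iff_add, Ideal.one_eq_top, Ideal.eq_top_iff_one]
    have h1 : (p : 𝓞 K) ∈ P + Q := Ideal.mem_sup_left (Ideal.subset_span (by simp))
    have h2 : ω - x ∈ P + Q := Ideal.mem_sup_left (Ideal.subset_span (by simp))
    have h3 : ω - y ∈ P + Q := Ideal.mem_sup_right (Ideal.subset_span (by simp))
    have hc : IsCoprime (p : ℤ) (x - y) :=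
      (Nat.prime_iff_prime_int.1 hp).coprime_iff_not_dvd.2 hxy
    obtain ⟨u, v, huv⟩ := hc
    have h4 : (u : 𝓞 K) * p + v * (x - y) = 1 := by exact_mod_cast congrArg (Int.cast : ℤ → 𝓞 K) huv
    have h5 : (1 : 𝓞 K) = u * p + v * ((ω - y) - (ω - x)) := by rw [← h4]; ring
    rw [h5]
    exact Ideal.add_mem _ (Ideal.mul_mem_left _ _ h1)
      (Ideal.mul_mem_left _ _ (Ideal.sub_mem _ h3 h2))
  have hP0 : P ≠ 0 := by rintro h; rw [h, Ideal.zero_eq_bot, Ideal.absNorm_bot] at nP; exact hp.ne_zero nP.symm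
  have hQ0 : Q ≠ 0 := by rintro h; rw [h, Ideal.zero_eq_bot, Ideal.absNorm_bot] at nQ; exact hp.ne_zero nQ.symm
  have key : ∀ i j : ℕ, i < j → j ≤ k → P ^ i * Q ^ (k - i) ≠ P ^ j * Q ^ (k - j) := by
    intro i j hij hjk he
    have e1 : P ^ i * Q ^ (k - i) = (P ^ i * Q ^ (k - j)) * Q ^ (j - i) := by
      rw [mul_assoc, ← pow_add]; congr 2; omega
    have e2 : P ^ j * Q ^ (k - j) = (P ^ i * Q ^ (k - j)) * P ^ (j - i) := by
      rw [mul_right_comm, ← pow_add]; congr 2; omega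
    rw [e1, e2] at he
    have h1 := mul_left_cancel₀ (mul_ne_zero (pow_ne_zero i hP0) (pow_ne_zero (k - j) hQ0)) he
    have h2 : IsCoprime (P ^ (j - i)) (Q ^ (j - i)) := hcop.pow
    rw [h1, isCoprime_self] at h2
    have h3 := Ideal.isUnit_iff.1 h2
    have h4 := congrArg Ideal.absNorm h3
    rw [map_pow, nP, Ideal.absNorm_top] at h4
    have h5 : 1 < p ^ (j - i) := Nat.one_lt_pow (by omega) hp.one_lt
    omega
  have hcard : Nat.card (Fin (k + 1)) ≤ idealCount K (p ^ k) := by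
    refine Nat.card_le_card_of_injective (fun i : Fin (k + 1) => ⟨P ^ (i : ℕ) * Q ^ (k - i), by
      rw [map_mul, map_pow, map_pow, nP, nQ, ← pow_add]; congr 1; omega⟩) ?_
    intro i j he
    simp only [Subtype.mk.injEq] at he
    by_contra hne
    rcases lt_or_gt_of_ne (fun h => hne (Fin.ext h)) with h | h
    · exact key i j h (by omega) he
    · exact key j i h (by omega) he.symm
  simpa using hcard

end

end ExponentTwo

namespace ExponentTwo

open NumberTheorySymbols

theorem exists_nat_modEq_of_coprime {A B : ℕ} (hAB : A.Coprime B) (x y : ℕ) :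
    ∃ n : ℕ, n ≡ x [MOD A] ∧ n ≡ y [MOD B] :=
  ⟨Nat.chineseRemainder hAB x y, (Nat.chineseRemainder hAB x y).2⟩

theorem exists_jacobi_neg_one {d : ℤ} (hd0 : d ≠ 0) (hd : ¬ IsSquare d) :
    ∃ n : ℕ, Odd n ∧ J(d | n) = -1 := by
  obtain ⟨s, a, hsa, hs⟩ := Nat.sq_mul_squarefree d.natAbs
  have hda : d.natAbs ≠ 0 := by omega
  have ha0 : a ≠ 0 := by rintro rfl; simp at hsa; omega
  have hs0 : s ≠ 0 := by rintro rfl; simp at hsa; omega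
  obtain ⟨σ, hσ, hdσ⟩ : ∃ σ : ℤ, (σ = 1 ∨ σ = -1) ∧ d = σ * (a ^ 2 * s : ℕ) := by
    rcases Int.natAbs_eq d with h | h
    · exact ⟨1, Or.inl rfl, by rw [hsa]; omega⟩
    · exact ⟨-1, Or.inr rfl, by rw [hsa]; omega⟩
  by_cases hodd : ∃ p : ℕ, p.Prime ∧ p ≠ 2 ∧ p ∣ s
  · obtain ⟨p, hp, hp2, t, rfl⟩ := hodd
    obtain ⟨i, a', ha', rfl⟩ := Nat.exists_eq_pow_mul_and_not_dvd ha0 p hp.ne_one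
    have hpt : ¬ p ∣ t := by
      rintro ⟨u, rfl⟩
      have := hs p ⟨u, by ring⟩
      exact hp.one_lt.ne' (Nat.isUnit_iff.1 this)
    set e : ℤ := σ * (t * a' ^ 2 : ℕ) with he
    have hde : d = p * (p ^ i) ^ 2 * e := by rw [hdσ, he]; push_cast; ring
    have hpodd : Odd p := hp.odd_of_ne_two hp2
    have hena : e.natAbs = t * a' ^ 2 := by
      rw [he, Int.natAbs_mul, Int.natAbs_natCast]
      rcases hσ with rfl | rfl <;> simp
    have hcop : p.Coprime (4 * e.natAbs) := by
      rw [hena, hp.coprime_iff_not_dvd, hp.dvd_mul, hp.dvd_mul]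
      rintro (h | h | h)
      · exact hp2 ((Nat.prime_dvd_prime_iff_eq hp Nat.prime_two).1 (hp.dvd_of_dvd_pow (n := 2) h))
      · exact hpt h
      · exact ha' (hp.dvd_of_dvd_pow h)
    have := Fact.mk hp
    obtain ⟨x, hx⟩ := FiniteField.exists_nonsquare (F := ZMod p) (by
      rw [ringChar.eq (ZMod p) p]; exact hp2)
    obtain ⟨n, hn1, hn2⟩ := exists_nat_modEq_of_coprime hcop x.val 1
    have hn4 : n % 4 = 1 := by
      have := hn2.of_dvd (Dvd.intro _ rfl)
      exact this
    have hnodd : Odd n := Nat.odd_iff.2 (by omega)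
    refine ⟨n, hnodd, ?_⟩
    have hJe : J(e | n) = 1 := by
      rw [jacobiSym.mod_right e hnodd]
      have h5 : n % (4 * e.natAbs) = 1 % (4 * e.natAbs) := hn2
      rw [h5, ← jacobiSym.mod_right e odd_one, jacobiSym.one_right]
    have hJp : J(p | n) = -1 := by
      rw [jacobiSym.quadratic_reciprocity_one_mod_four' hpodd hn4]
      have h6 : ((n : ℤ) : ZMod p) = x := by
        have := (ZMod.natCast_eq_natCast_iff n x.val p).2 hn1
        rw [ZMod.natCast_zmod_val] at this
        exact_mod_cast this
      rw [← jacobiSym.legendreSym.to_jacobiSym, legendreSym.eq_neg_one_iff, h6]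
      exact hx
    rw [hde, jacobiSym.mul_left, jacobiSym.mul_left, jacobiSym.pow_left, jacobiSym.pow_left, hJe,
      hJp, ← pow_mul, mul_comm i 2, pow_mul]
    norm_num
  · have hs12 : s = 1 ∨ s = 2 := by
      have h2 : s ∣ 2 := by
        have h3 := Nat.eq_prime_pow_of_unique_prime_dvd (p := 2) hs0 (fun {r} hr hrs => by
          by_contra h2
          exact hodd ⟨r, hr, h2, hrs⟩)
        set k := s.primeFactorsList.length
        by_cases hk : k ≤ 1
        · rw [h3]; exact pow_dvd_pow 2 hk |>.trans (by norm_num)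
        · have h4 : 2 * 2 ∣ s := by
            rw [h3, ← pow_two]; exact pow_dvd_pow 2 (by omega)
          exact absurd (hs 2 h4) (by norm_num)
      exact (Nat.dvd_prime Nat.prime_two).1 h2
    obtain ⟨i, a', ha', rfl⟩ := Nat.exists_eq_pow_mul_and_not_dvd ha0 2 (by norm_num)
    have hcop : Nat.Coprime a' 8 := by
      rw [show 8 = 2 ^ 3 by norm_num]
      exact Nat.Coprime.pow_right _ (Nat.coprime_two_right.2 (Nat.odd_iff.2 (by omega)))
    have key : ∀ c : ℕ, c % 2 = 1 → ∃ n : ℕ, n % 8 = c % 8 ∧ Odd n ∧ J(d | n) = J(σ * s | n) := by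
      intro c hc
      obtain ⟨n, hn1, hn2⟩ := exists_nat_modEq_of_coprime hcop 1 c
      have h8 : n % 8 = c % 8 := hn2
      have hnodd : Odd n := Nat.odd_iff.2 (by omega)
      refine ⟨n, h8, hnodd, ?_⟩
      have h1 : Int.gcd (a' : ℤ) n = 1 := by
        rw [Int.gcd_natCast_natCast]
        have : n.gcd a' = Nat.gcd 1 a' := hn1.gcd_eq
        rw [Nat.gcd_comm, this, Nat.gcd_one_left]
      have h2 : Int.gcd (2 : ℤ) n = 1 := by
        have : Nat.Coprime 2 n := Nat.coprime_two_left.2 hnodd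
        exact_mod_cast this
      have : d = ((2 : ℤ) ^ i) ^ 2 * (a' : ℤ) ^ 2 * (σ * s) := by rw [hdσ]; push_cast; ring
      rw [this, jacobiSym.mul_left, jacobiSym.mul_left, jacobiSym.pow_left, jacobiSym.pow_left,
        jacobiSym.sq_one' h1, ← pow_mul, mul_comm i 2, pow_mul, jacobiSym.sq_one h2]
      simp
    rcases hσ with rfl | rfl
    · rcases hs12 with rfl | rfl
      · exact absurd ⟨((2 ^ i * a' : ℕ) : ℤ), by rw [hdσ]; push_cast; ring⟩ hd
      · obtain ⟨n, hn8, hno, hJ⟩ := key 3 rfl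
        refine ⟨n, hno, ?_⟩
        rw [hJ, one_mul, Nat.cast_ofNat, jacobiSym.at_two hno, ZMod.χ₈_nat_mod_eight, hn8]
        rfl
    · obtain ⟨n, hn8, hno, hJ⟩ := key 7 rfl
      refine ⟨n, hno, ?_⟩
      rcases hs12 with rfl | rfl
      · rw [hJ, Nat.cast_one, mul_one, jacobiSym.at_neg_one hno, ZMod.χ₄_nat_mod_four,
          show n % 4 = 3 by omega]
        rfl
      · rw [hJ, show (-1 * (2 : ℕ) : ℤ) = -2 by norm_num, jacobiSym.at_neg_two hno,
          ZMod.χ₈'_nat_eq_if_mod_eight, hn8]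
        simp; omega

theorem exists_dirichletCharacter {N : ℕ} [NeZero N] {f : ℕ → ℤ} (h1 : f 1 = 1)
    (hmul : ∀ m n, f (m * n) = f m * f n) (hmod : ∀ n, f (n % N) = f n)
    (h0 : ∀ n, ¬ n.Coprime N → f n = 0) :
    ∃ χ : DirichletCharacter ℂ N, ∀ n : ℕ, χ n = f n := by
  have key : ∀ n : ℕ, f ((n : ZMod N).val) = f n := by
    intro n; rw [ZMod.val_natCast, hmod]
  refine ⟨⟨⟨⟨fun x => (f x.val : ℂ), ?_⟩, ?_⟩, ?_⟩, ?_⟩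
  · have := key 1
    rw [Nat.cast_one, h1] at this
    rw [this]; simp
  · intro x y
    have := key (x.val * y.val)
    rw [Nat.cast_mul, ZMod.natCast_zmod_val, ZMod.natCast_zmod_val, hmul] at this
    simp only [this]; push_cast; rfl
  · intro x hx
    simp only
    rw [h0, Int.cast_zero]
    intro hc
    apply hx
    have := (ZMod.isUnit_iff_coprime x.val N).2 hc
    rwa [ZMod.natCast_zmod_val] at this
  · intro n
    change ((f ((n : ZMod N).val) : ℤ) : ℂ) = _
    rw [key]

/-- `χ` is the Kronecker symbol of `D`. -/
structure IsKronecker (D : ℤ) {q : ℕ} (χ : DirichletCharacter ℂ q) : Prop where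
  odd : ∀ n : ℕ, Odd n → χ n = J(D | n)
  two : χ 2 = if D % 2 = 0 then 0 else if D % 8 = 1 then 1 else -1
  real : ∀ n : ℕ, χ n = 0 ∨ χ n = 1 ∨ χ n = -1

theorem exists_isKronecker {D : ℤ} (hD : IsFundamentalDiscriminant D) (hneg : D < 0) {q : ℕ}
    (hq : (q : ℤ) = -D) : ∃ χ : DirichletCharacter ℂ q, IsKronecker D χ := by
  have hq0 : q ≠ 0 := by omega
  have : NeZero q := ⟨hq0⟩
  have tri : ∀ {χ : DirichletCharacter ℂ q} {f : ℕ → ℤ}, (∀ n : ℕ, χ n = f n) →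
      (∀ n, f n = 0 ∨ f n = 1 ∨ f n = -1) → ∀ n : ℕ, χ n = 0 ∨ χ n = 1 ∨ χ n = -1 := by
    intro χ f hf ht n
    rw [hf]
    rcases ht n with h | h | h <;> simp [h]
  rcases hD.2 with ⟨h4, -⟩ | ⟨m, hm, -, -⟩
  · have hq4 : q % 4 = 3 := by omega
    obtain ⟨χ, hχ⟩ := exists_dirichletCharacter (N := q) (f := fun n => J(n | q))
      (by simp)
      (fun m n => by push_cast; exact jacobiSym.mul_left _ _ _)
      (fun n => by push_cast; exact (jacobiSym.mod_left _ _).symm)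
      (fun n hn => jacobiSym.eq_zero_iff.2 ⟨hq0, by rwa [Int.gcd_natCast_natCast]⟩)
    refine ⟨χ, ?_, ?_, tri hχ fun n => jacobiSym.trichotomy _ _⟩
    · intro n hn
      rw [hχ]
      congr 1
      have hqo : Odd q := Nat.odd_iff.2 (by omega)
      have hDq : D = -(q : ℤ) := by omega
      rw [hDq, jacobiSym.neg _ hn]
      rcases Nat.odd_mod_four_iff.1 (Nat.odd_iff.1 hn) with h | h
      · rw [jacobiSym.quadratic_reciprocity_one_mod_four h hqo, ZMod.χ₄_nat_one_mod_four h, one_mul]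
      · rw [jacobiSym.quadratic_reciprocity_three_mod_four h hq4, ZMod.χ₄_nat_three_mod_four h]
        ring
    · have h2 := hχ 2
      have hqo : Odd q := Nat.odd_iff.2 (by omega)
      push_cast at h2
      rw [h2, if_neg (by omega), jacobiSym.at_two hqo, ZMod.χ₈_nat_mod_eight]
      split_ifs with h
      · rw [show q % 8 = 7 by omega]; simp
      · rw [show q % 8 = 3 by omega]; simp
  · have hqm : q = 4 * m.natAbs := by omega
    obtain ⟨χ, hχ⟩ := exists_dirichletCharacter (N := q)
      (f := fun n => if n % 2 = 1 then J(m | n) else 0)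
      (by simp)
      (fun k n => by
        by_cases hk : k % 2 = 1
        · by_cases hn : n % 2 = 1
          · have : (k * n) % 2 = 1 := by rw [Nat.mul_mod, hk, hn]
            rw [if_pos hk, if_pos hn, if_pos this]
            exact jacobiSym.mul_right' _ (by omega) (by omega)
          · rw [if_neg hn, if_neg (by rw [Nat.mul_mod]; simp [Nat.mod_two_ne_one.1 hn]), mul_zero]
        · rw [if_neg hk, if_neg (by rw [Nat.mul_mod]; simp [Nat.mod_two_ne_one.1 hk]), zero_mul])
      (fun n => by
        have : n % q % 2 = n % 2 := Nat.mod_mod_of_dvd _ ⟨2 * m.natAbs, by omega⟩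
        simp only [this]
        split_ifs with h
        · rw [hqm, ← jacobiSym.mod_right m (Nat.odd_iff.2 h)]
        · rfl)
      (fun n hn => by
        split_ifs with h
        · refine jacobiSym.eq_zero_iff.2 ⟨by omega, fun hg => hn ?_⟩
          rw [hqm]
          refine Nat.Coprime.mul_right ?_ ?_
          · exact Nat.Coprime.pow_right 2 (Nat.coprime_two_right.2 (Nat.odd_iff.2 h))
          · rw [Nat.coprime_comm]
            simpa [Int.gcd] using hg
        · rfl)
    refine ⟨χ, ?_, ?_, tri hχ fun n => ?_⟩
    · intro n hn
      rw [hχ, if_pos (Nat.odd_iff.1 hn), hm, jacobiSym.mul_left, jacobiSym.at_four hn, one_mul]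
    · have h2 := hχ 2
      push_cast at h2
      rw [h2, if_pos (by omega)]
    · split_ifs
      · exact jacobiSym.trichotomy _ _
      · exact Or.inl rfl

theorem IsKronecker.roots_of_eq_one {D a b : ℤ} {q : ℕ} {χ : DirichletCharacter ℂ q}
    (hχ : IsKronecker D χ) (hb : b = D % 2) (ha : D = b ^ 2 + 4 * a) {p : ℕ} (hp : p.Prime)
    (h : χ p = 1) : ∃ x y : ℤ, (p : ℤ) ∣ x ^ 2 - b * x - a ∧ (p : ℤ) ∣ y ^ 2 - b * y - a ∧
      ¬ (p : ℤ) ∣ x - y := by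
  rcases hp.eq_two_or_odd' with rfl | hodd
  · have h2 := hχ.two
    push_cast at h
    rw [h] at h2
    split_ifs at h2 with h3 h4
    · simp at h2
    · have hb1 : b = 1 := by omega
      subst hb1
      refine ⟨0, 1, ?_, ?_, by norm_num⟩ <;> push_cast <;> omega
    · norm_num at h2
  · have := Fact.mk hp
    rw [hχ.odd p hodd] at h
    have hJ : J(D | p) = 1 := by exact_mod_cast h
    have hsq := ZMod.isSquare_of_jacobiSym_eq_one hJ
    obtain ⟨y, hy⟩ := hsq
    obtain ⟨c, hc⟩ := hodd
    have hpD : ¬ (p : ℤ) ∣ D := by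
      intro hd
      have h0 : J(D | p) = 0 := jacobiSym.eq_zero_iff.2 ⟨hp.ne_zero, by

          have h3 : ((D.gcd p : ℕ) : ℤ) = p := Int.gcd_eq_right (by positivity) hd
          rw [show D.gcd p = p by exact_mod_cast h3]; exact hp.ne_one⟩
      rw [h0] at hJ; norm_num at hJ
    set Y : ℤ := ((ZMod.val y : ℕ) : ℤ) with hY
    have hYy : ((Y : ℤ) : ZMod p) = y := by rw [hY]; simp
    have hdvd : (p : ℤ) ∣ D - Y ^ 2 := by
      rw [← ZMod.intCast_zmod_eq_zero_iff_dvd]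
      push_cast
      rw [hYy, hy]; ring
    have hp4 : IsCoprime (p : ℤ) 4 := by
      rw [Int.isCoprime_iff_gcd_eq_one]
      have : Nat.Coprime p 4 := by
        have : Nat.Coprime p (2 ^ 2) := Nat.Coprime.pow_right 2 (Nat.coprime_two_right.2 ⟨c, hc⟩)
        exact this
      exact_mod_cast this
    have hpc : (p : ℤ) = 2 * c + 1 := by exact_mod_cast hc
    obtain ⟨e, he⟩ := hdvd
    refine ⟨(b + Y) * (c + 1), (b - Y) * (c + 1), ?_, ?_, ?_⟩
    · apply hp4.dvd_of_dvd_mul_left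
      refine ⟨(b + Y) ^ 2 * (p + 2) - 2 * b * (b + Y) - e, ?_⟩
      linear_combination (-1) * he + ha - (b + Y) * ((b + Y) * (2 * c + 2 + p + 1) - 2 * b) * hpc
    · apply hp4.dvd_of_dvd_mul_left
      refine ⟨(b - Y) ^ 2 * (p + 2) - 2 * b * (b - Y) - e, ?_⟩
      linear_combination (-1) * he + ha - (b - Y) * ((b - Y) * (2 * c + 2 + p + 1) - 2 * b) * hpc
    · rintro ⟨k, hk⟩
      apply hpD
      have hYd : (p : ℤ) ∣ Y := ⟨k - Y, by linear_combination hk + Y * hpc⟩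
      obtain ⟨l, hl⟩ := hYd
      exact ⟨e + Y * l, by linear_combination he + Y * hl⟩

theorem root_of_dvd {D a b : ℤ} (hb : b = D % 2) (ha : D = b ^ 2 + 4 * a) {p : ℕ} (hp : p.Prime)
    (h : (p : ℤ) ∣ D) : ∃ x : ℤ, (p : ℤ) ∣ x ^ 2 - b * x - a := by
  rcases hp.eq_two_or_odd' with rfl | ⟨c, hc⟩
  · push_cast at h ⊢
    have hb0 : b = 0 := by omega
    subst hb0
    refine ⟨a, ?_⟩
    rcases Int.even_or_odd' a with ⟨k, rfl | rfl⟩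
    · exact ⟨2 * k ^ 2 - k, by ring⟩
    · exact ⟨2 * k ^ 2 + k, by ring⟩
  · obtain ⟨e, he⟩ := h
    have hp4 : IsCoprime (p : ℤ) 4 := by
      rw [Int.isCoprime_iff_gcd_eq_one]
      have : Nat.Coprime p (2 ^ 2) := Nat.Coprime.pow_right 2 (Nat.coprime_two_right.2 ⟨c, hc⟩)
      exact_mod_cast this
    have hpc : (p : ℤ) = 2 * c + 1 := by exact_mod_cast hc
    refine ⟨b * (c + 1), hp4.dvd_of_dvd_mul_left ⟨b ^ 2 * (p + 2) - 2 * b * b - e, ?_⟩⟩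
    linear_combination (-1) * he + ha - b * (b * (2 * c + 2 + p + 1) - 2 * b) * hpc

end ExponentTwo

namespace ExponentTwo

open DirichletCharacter Filter Topology

theorem IsKronecker.sq_eq_one {D : ℤ} {q : ℕ} [NeZero q] {χ : DirichletCharacter ℂ q}
    (hχ : IsKronecker D χ) : χ ^ 2 = 1 := by
  rw [← MulChar.isQuadratic_iff_sq_eq_one]
  intro x
  have := hχ.real x.val
  rwa [ZMod.natCast_zmod_val] at this

theorem zetaMul_prime_pow {N : ℕ} (χ : DirichletCharacter ℂ N) {p : ℕ} (hp : p.Prime) (k : ℕ) :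
    zetaMul χ (p ^ k) = ∑ i ∈ Finset.range (k + 1), (χ p) ^ i := by
  refine (ArithmeticFunction.coe_zeta_mul_apply (f := toArithmeticFunction (χ ·))
    (x := p ^ k)).trans ?_
  rw [Nat.sum_divisors_prime_pow hp]
  refine Finset.sum_congr rfl fun i _ => ?_
  rw [← χ.apply_eq_toArithmeticFunction_apply (pow_ne_zero _ hp.ne_zero), Nat.cast_pow, map_pow]

theorem zetaMul_eq_ofReal {N : ℕ} {χ : DirichletCharacter ℂ N} (hχ : χ ^ 2 = 1) (n : ℕ) :
    zetaMul χ n = ((zetaMul χ n).re : ℂ) := by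
  have h := zetaMul_nonneg hχ n
  rw [Complex.le_def] at h
  exact Complex.ext rfl (by simpa using h.2.symm)

theorem zetaMul_re_nonneg {N : ℕ} {χ : DirichletCharacter ℂ N} (hχ : χ ^ 2 = 1) (n : ℕ) :
    0 ≤ (zetaMul χ n).re := (Complex.le_def.1 (zetaMul_nonneg hχ n)).1

section

variable {K : Type*} [Field K] [NumberField K] {a b : ℤ} {ω : 𝓞 K}

theorem IsQuadGen.zetaMul_le_idealCount (hω : IsQuadGen a b ω) {D : ℤ} {q : ℕ} (hq0 : q ≠ 0)
    {χ : DirichletCharacter ℂ q} (hχ : IsKronecker D χ) (hqD : (q : ℤ) = -D)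
    (hb : b = D % 2) (ha : D = b ^ 2 + 4 * a) {n : ℕ} (hn : n ≠ 0) :
    (zetaMul χ n).re ≤ idealCount K n := by
  have : NeZero q := ⟨hq0⟩
  have h2 := hχ.sq_eq_one
  refine le_idealCount_of_prime_pow (r := fun n => (zetaMul χ n).re) ?_
    (fun n => zetaMul_re_nonneg h2 n) ?_ ?_ hn
  · simp [χ.isMultiplicative_zetaMul.1]
  · intro m n hmn
    rw [χ.isMultiplicative_zetaMul.2 hmn, zetaMul_eq_ofReal h2 m, zetaMul_eq_ofReal h2 n,
      ← Complex.ofReal_mul, Complex.ofReal_re, Complex.ofReal_re, Complex.ofReal_re]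
  · intro p k hp hk
    rw [zetaMul_prime_pow χ hp]
    rcases hχ.real p with h | h | h
    · have hpD : (p : ℤ) ∣ D := by
        have hnu : ¬ IsUnit ((p : ZMod q)) := by
          intro hu
          exact (hu.map χ).ne_zero h
        rw [ZMod.isUnit_iff_coprime, hp.coprime_iff_not_dvd, not_not] at hnu
        have h3 : (p : ℤ) ∣ q := by exact_mod_cast hnu
        rw [hqD] at h3
        exact (dvd_neg.1 h3)
      obtain ⟨x, hx⟩ := root_of_dvd hb ha hp hpD
      have := hω.one_le_idealCount_of_root hp hx k
      rw [h, Finset.sum_range_succ']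
      simp
      exact_mod_cast this
    · obtain ⟨x, y, hx, hy, hxy⟩ := hχ.roots_of_eq_one hb ha hp h
      have := hω.succ_le_idealCount hp hx hy hxy k
      rw [h]
      simp
      exact_mod_cast this
    · rw [h, neg_one_geom_sum]
      split_ifs with he
      · simp
      · have : Even k := by
          rw [Nat.even_add_one, not_not] at he; exact he
        have := hω.one_le_idealCount_even hp this
        simp
        exact_mod_cast this

theorem tendsto_sum_idealCount (K : Type*) [Field K] [NumberField K] :
    Tendsto (fun n : ℕ => (∑ k ∈ Finset.Icc 1 n, (idealCount K k : ℝ)) / n) atTop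
      (𝓝 (dedekindZeta_residue K)) := by
  refine ((Ideal.tendsto_norm_le_div_atTop₀ K).comp tendsto_natCast_atTop_atTop).congr fun n ↦ ?_
  simp only [Function.comp_apply, Nat.cast_le, ← Nat.cast_sum, idealCount]
  congr
  rw [← add_left_inj 1, ← Ideal.card_norm_le_eq_card_norm_le_add_one,
    show Finset.Icc 1 n = Finset.Ioc 0 n from Finset.Icc_succ_left_eq_Ioc _ _,
    show 1 = Nat.card {I : Ideal (𝓞 K) // Ideal.absNorm I = 0} by simp [Ideal.absNorm_eq_zero_iff],
    Finset.sum_Ioc_add_eq_sum_Icc (n.zero_le),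
    ← Finset.card_preimage_eq_sum_card_image_eq (fun k _ ↦ Ideal.finite_setOfPred_absNorm_eq k)]
  simp [Set.coe_eq_subtype]

theorem summable_idealCount (K : Type*) [Field K] [NumberField K] {s : ℝ} (hs : 1 < s) :
    LSeriesSummable (fun n => ((idealCount K n : ℝ) : ℂ)) s := by
  refine LSeriesSummable_of_sum_norm_bigO_and_nonneg (f := fun n => (idealCount K n : ℝ))
    (r := 1) ?_ (fun _ => Nat.cast_nonneg _) zero_le_one (by simpa using hs)
  have h := (tendsto_sum_idealCount K).isBigO_one ℝ
  simp only [Real.rpow_one]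
  have h2 := h.mul (Asymptotics.isBigO_refl (fun n : ℕ => (n : ℝ)) atTop)
  refine (h2.congr' ?_ ?_)
  · filter_upwards [eventually_ne_atTop 0] with n hn
    field_simp
  · filter_upwards with n
    simp

theorem abs_det_of_isEmpty {n : Type*} {_ : DecidableEq n} {_ : Fintype n} (M : Matrix n n ℝ)
    (h : n → False) : |M.det| = 1 := by
  have : IsEmpty n := ⟨h⟩
  rw [Matrix.det_isEmpty, abs_one]

theorem IsQuadGen.residue_le (hω : IsQuadGen a b ω) {q : ℕ} (hq0 : q ≠ 0)
    (hq : (q : ℤ) = -(b ^ 2 + 4 * a)) :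
    dedekindZeta_residue K ≤ Real.pi * Fintype.card (ClassGroup (𝓞 K)) / √q := by
  have hd : discr K = -(q : ℤ) := by rw [hω.discr_eq, hq]; ring
  have hrk := InfinitePlace.card_add_two_mul_card_eq_rank K
  rw [hω.finrank_eq] at hrk
  have hr2 : InfinitePlace.nrComplexPlaces K = 1 := by
    by_contra hne
    have h0 : InfinitePlace.nrComplexPlaces K = 0 := by omega
    have := sign_discr K
    rw [h0, hd, pow_zero, Int.sign_eq_one_iff_pos] at this
    omega
  have hr1 : InfinitePlace.nrRealPlaces K = 0 := by omega
  have hreg : Units.regulator K = 1 := by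
    have hcard : Fintype.card (InfinitePlace K) = 1 := by
      rw [InfinitePlace.card_eq_nrRealPlaces_add_nrComplexPlaces]; omega
    have hsub : ∀ v w : InfinitePlace K, v = w := Fintype.card_le_one_iff.1 hcard.le
    obtain ⟨w⟩ : Nonempty (InfinitePlace K) := inferInstance
    have hw : ∀ x : {w' : InfinitePlace K // w' ≠ w}, False := fun x => x.2 (hsub _ _)
    have hrank : Units.rank K = 0 := by rw [Units.rank, hcard]
    let e : {w' : InfinitePlace K // w' ≠ w} ≃ Fin (Units.rank K) :=
      ⟨fun x => (hw x).elim, fun x => (by rw [hrank] at x; exact x.elim0),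
        fun x => (hw x).elim, fun x => (by rw [hrank] at x; exact x.elim0)⟩
    exact (Units.regulator_eq_det K w e).trans (abs_det_of_isEmpty _ hw)
  rw [dedekindZeta_residue_def, hr1, hr2, hreg, hd]
  have hw : (2 : ℝ) ≤ Units.torsionOrder K := by
    have h1 := Units.even_torsionOrder K
    have h2 := Units.torsionOrder_pos K
    obtain ⟨c, hc⟩ := h1
    have : 2 ≤ Units.torsionOrder K := by omega
    exact_mod_cast this
  have hq' : (0 : ℝ) < q := by exact_mod_cast Nat.pos_of_ne_zero hq0
  have hsq : 0 < √(q : ℝ) := Real.sqrt_pos.2 hq'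
  have : |((-(q : ℤ) : ℤ) : ℝ)| = q := by push_cast; rw [abs_neg, abs_of_pos hq']
  rw [this, pow_zero, pow_one, one_mul, mul_one, classNumber]
  rw [div_le_div_iff₀ (by positivity) hsq]
  have : 0 ≤ Real.pi * Fintype.card (ClassGroup (𝓞 K)) * √q := by positivity
  nlinarith

theorem LSeries_zetaMul {q : ℕ} [NeZero q] (χ : DirichletCharacter ℂ q) {s : ℂ} (hs : 1 < s.re) :
    LSeries (zetaMul χ) s = riemannZeta s * LFunction χ s := by
  have h1 : (fun n => ((ArithmeticFunction.zeta : ArithmeticFunction ℂ) n)) =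
      fun n => ((ArithmeticFunction.zeta n : ℕ) : ℂ) := by
    ext n; rw [ArithmeticFunction.natCoe_apply]
  have h2 : LSeriesSummable (toArithmeticFunction (χ ·)) s :=
    (LSeriesSummable_congr _ fun h ↦ (χ.apply_eq_toArithmeticFunction_apply h).symm).mpr <|
      ZMod.LSeriesSummable_of_one_lt_re χ hs
  rw [zetaMul, ArithmeticFunction.LSeries_mul' _ h2, LFunction_eq_LSeries χ hs,
    ← LSeries_congr χ.apply_eq_toArithmeticFunction_apply s,
    ← ArithmeticFunction.LSeries_zeta_eq_riemannZeta hs]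
  · rw [h1]
  · rw [h1]; exact ArithmeticFunction.LSeriesSummable_zeta_iff.mpr hs

theorem LFunction_one_le_residue {q : ℕ} [NeZero q] {χ : DirichletCharacter ℂ q} (h2 : χ ^ 2 = 1)
    (hχ1 : χ ≠ 1) (hle : ∀ n : ℕ, n ≠ 0 → (zetaMul χ n).re ≤ idealCount K n) :
    (LFunction χ 1).re ≤ dedekindZeta_residue K := by
  have hcast : Tendsto (fun s : ℝ => (s : ℂ)) (𝓝[>] 1) (𝓝[≠] 1) := by
    rw [tendsto_nhdsWithin_iff]
    refine ⟨?_, ?_⟩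
    · exact (Complex.continuous_ofReal.tendsto' 1 1 (by simp)).mono_left nhdsWithin_le_nhds
    · filter_upwards [self_mem_nhdsWithin] with s hs
      simp only [Set.mem_compl_iff, Set.mem_singleton_iff]
      exact_mod_cast (ne_of_gt hs)
  have hL : Tendsto (fun s : ℝ => ((s : ℂ) - 1) * riemannZeta s * LFunction χ s) (𝓝[>] 1)
      (𝓝 (1 * LFunction χ 1)) := by
    refine (riemannZeta_residue_one.comp hcast).mul ?_
    exact ((differentiable_LFunction hχ1).continuous.tendsto 1).comp (hcast.mono_right nhdsWithin_le_nhds)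
  rw [one_mul] at hL
  have hLre := (Complex.continuous_re.tendsto _).comp hL
  have hR := tendsto_sub_one_mul_dedekindZeta_nhdsGT K
  have hRre := (Complex.continuous_re.tendsto _).comp hR
  rw [Complex.ofReal_re] at hRre
  refine le_of_tendsto_of_tendsto hLre hRre ?_
  filter_upwards [self_mem_nhdsWithin] with s hs
  have hs1 : (1 : ℝ) < s := hs
  have hs' : 1 < (s : ℂ).re := by simpa using hs1
  have hcr : ∀ z : ℂ, (((s : ℂ) - 1) * z).re = (s - 1) * z.re := by
    intro z
    rw [← Complex.ofReal_one, ← Complex.ofReal_sub, Complex.re_ofReal_mul]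
  simp only [Function.comp]
  have hs2 : LSeriesSummable (fun n => ((idealCount K n : ℝ) : ℂ)) s := summable_idealCount K hs1
  have e2 : dedekindZeta K s = LSeries (fun n => ((idealCount K n : ℝ) : ℂ)) s := by
    rw [dedekindZeta]
    refine LSeries_congr (fun {n} _ => ?_) s
    simp [idealCount]
  rw [mul_assoc, ← LSeries_zetaMul χ hs', hcr, hcr, e2]
  refine mul_le_mul_of_nonneg_left ?_ (sub_nonneg.2 hs1.le)
  rw [LSeries, LSeries, Complex.re_tsum (LSeriesSummable_zetaMul χ hs'), Complex.re_tsum hs2]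
  refine Summable.tsum_le_tsum (fun n => ?_)
    (Complex.hasSum_re (LSeriesSummable_zetaMul χ hs').hasSum).summable
    (Complex.hasSum_re hs2.hasSum).summable
  rcases eq_or_ne n 0 with rfl | hn
  · simp
  rw [LSeries.term_of_ne_zero hn, LSeries.term_of_ne_zero hn, zetaMul_eq_ofReal h2,
    ← Complex.ofReal_natCast, ← Complex.ofReal_cpow (Nat.cast_nonneg n), ← Complex.ofReal_div,
    ← Complex.ofReal_div, Complex.ofReal_re, Complex.ofReal_re]
  gcongr
  exact hle n hn

end

end ExponentTwo

namespace ExponentTwo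

section

open DirichletCharacter ComplexOrder

open ArithmeticFunction in
/-- The convolution `1 * χ₁ * χ₂ * χ₃`. -/
noncomputable def fourConv {M N P : ℕ} (χ₁ : DirichletCharacter ℂ M) (χ₂ : DirichletCharacter ℂ N)
    (χ₃ : DirichletCharacter ℂ P) : ArithmeticFunction ℂ :=
  zetaMul χ₁ * (toArithmeticFunction (χ₂ ·) * toArithmeticFunction (χ₃ ·))

theorem fourConv_swap {M N P : ℕ} (χ₁ : DirichletCharacter ℂ M) (χ₂ : DirichletCharacter ℂ N)
    (χ₃ : DirichletCharacter ℂ P) : fourConv χ₁ χ₂ χ₃ = fourConv χ₂ χ₁ χ₃ := by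
  rw [fourConv, fourConv, zetaMul, zetaMul]
  ring

theorem isMultiplicative_fourConv {M N P : ℕ} (χ₁ : DirichletCharacter ℂ M)
    (χ₂ : DirichletCharacter ℂ N) (χ₃ : DirichletCharacter ℂ P) :
    (fourConv χ₁ χ₂ χ₃).IsMultiplicative :=
  χ₁.isMultiplicative_zetaMul.mul
    ((isMultiplicative_toArithmeticFunction χ₂).mul (isMultiplicative_toArithmeticFunction χ₃))

theorem toArithmeticFunction_prime_pow {N : ℕ} (χ : DirichletCharacter ℂ N) {p : ℕ} (hp : p.Prime)
    (k : ℕ) : toArithmeticFunction (χ ·) (p ^ k) = (χ p) ^ k := by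
  rw [← χ.apply_eq_toArithmeticFunction_apply (pow_ne_zero _ hp.ne_zero), Nat.cast_pow, map_pow]

theorem mul_apply_prime_pow (f g : ArithmeticFunction ℂ) {p : ℕ} (hp : p.Prime) (k : ℕ) :
    (f * g) (p ^ k) = ∑ i ∈ Finset.range (k + 1), f (p ^ i) * g (p ^ (k - i)) := by
  rw [ArithmeticFunction.mul_apply, Nat.sum_divisorsAntidiagonal (fun a b => f a * g b),
    Nat.sum_divisors_prime_pow hp]
  refine Finset.sum_congr rfl fun i hi => ?_
  rw [Nat.pow_div (by simpa [Nat.lt_succ_iff] using hi) hp.pos]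

theorem fourConv_prime_pow {M N P : ℕ} {χ₁ : DirichletCharacter ℂ M}
    {χ₂ : DirichletCharacter ℂ N} {χ₃ : DirichletCharacter ℂ P}
    (h : ∀ n : ℕ, χ₃ n = χ₁ n * χ₂ n) {p : ℕ} (hp : p.Prime) (k : ℕ) :
    fourConv χ₁ χ₂ χ₃ (p ^ k) = ∑ i ∈ Finset.range (k + 1),
      zetaMul χ₁ (p ^ i) * ((χ₂ p) ^ (k - i) * zetaMul χ₁ (p ^ (k - i))) := by
  rw [fourConv, mul_apply_prime_pow _ _ hp]
  refine Finset.sum_congr rfl fun i _ => ?_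
  congr 1
  rw [mul_comm (toArithmeticFunction _), mul_apply_prime_pow _ _ hp, zetaMul_prime_pow χ₁ hp,
    Finset.mul_sum]
  refine Finset.sum_congr rfl fun j hj => ?_
  rw [toArithmeticFunction_prime_pow _ hp, toArithmeticFunction_prime_pow _ hp, h, mul_pow]
  have : j ≤ k - i := by simpa [Nat.lt_succ_iff] using hj
  rw [mul_assoc, ← pow_add, Nat.add_sub_cancel' this, mul_comm]

theorem one_le_zetaMul_even {N : ℕ} {χ : DirichletCharacter ℂ N} (hχ : χ ^ 2 = 1) {p : ℕ}
    (hp : p.Prime) {k : ℕ} (hk : Even k) : 1 ≤ zetaMul χ (p ^ k) := by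
  rw [zetaMul_prime_pow χ hp]
  rcases MulChar.isQuadratic_iff_sq_eq_one.mpr hχ p with h | h | h
  · rw [h, Finset.sum_range_succ']
    simp
  · rw [h]
    simp
  · rw [h, neg_one_geom_sum, if_neg]
    rw [Nat.even_add_one, not_not]
    exact hk

theorem fourConv_prime_pow_nonneg_of {M N P : ℕ} {χ₁ : DirichletCharacter ℂ M}
    {χ₂ : DirichletCharacter ℂ N} {χ₃ : DirichletCharacter ℂ P}
    (h : ∀ n : ℕ, χ₃ n = χ₁ n * χ₂ n) (h1 : χ₁ ^ 2 = 1) {p : ℕ} (hp : p.Prime) (k : ℕ)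
    (hn : ∀ j, 0 ≤ (χ₂ p) ^ j * zetaMul χ₁ (p ^ j)) :
    0 ≤ fourConv χ₁ χ₂ χ₃ (p ^ k) ∧ (Even k → 1 ≤ fourConv χ₁ χ₂ χ₃ (p ^ k)) := by
  have hle : zetaMul χ₁ (p ^ k) ≤ fourConv χ₁ χ₂ χ₃ (p ^ k) := by
    rw [fourConv_prime_pow h hp, Finset.sum_range_succ, Nat.sub_self, pow_zero, pow_zero,
      χ₁.isMultiplicative_zetaMul.1, mul_one, mul_one]
    exact le_add_of_nonneg_left
      (Finset.sum_nonneg fun i _ => mul_nonneg (zetaMul_nonneg h1 _) (hn _))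
  exact ⟨(zetaMul_nonneg h1 _).trans hle, fun hk => (one_le_zetaMul_even h1 hp hk).trans hle⟩

theorem fourConv_prime_pow_nonneg {M N P : ℕ} {χ₁ : DirichletCharacter ℂ M}
    {χ₂ : DirichletCharacter ℂ N} {χ₃ : DirichletCharacter ℂ P}
    (h : ∀ n : ℕ, χ₃ n = χ₁ n * χ₂ n) (h1 : χ₁ ^ 2 = 1) (h2 : χ₂ ^ 2 = 1) {p : ℕ} (hp : p.Prime)
    (k : ℕ) :
    0 ≤ fourConv χ₁ χ₂ χ₃ (p ^ k) ∧ (Even k → 1 ≤ fourConv χ₁ χ₂ χ₃ (p ^ k)) := by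
  have key : ∀ {x : ℂ}, x = 0 ∨ x = 1 → ∀ j : ℕ, 0 ≤ x ^ j := by
    rintro x (rfl | rfl) j
    · exact pow_nonneg le_rfl j
    · simp
  rcases MulChar.isQuadratic_iff_sq_eq_one.mpr h2 p with e2 | e2 | e2
  · exact fourConv_prime_pow_nonneg_of h h1 hp k fun j =>
      mul_nonneg (key (.inl e2) j) (zetaMul_nonneg h1 _)
  · exact fourConv_prime_pow_nonneg_of h h1 hp k fun j =>
      mul_nonneg (key (.inr e2) j) (zetaMul_nonneg h1 _)
  · have h' : ∀ n : ℕ, χ₃ n = χ₂ n * χ₁ n := fun n => by rw [h, mul_comm]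
    rcases MulChar.isQuadratic_iff_sq_eq_one.mpr h1 p with e1 | e1 | e1
    · rw [fourConv_swap]
      exact fourConv_prime_pow_nonneg_of h' h2 hp k fun j =>
        mul_nonneg (key (.inl e1) j) (zetaMul_nonneg h2 _)
    · rw [fourConv_swap]
      exact fourConv_prime_pow_nonneg_of h' h2 hp k fun j =>
        mul_nonneg (key (.inr e1) j) (zetaMul_nonneg h2 _)
    · refine fourConv_prime_pow_nonneg_of h h1 hp k fun j => ?_
      rw [zetaMul_prime_pow χ₁ hp, e1, e2, neg_one_geom_sum]
      split_ifs with hj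
      · simp
      · have : Even j := by rwa [Nat.even_add_one, not_not] at hj
        simp [this.neg_one_pow]

theorem fourConv_nonneg {M N P : ℕ} {χ₁ : DirichletCharacter ℂ M}
    {χ₂ : DirichletCharacter ℂ N} {χ₃ : DirichletCharacter ℂ P}
    (h : ∀ n : ℕ, χ₃ n = χ₁ n * χ₂ n) (h1 : χ₁ ^ 2 = 1) (h2 : χ₂ ^ 2 = 1) (n : ℕ) :
    0 ≤ fourConv χ₁ χ₂ χ₃ n := by
  rcases eq_or_ne n 0 with rfl | hn
  · simp
  rw [(isMultiplicative_fourConv χ₁ χ₂ χ₃).multiplicative_factorization _ hn]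
  exact Finset.prod_nonneg fun p hp =>
    (fourConv_prime_pow_nonneg h h1 h2 (Nat.prime_of_mem_primeFactors hp) _).1

theorem one_le_of_even_prime_pow {f : ArithmeticFunction ℂ} (hf : f.IsMultiplicative)
    (h : ∀ p k : ℕ, p.Prime → Even k → 1 ≤ f (p ^ k)) {n : ℕ} (hn : n ≠ 0) : 1 ≤ f (n ^ 2) := by
  rw [hf.multiplicative_factorization _ (pow_ne_zero 2 hn)]
  refine Finset.prod_induction (fun p => f (p ^ ((n ^ 2).factorization p))) (fun x => (1 : ℂ) ≤ x)
    (fun x y hx hy => ?_) le_rfl fun p hp => ?_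
  · exact one_le_mul_of_one_le_of_one_le hx hy
  · refine h p _ (Nat.prime_of_mem_primeFactors hp) ?_
    rw [Nat.factorization_pow]
    simp

theorem one_le_fourConv_sq {M N P : ℕ} {χ₁ : DirichletCharacter ℂ M}
    {χ₂ : DirichletCharacter ℂ N} {χ₃ : DirichletCharacter ℂ P}
    (h : ∀ n : ℕ, χ₃ n = χ₁ n * χ₂ n) (h1 : χ₁ ^ 2 = 1) (h2 : χ₂ ^ 2 = 1) {n : ℕ} (hn : n ≠ 0) :
    1 ≤ fourConv χ₁ χ₂ χ₃ (n ^ 2) :=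
  one_le_of_even_prime_pow (isMultiplicative_fourConv χ₁ χ₂ χ₃)
    (fun _ k hp hk => (fourConv_prime_pow_nonneg h h1 h2 hp k).2 hk) hn

theorem one_le_zetaMul_sq {N : ℕ} {χ : DirichletCharacter ℂ N} (hχ : χ ^ 2 = 1) {n : ℕ}
    (hn : n ≠ 0) : 1 ≤ zetaMul χ (n ^ 2) :=
  one_le_of_even_prime_pow χ.isMultiplicative_zetaMul
    (fun _ _ hp hk => one_le_zetaMul_even hχ hp hk) hn

theorem LSeriesSummable_toArithmeticFunction {q : ℕ} [NeZero q] (χ : DirichletCharacter ℂ q)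
    {s : ℂ} (hs : 1 < s.re) : LSeriesSummable (toArithmeticFunction (χ ·)) s :=
  (LSeriesSummable_congr _ fun h ↦ (χ.apply_eq_toArithmeticFunction_apply h).symm).mpr <|
      ZMod.LSeriesSummable_of_one_lt_re χ hs

theorem LSeriesSummable_fourConv {M N P : ℕ} [NeZero M] [NeZero N] [NeZero P]
    (χ₁ : DirichletCharacter ℂ M) (χ₂ : DirichletCharacter ℂ N) (χ₃ : DirichletCharacter ℂ P)
    {s : ℂ} (hs : 1 < s.re) : LSeriesSummable (fourConv χ₁ χ₂ χ₃) s :=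
  ArithmeticFunction.LSeriesSummable_mul (LSeriesSummable_zetaMul χ₁ hs)
    (ArithmeticFunction.LSeriesSummable_mul (LSeriesSummable_toArithmeticFunction χ₂ hs)
      (LSeriesSummable_toArithmeticFunction χ₃ hs))

theorem LSeries_fourConv {M N P : ℕ} [NeZero M] [NeZero N] [NeZero P]
    (χ₁ : DirichletCharacter ℂ M) (χ₂ : DirichletCharacter ℂ N) (χ₃ : DirichletCharacter ℂ P)
    {s : ℂ} (hs : 1 < s.re) : LSeries (fourConv χ₁ χ₂ χ₃) s =
      riemannZeta s * LFunction χ₁ s * (LFunction χ₂ s * LFunction χ₃ s) := by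
  have e (q : ℕ) [NeZero q] (χ : DirichletCharacter ℂ q) :
      LSeries (toArithmeticFunction (χ ·)) s = LFunction χ s := by
    rw [LFunction_eq_LSeries χ hs, ← LSeries_congr χ.apply_eq_toArithmeticFunction_apply s]
  have e2 := LSeriesSummable_toArithmeticFunction χ₂ hs
  have e3 := LSeriesSummable_toArithmeticFunction χ₃ hs
  rw [fourConv, ArithmeticFunction.LSeries_mul' (LSeriesSummable_zetaMul χ₁ hs)
    (ArithmeticFunction.LSeriesSummable_mul e2 e3), ArithmeticFunction.LSeries_mul' e2 e3,
    LSeries_zetaMul χ₁ hs, e, e]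

/-- The product of two characters to different moduli, to the product modulus. -/
noncomputable def prodChar {M N : ℕ} (χ₁ : DirichletCharacter ℂ M) (χ₂ : DirichletCharacter ℂ N) :
    DirichletCharacter ℂ (M * N) :=
  changeLevel (dvd_mul_right M N) χ₁ * changeLevel (dvd_mul_left N M) χ₂

theorem prodChar_apply {M N : ℕ} (χ₁ : DirichletCharacter ℂ M) (χ₂ : DirichletCharacter ℂ N)
    (n : ℕ) : prodChar χ₁ χ₂ n = χ₁ n * χ₂ n := by
  rw [prodChar, MulChar.mul_apply]
  by_cases hu : IsUnit ((n : ℕ) : ZMod (M * N))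
  · rw [← hu.unit_spec, changeLevel_eq_cast_of_dvd, changeLevel_eq_cast_of_dvd, hu.unit_spec,
      ZMod.cast_natCast (dvd_mul_right M N), ZMod.cast_natCast (dvd_mul_left N M)]
  · rw [MulChar.map_nonunit _ hu, zero_mul]
    rw [ZMod.isUnit_iff_coprime, Nat.coprime_mul_iff_right, not_and_or, ← ZMod.isUnit_iff_coprime,
      ← ZMod.isUnit_iff_coprime] at hu
    rcases hu with hu | hu
    · rw [MulChar.map_nonunit _ hu, zero_mul]
    · rw [MulChar.map_nonunit _ hu, mul_zero]

end

section

open NumberTheorySymbols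

theorem IsKronecker.ne_one {D : ℤ} {q : ℕ} {χ : DirichletCharacter ℂ q} (hχ : IsKronecker D χ)
    (hD : D < 0) : χ ≠ 1 := by
  obtain ⟨n, hn, hj⟩ := exists_jacobi_neg_one hD.ne
    (fun ⟨r, hr⟩ => absurd (hr ▸ hD) (not_lt.2 (mul_self_nonneg r)))
  intro h
  have h1 := hχ.odd n hn
  rw [hj, h] at h1
  by_cases hu : IsUnit ((n : ℕ) : ZMod q)
  · rw [MulChar.one_apply hu] at h1
    norm_num at h1
  · rw [MulChar.map_nonunit _ hu] at h1
    norm_num at h1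

theorem IsKronecker.prodChar_ne_one {D₁ D₂ : ℤ} {q₁ q₂ : ℕ} {χ₁ : DirichletCharacter ℂ q₁}
    {χ₂ : DirichletCharacter ℂ q₂} (h1 : IsKronecker D₁ χ₁) (h2 : IsKronecker D₂ χ₂)
    (h0 : D₁ * D₂ ≠ 0) (hD : ¬ IsSquare (D₁ * D₂)) : prodChar χ₁ χ₂ ≠ 1 := by
  obtain ⟨n, hn, hj⟩ := exists_jacobi_neg_one h0 hD
  intro h
  have h3 := prodChar_apply χ₁ χ₂ n
  rw [h1.odd n hn, h2.odd n hn, h, ← Int.cast_mul, ← jacobiSym.mul_left, hj] at h3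
  by_cases hu : IsUnit ((n : ℕ) : ZMod (q₁ * q₂))
  · rw [MulChar.one_apply hu] at h3
    norm_num at h3
  · rw [MulChar.map_nonunit _ hu] at h3
    norm_num at h3

end

theorem exists_squarefree_of_fundamental {D : ℤ} (hD : IsFundamentalDiscriminant D) :
    ∃ d e : ℤ, Squarefree d ∧ (e = 1 ∧ d % 4 = 1 ∨ e = 2 ∧ d % 4 ≠ 1) ∧ D = d * e ^ 2 := by
  obtain ⟨-, ⟨h1, h2⟩ | ⟨m, rfl, h2, h3⟩⟩ := hD
  · exact ⟨D, 1, h2, .inl ⟨rfl, h1⟩, by ring⟩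
  · exact ⟨m, 2, h2, .inr ⟨rfl, by omega⟩, by ring⟩

theorem eq_of_squarefree_of_isSquare {d₁ d₂ : ℤ} (h1 : Squarefree d₁) (h2 : Squarefree d₂)
    (h : IsSquare (d₁ * d₂)) : d₁ = d₂ := by
  obtain ⟨r, hr⟩ := h
  obtain ⟨s, rfl⟩ : d₁ ∣ r := (h1.dvd_pow_iff_dvd two_ne_zero).1
    (by rw [pow_two, ← hr]; exact dvd_mul_right _ _)
  have h3 : d₂ = d₁ * (s * s) := mul_left_cancel₀ h1.ne_zero (by linarith)
  have h4 := Int.isUnit_mul_self (h2 s (h3 ▸ dvd_mul_left _ _))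
  rw [h3, h4, mul_one]

theorem isSquare_of_mul_sq {a b : ℤ} (hb : b ≠ 0) (h : IsSquare (a * b ^ 2)) : IsSquare a := by
  obtain ⟨r, hr⟩ := h
  obtain ⟨s, rfl⟩ : b ∣ r := (Int.pow_dvd_pow_iff two_ne_zero).1
    (by rw [pow_two r, ← hr]; exact dvd_mul_left _ _)
  exact ⟨s, mul_right_cancel₀ (pow_ne_zero 2 hb) (by linarith)⟩

theorem not_isSquare_mul_of_fundamental {D₁ D₂ : ℤ} (h1 : IsFundamentalDiscriminant D₁)
    (h2 : IsFundamentalDiscriminant D₂) (hne : D₁ ≠ D₂) : ¬ IsSquare (D₁ * D₂) := by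
  obtain ⟨d₁, e₁, hd₁, he₁, rfl⟩ := exists_squarefree_of_fundamental h1
  obtain ⟨d₂, e₂, hd₂, he₂, rfl⟩ := exists_squarefree_of_fundamental h2
  intro h
  have he : e₁ * e₂ ≠ 0 := by
    rcases he₁ with ⟨rfl, -⟩ | ⟨rfl, -⟩ <;> rcases he₂ with ⟨rfl, -⟩ | ⟨rfl, -⟩ <;> norm_num
  have h3 : IsSquare (d₁ * d₂) := isSquare_of_mul_sq he (by
    rwa [show d₁ * d₂ * (e₁ * e₂) ^ 2 = d₁ * e₁ ^ 2 * (d₂ * e₂ ^ 2) by ring])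
  obtain rfl := eq_of_squarefree_of_isSquare hd₁ hd₂ h3
  apply hne
  rcases he₁ with ⟨rfl, a1⟩ | ⟨rfl, a1⟩ <;> rcases he₂ with ⟨rfl, a2⟩ | ⟨rfl, a2⟩ <;>
    first | rfl | exact absurd a1 a2 | exact absurd a2 a1

theorem not_isSquare_neg_of_fundamental {D : ℤ} (h : IsFundamentalDiscriminant D)
    (h4 : D ≠ -4) : ¬ IsSquare (-D) := by
  obtain ⟨d, e, hd, he, rfl⟩ := exists_squarefree_of_fundamental h
  intro hs
  have he0 : e ≠ 0 := by rcases he with ⟨rfl, -⟩ | ⟨rfl, -⟩ <;> norm_num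
  have h1 : IsSquare (-1 * d) := isSquare_of_mul_sq he0 (by
    rwa [show -1 * d * e ^ 2 = -(d * e ^ 2) by ring])
  have h2 : (-1 : ℤ) = d := eq_of_squarefree_of_isSquare (isUnit_one.neg.squarefree) hd h1
  subst h2
  rcases he with ⟨rfl, h5⟩ | ⟨rfl, -⟩
  · norm_num at h5
  · norm_num at h4

end ExponentTwo

namespace ExponentTwo

section Estermann

open Complex LSeries

/-- The weight `n ^ (-3/2) * ∑_{j<m} ((1/2+t) log n) ^ j / j!`. -/
noncomputable def weight (m : ℕ) (t : ℝ) (n : ℕ) : ℝ :=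
  (n : ℝ) ^ (-(3 / 2) : ℝ) *
    ∑ j ∈ Finset.range m, ((1 / 2 + t) * Real.log n) ^ j / (j.factorial : ℝ)

theorem logMul_iterate_apply (f : ℕ → ℂ) (j n : ℕ) : logMul^[j] f n = (log n) ^ j * f n := by
  induction j generalizing f with
  | zero => simp
  | succ j ih => rw [Function.iterate_succ_apply, ih, logMul, pow_succ, mul_assoc]

theorem term_logMul_three_half (r : ℕ → ℝ) (j n : ℕ) :
    term (logMul^[j] fun n => (r n : ℂ)) (3 / 2) n =
      ((r n * ((n : ℝ) ^ (-(3 / 2) : ℝ) * Real.log n ^ j) : ℝ) : ℂ) := by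
  rcases eq_or_ne n 0 with rfl | hn
  · rw [term_zero, Nat.cast_zero, Real.zero_rpow (by norm_num)]
    simp
  · rw [term_of_ne_zero hn, logMul_iterate_apply, ← natCast_log, Real.rpow_neg (Nat.cast_nonneg n)]
    push_cast [Complex.ofReal_cpow (Nat.cast_nonneg n)]
    field_simp

theorem estermann {r : ℕ → ℝ} {l M : ℝ} {G : ℂ → ℂ} (hG : Differentiable ℂ G)
    (hsum : ∀ s : ℂ, 1 < s.re → LSeriesSummable (fun n => (r n : ℂ)) s)
    (hL : ∀ s : ℂ, 1 < s.re → LSeries (fun n => (r n : ℂ)) s = l / (s - 1) + G s)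
    (hM : ∀ s ∈ Metric.sphere (3 / 2 : ℂ) 1, ‖G s‖ ≤ M) {t : ℝ} (ht0 : 0 < t) (ht : t < 1 / 2)
    (m : ℕ) :
    Summable (fun n => r n * weight m t n) ∧
    ‖G (1 - t) - ((∑' n, r n * weight m t n - l / t * ((1 + 2 * t) ^ m - 1) : ℝ) : ℂ)‖ ≤
      M * (1 / 2 + t) ^ m / (1 / 2 - t) := by
  set f : ℕ → ℂ := fun n => (r n : ℂ) with hf
  have habs : abscissaOfAbsConv f < ((3 / 2 : ℂ)).re := by
    have h1 : abscissaOfAbsConv f ≤ (1 : ℝ) :=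
      abscissaOfAbsConv_le_of_forall_lt_LSeriesSummable fun y hy => hsum y (by simpa using hy)
    refine h1.trans_lt ?_
    have h2 : ((3 / 2 : ℂ)).re = 3 / 2 := by norm_num
    rw [h2]
    exact EReal.coe_lt_coe_iff.2 (by norm_num)
  have hsj : ∀ j, Summable fun n => r n * ((n : ℝ) ^ (-(3 / 2) : ℝ) * Real.log n ^ j) := by
    intro j
    have : LSeriesSummable (logMul^[j] f) (3 / 2) :=
      LSeriesSummable_of_abscissaOfAbsConv_lt_re (by rwa [absicssaOfAbsConv_logPowMul])
    exact Complex.summable_ofReal.1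
      (this.congr fun n => term_logMul_three_half r j n)
  set a : ℕ → ℝ := fun j => ∑' n, r n * ((n : ℝ) ^ (-(3 / 2) : ℝ) * Real.log n ^ j) with ha
  have hder : ∀ j, iteratedDeriv j G (3 / 2) =
      (-1) ^ j * ((a j - l * (j.factorial * 2 ^ (j + 1)) : ℝ) : ℂ) := by
    intro j
    have hev : G =ᶠ[nhds (3 / 2 : ℂ)] fun s => LSeries f s - l * (1 * s - 1)⁻¹ := by
      have : {s : ℂ | 1 < s.re} ∈ nhds (3 / 2 : ℂ) :=
        (isOpen_lt continuous_const continuous_re).mem_nhds (by norm_num)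
      filter_upwards [this] with s hs
      rw [hL s hs]
      ring
    have h1 : (1 * (3 / 2 : ℂ) - 1) ≠ 0 := by norm_num
    have hc1 : ContDiffAt ℂ j (LSeries f) (3 / 2) :=
      (LSeries_analyticOnNhd f _ habs).contDiffAt
    have hc2 : ContDiffAt ℂ j (fun s : ℂ => (1 * s - 1)⁻¹) (3 / 2) :=
      ((contDiffAt_const.mul contDiffAt_id).sub contDiffAt_const).inv h1
    rw [hev.iteratedDeriv_eq, iteratedDeriv_fun_sub hc1 (contDiffAt_const.mul hc2),
      LSeries_iteratedDeriv j habs, iteratedDeriv_const_mul _ hc2, iteratedDeriv_eq_iterate,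
      iter_deriv_inv_linear_sub]
    have h2 : LSeries (logMul^[j] f) (3 / 2) = (a j : ℂ) := by
      rw [LSeries, ha, Complex.ofReal_tsum]
      simp_rw [hf, term_logMul_three_half]
    have h3 : (1 * (3 / 2 : ℂ) - 1) ^ (-1 - j : ℤ) = 2 ^ (j + 1) := by
      rw [show (-1 - j : ℤ) = -((j + 1 : ℕ) : ℤ) by push_cast; ring, zpow_neg, zpow_natCast,
        ← inv_pow]
      norm_num
    beta_reduce
    rw [h2, h3]
    push_cast
    ring
  set b : ℕ → ℝ := fun j => (1 / 2 + t) ^ j / j.factorial * (a j - l * (j.factorial * 2 ^ (j + 1)))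
    with hb
  have hterm : ∀ j, (j.factorial : ℂ)⁻¹ • ((1 - t : ℂ) - 3 / 2) ^ j • iteratedDeriv j G (3 / 2) =
      (b j : ℂ) := by
    intro j
    rw [hder, smul_eq_mul, smul_eq_mul, show ((1 - t : ℂ) - 3 / 2) = (-1) * (1 / 2 + t) by ring,
      mul_pow, hb]
    have : ((-1 : ℂ) ^ j) * (-1) ^ j = 1 := by rw [← mul_pow]; norm_num
    push_cast
    linear_combination ((j.factorial : ℂ)⁻¹ * (1 / 2 + t) ^ j *
      ((a j : ℂ) - l * (j.factorial * 2 ^ (j + 1)))) * this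
  have hball : (1 - t : ℂ) ∈ Metric.ball (3 / 2 : ℂ) 1 := by
    rw [mem_ball_iff_norm, show (1 - t : ℂ) - 3 / 2 = ((-(1 / 2 + t) : ℝ) : ℂ) by push_cast; ring,
      Complex.norm_real, norm_neg, Real.norm_eq_abs, abs_of_pos (by linarith)]
    linarith
  have hT : HasSum (fun j => (b j : ℂ)) (G (1 - t)) := by
    have := Complex.hasSum_taylorSeries_on_ball (hG.differentiableOn (s := Metric.ball (3 / 2) 1))
      hball
    simpa only [hterm] using this
  have hbound : ∀ j, ‖(b j : ℂ)‖ ≤ M * (1 / 2 + t) ^ j := by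
    intro j
    have h1 := Complex.norm_iteratedDeriv_le_of_forall_mem_sphere_norm_le j one_pos
      hG.diffContOnCl hM
    rw [← hterm j, norm_smul, norm_smul, norm_pow,
      show (1 - t : ℂ) - 3 / 2 = ((-(1 / 2 + t) : ℝ) : ℂ) by push_cast; ring, Complex.norm_real,
      norm_neg, Real.norm_eq_abs, abs_of_pos (by linarith), norm_inv, Complex.norm_natCast]
    rw [one_pow, div_one] at h1
    have hf0 : (0 : ℝ) < j.factorial := by exact_mod_cast j.factorial_pos
    calc _ ≤ (j.factorial : ℝ)⁻¹ * ((1 / 2 + t) ^ j * (j.factorial * M)) := by gcongr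
      _ = _ := by field_simp
  have hwt : ∀ n, r n * weight m t n = ∑ j ∈ Finset.range m, (1 / 2 + t) ^ j / j.factorial *
      (r n * ((n : ℝ) ^ (-(3 / 2) : ℝ) * Real.log n ^ j)) := by
    intro n
    rw [weight, Finset.mul_sum, Finset.mul_sum]
    refine Finset.sum_congr rfl fun j _ => ?_
    rw [mul_pow]
    ring
  refine ⟨?_, ?_⟩
  · simp_rw [hwt]
    exact summable_sum fun j _ => (hsj j).mul_left _
  have hsumb : ∑' n, r n * weight m t n - l / t * ((1 + 2 * t) ^ m - 1) =
      ∑ j ∈ Finset.range m, b j := by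
    simp_rw [hwt]
    rw [Summable.tsum_finsetSum fun j _ => (hsj j).mul_left _]
    simp_rw [tsum_mul_left, hb, mul_sub, Finset.sum_sub_distrib]
    have hg := geom_sum_eq (show 1 + 2 * t ≠ 1 by linarith) m
    rw [show l / t * (1 + 2 * t) ^ m - l / t * 1 =
      2 * l * (((1 + 2 * t) ^ m - 1) / (1 + 2 * t - 1)) by field_simp; ring, ← hg, Finset.mul_sum]
    congr 1
    refine Finset.sum_congr rfl fun j _ => ?_
    have hf0 : (j.factorial : ℝ) ≠ 0 := by exact_mod_cast j.factorial_ne_zero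
    rw [show 1 + 2 * t = 2 * (1 / 2 + t) by ring, mul_pow]
    field_simp
    ring
  rw [hsumb]
  have hsplit := hT.summable.sum_add_tsum_nat_add m
  rw [hT.tsum_eq] at hsplit
  rw [← hsplit]
  push_cast
  rw [add_sub_cancel_left]
  have hgeo : HasSum (fun j : ℕ => M * (1 / 2 + t) ^ (j + m))
      (M * (1 / 2 + t) ^ m / (1 / 2 - t)) := by
    have h1 := (hasSum_geometric_of_lt_one (r := 1 / 2 + t) (by linarith)
      (by linarith)).mul_left (M * (1 / 2 + t) ^ m)
    rw [show (1 - (1 / 2 + t)) = 1 / 2 - t by ring, ← div_eq_mul_inv] at h1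
    refine h1.congr_fun ?_
    intro j
    ring
  exact tsum_of_norm_bounded hgeo fun j => hbound (j + m)

end Estermann

end ExponentTwo

namespace ExponentTwo

section IntegralRep

open Complex Filter Topology MeasureTheory Set

theorem differentiableAt_integral_mul_cpow {A : ℝ → ℂ} {C : ℝ} (hA : Measurable A)
    (hC : ∀ u, ‖A u‖ ≤ C) {s : ℂ} (hs : 0 < s.re) :
    DifferentiableAt ℂ (fun s => ∫ u in Ioi (1 : ℝ), A u * (u : ℂ) ^ (-(s + 1))) s := by
  have hC0 : 0 ≤ C := (norm_nonneg _).trans (hC 0)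
  have heq : (fun s => ∫ u in Ioi (1 : ℝ), A u * (u : ℂ) ^ (-(s + 1))) =
      fun s => mellin ((Ioi (1 : ℝ)).indicator A) (-s) := by
    ext s
    rw [mellin]
    have h1 : ∀ u : ℝ, (u : ℂ) ^ (-s - 1) • (Ioi (1 : ℝ)).indicator A u =
        (Ioi (1 : ℝ)).indicator (fun u => A u * (u : ℂ) ^ (-(s + 1))) u := by
      intro u
      by_cases hu : u ∈ Ioi (1 : ℝ)
      · rw [indicator_of_mem hu, indicator_of_mem hu, smul_eq_mul, mul_comm, neg_add,
          sub_eq_add_neg]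
      · rw [indicator_of_notMem hu, indicator_of_notMem hu, smul_zero]
    simp_rw [h1]
    rw [setIntegral_indicator measurableSet_Ioi]
    congr 2
    rw [Ioi_inter_Ioi, max_eq_right zero_le_one]
  rw [heq]
  have hb : ∀ u, ‖(Ioi (1 : ℝ)).indicator A u‖ ≤ C := fun u =>
    (norm_indicator_le_norm_self _ _).trans (hC u)
  have hm : Measurable ((Ioi (1 : ℝ)).indicator A) := hA.indicator measurableSet_Ioi
  have hd : DifferentiableAt ℂ (mellin ((Ioi (1 : ℝ)).indicator A)) (-s) := by
    refine mellin_differentiableAt_of_isBigO_rpow (a := 0) (b := -s.re - 1) ?_ ?_ (by simpa) ?_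
      (by simp)
    · refine LocallyIntegrable.locallyIntegrableOn ?_ _
      refine (locallyIntegrable_const C).mono hm.aestronglyMeasurable ?_
      filter_upwards with u
      rw [Real.norm_of_nonneg hC0]
      exact hb u
    · simp only [neg_zero, Real.rpow_zero]
      exact Asymptotics.isBigO_of_le' (c := C) _ fun u => by simpa using hb u
    · refine Asymptotics.IsBigO.congr' (Asymptotics.isBigO_zero _ _) ?_ EventuallyEq.rfl
      have : Iio (1 : ℝ) ∈ 𝓝[>] (0 : ℝ) := mem_nhdsWithin_of_mem_nhds (Iio_mem_nhds one_pos)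
      filter_upwards [this] with u hu
      rw [indicator_of_notMem (by simpa using hu.le)]
  exact hd.comp s differentiableAt_id.neg

/-- Two functions analytic on `re s > 0` that agree on `re s > 1` agree. -/
theorem eq_of_eq_on_one_lt_re {F G : ℂ → ℂ} (hF : ∀ s : ℂ, 0 < s.re → DifferentiableAt ℂ F s)
    (hG : ∀ s : ℂ, 0 < s.re → DifferentiableAt ℂ G s) (h : ∀ s : ℂ, 1 < s.re → F s = G s)
    {s : ℂ} (hs : 0 < s.re) : F s = G s := by
  have ho : IsOpen {s : ℂ | 0 < s.re} := isOpen_lt continuous_const continuous_re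
  have hFa : AnalyticOnNhd ℂ F {s : ℂ | 0 < s.re} :=
    DifferentiableOn.analyticOnNhd (fun s hs => (hF s hs).differentiableWithinAt) ho
  have hGa : AnalyticOnNhd ℂ G {s : ℂ | 0 < s.re} :=
    DifferentiableOn.analyticOnNhd (fun s hs => (hG s hs).differentiableWithinAt) ho
  have hc : IsPreconnected {s : ℂ | 0 < s.re} := (convex_halfSpace_re_gt 0).isPreconnected
  refine hFa.eqOn_of_preconnected_of_eventuallyEq hGa hc (z₀ := 2) (by simp) ?_ hs
  have : {s : ℂ | 1 < s.re} ∈ 𝓝 (2 : ℂ) :=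
    (isOpen_lt continuous_const continuous_re).mem_nhds (by norm_num)
  filter_upwards [this] with s hs using h s hs

theorem sum_range_natCast_add {N : ℕ} [NeZero N] (g : ZMod N → ℂ) (a : ZMod N) :
    ∑ k ∈ Finset.range N, g (k + a) = ∑ x, g x := by
  rw [← Fintype.sum_equiv (Equiv.addRight a) (fun x => g (x + a)) g fun x => rfl]
  refine Finset.sum_nbij' (fun k => (k : ZMod N)) ZMod.val (by simp) ?_ ?_ (by simp) (by simp)
  · intro x _
    exact Finset.mem_range.2 (ZMod.val_lt x)
  · intro k hk
    exact ZMod.val_cast_of_lt (Finset.mem_range.1 hk)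

theorem sum_Icc_character_add {N : ℕ} [NeZero N] {χ : DirichletCharacter ℂ N} (hχ : χ ≠ 1) (n : ℕ) :
    ∑ k ∈ Finset.Icc 1 (n + N), χ k = ∑ k ∈ Finset.Icc 1 n, χ k := by
  have h1 : ∀ n : ℕ, ∑ k ∈ Finset.Icc 1 n, χ k = ∑ k ∈ Finset.range n, χ (k + 1 : ℕ) := by
    intro n
    rw [Finset.range_eq_Ico, Finset.sum_Ico_add' (fun k : ℕ => χ k) 0 n 1]
    rfl
  rw [h1, h1, Finset.sum_range_add]
  have := sum_range_natCast_add (fun x => χ x) ((n : ZMod N) + 1)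
  rw [MulChar.sum_eq_zero_of_ne_one hχ] at this
  rw [add_eq_left, ← this]
  refine Finset.sum_congr rfl fun k _ => ?_
  push_cast
  ring_nf

theorem norm_sum_Icc_character_le_self {N : ℕ} (χ : DirichletCharacter ℂ N) (n : ℕ) :
    ‖∑ k ∈ Finset.Icc 1 n, χ k‖ ≤ n := by
  refine (norm_sum_le _ _).trans ((Finset.sum_le_sum fun k _ => χ.norm_le_one _).trans ?_)
  simp

theorem norm_sum_Icc_character_le {N : ℕ} [NeZero N] {χ : DirichletCharacter ℂ N} (hχ : χ ≠ 1)
    (n : ℕ) : ‖∑ k ∈ Finset.Icc 1 n, χ k‖ ≤ N := by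
  induction n using Nat.strong_induction_on with
  | _ n ih =>
    rcases lt_or_ge n N with h | h
    · exact (norm_sum_Icc_character_le_self χ n).trans (by exact_mod_cast h.le)
    · obtain ⟨m, rfl⟩ := Nat.exists_eq_add_of_le' h
      rw [sum_Icc_character_add hχ]
      exact ih m (by have := NeZero.pos N; omega)

theorem measurable_sum_Icc_floor (f : ℕ → ℂ) :
    Measurable fun u : ℝ => ∑ k ∈ Finset.Icc 1 ⌊u⌋₊, f k :=
  (measurable_from_top (f := fun n : ℕ => ∑ k ∈ Finset.Icc 1 n, f k)).comp Nat.measurable_floor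

theorem LFunction_eq_mul_integral {N : ℕ} [NeZero N] {χ : DirichletCharacter ℂ N} (hχ : χ ≠ 1)
    {s : ℂ} (hs : 0 < s.re) : DirichletCharacter.LFunction χ s =
      s * ∫ u in Ioi (1 : ℝ), (∑ k ∈ Finset.Icc 1 ⌊u⌋₊, χ k) * (u : ℂ) ^ (-(s + 1)) := by
  refine eq_of_eq_on_one_lt_re (F := DirichletCharacter.LFunction χ)
    (fun s _ => (DirichletCharacter.differentiable_LFunction hχ) s)
    (fun s hs => differentiableAt_id.mul
      (differentiableAt_integral_mul_cpow (measurable_sum_Icc_floor (fun n => χ n))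
        (fun u => norm_sum_Icc_character_le hχ _) hs)) (fun s hs => ?_) hs
  rw [DirichletCharacter.LFunction_eq_LSeries χ hs]
  refine LSeries_eq_mul_integral _ le_rfl (zero_lt_one.trans hs)
    (ZMod.LSeriesSummable_of_one_lt_re χ hs) ?_
  simp only [Real.rpow_zero]
  exact Asymptotics.isBigO_of_le' (c := N) _ fun n => by
    simpa using norm_sum_Icc_character_le hχ n

theorem norm_integral_mul_cpow_le {A : ℝ → ℂ} {N : ℕ} (hN : 1 ≤ N)
    (hA : ∀ u, 1 < u → ‖A u‖ ≤ u) (hA' : ∀ u, ‖A u‖ ≤ N) {s : ℂ} (hs : 1 / 2 ≤ s.re) :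
    ‖∫ u in Ioi (1 : ℝ), A u * (u : ℂ) ^ (-(s + 1))‖ ≤ 4 * √N := by
  have hN' : (1 : ℝ) ≤ N := by exact_mod_cast hN
  have hpt : ∀ u : ℝ, 1 < u → ‖A u * (u : ℂ) ^ (-(s + 1))‖ ≤ ‖A u‖ * u ^ (-(3 / 2) : ℝ) := by
    intro u hu
    rw [norm_mul, norm_cpow_eq_rpow_re_of_pos (by linarith)]
    gcongr
    · exact hu.le
    · simp; linarith
  set g : ℝ → ℝ := fun u => if u ≤ N then u ^ (-(1 / 2) : ℝ) else N * u ^ (-(3 / 2) : ℝ) with hg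
  have h1 : IntegrableOn g (Ioc 1 N) := by
    have : IntervalIntegrable (fun u : ℝ => u ^ (-(1 / 2) : ℝ)) volume 1 N :=
      intervalIntegral.intervalIntegrable_rpow' (by norm_num)
    rw [intervalIntegrable_iff_integrableOn_Ioc_of_le hN'] at this
    refine this.congr_fun (fun u hu => ?_) measurableSet_Ioc
    simp only [hg, if_pos hu.2]
  have h2 : IntegrableOn g (Ioi N) := by
    have : IntegrableOn (fun u : ℝ => (N : ℝ) * u ^ (-(3 / 2) : ℝ)) (Ioi (N : ℝ)) :=
      (integrableOn_Ioi_rpow_of_lt (by norm_num) (by linarith)).const_mul _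
    refine this.congr_fun (fun u hu => ?_) measurableSet_Ioi
    simp only [hg, if_neg (not_le.2 (mem_Ioi.1 hu))]
  have hu : Ioi (1 : ℝ) = Ioc 1 (N : ℝ) ∪ Ioi N := (Ioc_union_Ioi_eq_Ioi hN').symm
  have hgi : IntegrableOn g (Ioi 1) := by rw [hu]; exact h1.union h2
  refine (norm_integral_le_of_norm_le hgi ?_).trans ?_
  · refine (ae_restrict_iff' measurableSet_Ioi).2 (ae_of_all _ fun u hu => ?_)
    have hu1 : (1 : ℝ) < u := hu
    have hu0 : (0 : ℝ) < u := by linarith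
    refine (hpt u hu1).trans ?_
    simp only [hg]
    split_ifs with h
    · have : u ^ (-(1 / 2) : ℝ) = u * u ^ (-(3 / 2) : ℝ) := by
        nth_rw 2 [← Real.rpow_one u]
        rw [← Real.rpow_add hu0]
        norm_num
      rw [this]
      gcongr
      exact hA u hu1
    · gcongr
      exact hA' u
  · rw [hu, setIntegral_union Ioc_disjoint_Ioi_same measurableSet_Ioi h1 h2]
    have e1 : ∫ u in Ioc 1 (N : ℝ), g u = 2 * √N - 2 := by
      rw [setIntegral_congr_fun (g := fun u : ℝ => u ^ (-(1 / 2) : ℝ)) measurableSet_Ioc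
        fun u hu => by simp only [hg, if_pos hu.2], ← intervalIntegral.integral_of_le hN',
        integral_rpow (by norm_num), Real.sqrt_eq_rpow]
      norm_num
      ring
    have e2 : ∫ u in Ioi (N : ℝ), g u = 2 * √N := by
      have hN0 : (0 : ℝ) < N := by linarith
      rw [setIntegral_congr_fun (g := fun u : ℝ => N * u ^ (-(3 / 2) : ℝ)) measurableSet_Ioi
        fun u hu => by simp only [hg, if_neg (not_le.2 (mem_Ioi.1 hu))], integral_const_mul,
        integral_Ioi_rpow_of_lt (by norm_num) hN0, Real.sqrt_eq_rpow]
      norm_num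
      have : (N : ℝ) ^ (1 / 2 : ℝ) = N * (N : ℝ) ^ (-(1 / 2) : ℝ) := by
        nth_rw 2 [← Real.rpow_one (N : ℝ)]
        rw [← Real.rpow_add hN0]
        norm_num
      rw [this]
      ring
    rw [e1, e2]
    linarith

theorem sphere_three_half {s : ℂ} (hs : s ∈ Metric.sphere (3 / 2 : ℂ) 1) :
    1 / 2 ≤ s.re ∧ ‖s‖ ≤ 5 / 2 ∧ 1 / 2 ≤ ‖s - 1‖ ∧ ‖s‖ ≤ 2 * s.re := by
  rw [mem_sphere_iff_norm] at hs
  have h1 : |(s - 3 / 2).re| ≤ 1 := hs ▸ abs_re_le_norm _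
  have hre : (s - 3 / 2).re = s.re - 3 / 2 := by simp
  rw [hre, abs_le] at h1
  have h32 : ‖(3 / 2 : ℂ)‖ = 3 / 2 := by norm_num
  have hsq : (s.re - 3 / 2) ^ 2 + s.im ^ 2 = 1 := by
    have := Complex.sq_norm (s - 3 / 2)
    rw [hs, normSq_apply, hre] at this
    simp at this
    nlinarith
  refine ⟨by linarith, ?_, ?_, ?_⟩
  · calc ‖s‖ = ‖(s - 3 / 2) + 3 / 2‖ := by ring_nf
      _ ≤ ‖s - 3 / 2‖ + ‖(3 / 2 : ℂ)‖ := norm_add_le _ _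
      _ = 5 / 2 := by rw [hs, h32]; norm_num
  · have h3 : ‖s - 3 / 2‖ ≤ ‖s - 1‖ + ‖(1 / 2 : ℂ)‖ := by
      rw [show s - 3 / 2 = (s - 1) - 1 / 2 by ring]
      exact norm_sub_le _ _
    have : ‖(1 / 2 : ℂ)‖ = 1 / 2 := by norm_num
    rw [hs, this] at h3
    linarith
  · refine abs_le_of_sq_le_sq' ?_ (by linarith) |>.2
    rw [Complex.sq_norm, normSq_apply]
    nlinarith

theorem norm_LFunction_le {N : ℕ} [NeZero N] {χ : DirichletCharacter ℂ N} (hχ : χ ≠ 1)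
    {s : ℂ} (h1 : 1 / 2 ≤ s.re) (h2 : ‖s‖ ≤ 5 / 2) :
    ‖DirichletCharacter.LFunction χ s‖ ≤ 10 * √N := by
  rw [LFunction_eq_mul_integral hχ (by linarith), norm_mul]
  have h3 := norm_integral_mul_cpow_le (s := s) (NeZero.pos N)
    (A := fun u : ℝ => ∑ k ∈ Finset.Icc 1 ⌊u⌋₊, χ k)
    (fun u hu => (norm_sum_Icc_character_le_self χ _).trans (Nat.floor_le (by linarith)))
    (fun u => norm_sum_Icc_character_le hχ _) h1
  calc _ ≤ 5 / 2 * (4 * √N) := by gcongr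
    _ = _ := by ring

/-- The entire function `(s - 1) ζ(s)`. -/
noncomputable def entireZeta : ℂ → ℂ := Function.update (fun s => (s - 1) * riemannZeta s) 1 1

theorem entireZeta_of_ne {s : ℂ} (hs : s ≠ 1) : entireZeta s = (s - 1) * riemannZeta s :=
  Function.update_of_ne hs _ _

theorem entireZeta_one : entireZeta 1 = 1 := Function.update_self _ _ _

theorem differentiable_entireZeta : Differentiable ℂ entireZeta := by
  rw [← differentiableOn_univ,
    ← differentiableOn_compl_singleton_and_continuousAt_iff (c := 1) Filter.univ_mem]
  refine ⟨DifferentiableOn.congr (f := fun s ↦ (s - 1) * riemannZeta s)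
    (fun s hs => ?_) fun s hs => entireZeta_of_ne hs.2, ?_⟩
  · exact ((differentiableAt_id.sub_const 1).mul
      (differentiableAt_riemannZeta hs.2)).differentiableWithinAt
  · rw [entireZeta, continuousAt_update_same]
    exact riemannZeta_residue_one

theorem norm_fract_le (u : ℝ) : ‖((Int.fract u : ℝ) : ℂ)‖ ≤ 1 := by
  rw [norm_real, Real.norm_of_nonneg (Int.fract_nonneg u)]
  exact (Int.fract_lt_one u).le

theorem entireZeta_eq {s : ℂ} (hs : 0 < s.re) : entireZeta s =
      s - (s - 1) * s * ∫ u in Ioi (1 : ℝ), ((Int.fract u : ℝ) : ℂ) * (u : ℂ) ^ (-(s + 1)) := by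
  refine eq_of_eq_on_one_lt_re (fun s _ => differentiable_entireZeta s)
    (fun s hs => differentiableAt_id.sub (((differentiableAt_id.sub_const 1).mul
      differentiableAt_id).mul (differentiableAt_integral_mul_cpow
        (measurable_ofReal.comp measurable_fract) norm_fract_le hs))) (fun s hs => ?_) hs
  have hs0 : 0 < s.re := by linarith
  have hs1 : s ≠ 1 := fun h => by rw [h, one_re] at hs; exact lt_irrefl _ hs
  have h1 : riemannZeta s =
      s * ∫ u in Ioi (1 : ℝ), (∑ k ∈ Finset.Icc 1 ⌊u⌋₊, (1 : ℂ)) * (u : ℂ) ^ (-(s + 1)) := by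
    rw [← LSeries_one_eq_riemannZeta hs]
    refine LSeries_eq_mul_integral' _ zero_le_one (by simpa using hs) ?_
    simp only [Real.rpow_one, Pi.one_apply, norm_one, Finset.sum_const, Nat.card_Icc,
      add_tsub_cancel_right, nsmul_eq_mul, mul_one]
    exact Asymptotics.isBigO_refl _ _
  have h2 : ∫ u in Ioi (1 : ℝ), (u : ℂ) ^ (-s) = 1 / (s - 1) := by
    rw [integral_Ioi_cpow_of_lt (by simpa using hs) zero_lt_one]
    have : -s + 1 ≠ 0 := by
      intro h
      exact hs1 (by linear_combination -h)
    have h' : s - 1 ≠ 0 := sub_ne_zero.2 hs1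
    field_simp
    simp
    ring
  have hi1 : IntegrableOn (fun u : ℝ => (u : ℂ) ^ (-s)) (Ioi 1) :=
    integrableOn_Ioi_cpow_of_lt (by simpa using hs) zero_lt_one
  have hi2 : IntegrableOn (fun u : ℝ => ((Int.fract u : ℝ) : ℂ) * (u : ℂ) ^ (-(s + 1)))
      (Ioi 1) := by
    have : IntegrableOn (fun u : ℝ => (u : ℂ) ^ (-(s + 1))) (Ioi 1) :=
      integrableOn_Ioi_cpow_of_lt (by simp; linarith) zero_lt_one
    refine Integrable.bdd_mul this (c := 1)
      (measurable_ofReal.comp measurable_fract).aestronglyMeasurable ?_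
    exact ae_of_all _ fun u => norm_fract_le u
  have h3 : ∫ u in Ioi (1 : ℝ), (∑ k ∈ Finset.Icc 1 ⌊u⌋₊, (1 : ℂ)) * (u : ℂ) ^ (-(s + 1)) =
      1 / (s - 1) - ∫ u in Ioi (1 : ℝ), ((Int.fract u : ℝ) : ℂ) * (u : ℂ) ^ (-(s + 1)) := by
    rw [← h2, ← integral_sub hi1 hi2]
    refine setIntegral_congr_fun measurableSet_Ioi fun u hu => ?_
    have hu1 : (1 : ℝ) < u := hu
    have hu0 : (u : ℂ) ≠ 0 := by exact_mod_cast (by linarith : u ≠ 0)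
    have e1 : ((⌊u⌋₊ : ℕ) : ℂ) = u - (Int.fract u : ℝ) := by
      have : ((⌊u⌋₊ : ℕ) : ℝ) = u - Int.fract u := by
        rw [Int.self_sub_fract, natCast_floor_eq_intCast_floor (by linarith)]
      rw [← ofReal_natCast, this, ofReal_sub]
    have e2 : (u : ℂ) ^ (-s) = u * (u : ℂ) ^ (-(s + 1)) := by
      nth_rw 2 [← cpow_one (u : ℂ)]
      rw [← cpow_add _ _ hu0]
      congr 1
      ring
    simp only [Finset.sum_const, Nat.card_Icc, add_tsub_cancel_right, nsmul_eq_mul, mul_one]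
    rw [e1, e2]
    ring
  show entireZeta s =
    s - (s - 1) * s * ∫ u in Ioi (1 : ℝ), ((Int.fract u : ℝ) : ℂ) * (u : ℂ) ^ (-(s + 1))
  rw [entireZeta_of_ne hs1, h1, h3]
  have h' : s - 1 ≠ 0 := sub_ne_zero.2 hs1
  field_simp

theorem norm_zeta_sphere_le {s : ℂ} (hs : s ∈ Metric.sphere (3 / 2 : ℂ) 1) :
    ‖riemannZeta s‖ ≤ 5 := by
  obtain ⟨h1, h2, h3, h4⟩ := sphere_three_half hs
  have hs0 : 0 < s.re := by linarith
  have hne : s - 1 ≠ 0 := by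
    intro h; rw [h, norm_zero] at h3; linarith
  have hJ : ‖∫ u in Ioi (1 : ℝ), ((Int.fract u : ℝ) : ℂ) * (u : ℂ) ^ (-(s + 1))‖ ≤ 1 / s.re := by
    have hi : IntegrableOn (fun u : ℝ => u ^ (-(s.re + 1))) (Ioi 1) :=
      integrableOn_Ioi_rpow_of_lt (by linarith) zero_lt_one
    refine (norm_integral_le_of_norm_le hi ?_).trans ?_
    · refine (ae_restrict_iff' measurableSet_Ioi).2 (ae_of_all _ fun u hu => ?_)
      have hu1 : (1 : ℝ) < u := hu
      rw [norm_mul, norm_cpow_eq_rpow_re_of_pos (by linarith)]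
      have : (-(s + 1)).re = -(s.re + 1) := by simp
      rw [this]
      exact mul_le_of_le_one_left (Real.rpow_nonneg (by linarith) _) (norm_fract_le u)
    · rw [integral_Ioi_rpow_of_lt (by linarith) zero_lt_one, Real.one_rpow]
      apply le_of_eq
      rw [show -(s.re + 1) + 1 = -s.re by ring, neg_div_neg_eq]
  have hz : riemannZeta s = 1 + 1 / (s - 1) -
      s * ∫ u in Ioi (1 : ℝ), ((Int.fract u : ℝ) : ℂ) * (u : ℂ) ^ (-(s + 1)) := by
    have := entireZeta_eq hs0
    rw [entireZeta_of_ne (sub_ne_zero.1 hne)] at this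
    apply mul_left_cancel₀ hne
    rw [this]
    field_simp
    ring
  rw [hz]
  have e1 : ‖1 / (s - 1)‖ ≤ 2 := by
    rw [norm_div, norm_one, div_le_iff₀ (by linarith)]
    linarith
  have e2 : ‖s * ∫ u in Ioi (1 : ℝ), ((Int.fract u : ℝ) : ℂ) * (u : ℂ) ^ (-(s + 1))‖ ≤ 2 := by
    rw [norm_mul]
    calc _ ≤ (2 * s.re) * (1 / s.re) := by gcongr
      _ = 2 := by field_simp
  calc _ ≤ ‖(1 : ℂ) + 1 / (s - 1)‖ + ‖s * ∫ u in Ioi (1 : ℝ),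
        ((Int.fract u : ℝ) : ℂ) * (u : ℂ) ^ (-(s + 1))‖ := norm_sub_le _ _
    _ ≤ (‖(1 : ℂ)‖ + ‖1 / (s - 1)‖) + _ := by gcongr; exact norm_add_le _ _
    _ ≤ 5 := by rw [norm_one]; linarith

theorem estermann_zeta_mul {r : ℕ → ℝ} {l B : ℝ} {R : ℂ → ℂ} (hR : Differentiable ℂ R)
    (hsum : ∀ s : ℂ, 1 < s.re → LSeriesSummable (fun n => (r n : ℂ)) s)
    (hL : ∀ s : ℂ, 1 < s.re → LSeries (fun n => (r n : ℂ)) s = riemannZeta s * R s)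
    (hl : R 1 = l) (hB : ∀ s : ℂ, 1 / 2 ≤ s.re → ‖s‖ ≤ 5 / 2 → ‖R s‖ ≤ B)
    {t : ℝ} (ht0 : 0 < t) (ht : t < 1 / 2) (m : ℕ) :
    Summable (fun n => r n * weight m t n) ∧
    ‖riemannZeta (1 - t) * R (1 - t) -
        ((∑' n, r n * weight m t n - l / t * (1 + 2 * t) ^ m : ℝ) : ℂ)‖ ≤
      7 * B * (1 / 2 + t) ^ m / (1 / 2 - t) := by
  set G : ℂ → ℂ := dslope (fun s => entireZeta s * R s) 1 with hGdef
  have hP : Differentiable ℂ fun s => entireZeta s * R s := differentiable_entireZeta.mul hR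
  have hG : Differentiable ℂ G := by
    rw [← differentiableOn_univ]
    exact (Complex.differentiableOn_dslope Filter.univ_mem).2 hP.differentiableOn
  have hGs : ∀ s : ℂ, s ≠ 1 → G s = riemannZeta s * R s - l / (s - 1) := by
    intro s hs
    have h' : s - 1 ≠ 0 := sub_ne_zero.2 hs
    rw [hGdef, dslope_of_ne _ hs, slope_def_field, entireZeta_of_ne hs, entireZeta_one, hl]
    field_simp
  have h1B : |l| ≤ B := by
    have := hB 1 (by norm_num) (by norm_num)
    rwa [hl, norm_real, Real.norm_eq_abs] at this
  have hM : ∀ s ∈ Metric.sphere (3 / 2 : ℂ) 1, ‖G s‖ ≤ 7 * B := by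
    intro s hs
    obtain ⟨h1, h2, h3, -⟩ := sphere_three_half hs
    have hne : s ≠ 1 := by
      rintro rfl; rw [sub_self, norm_zero] at h3; linarith
    rw [hGs s hne]
    refine (norm_sub_le _ _).trans ?_
    rw [norm_mul, norm_div, norm_real, Real.norm_eq_abs]
    have e1 : ‖riemannZeta s‖ * ‖R s‖ ≤ 5 * B := by
      gcongr
      · exact norm_zeta_sphere_le hs
      · exact hB s h1 h2
    have e2 : |l| / ‖s - 1‖ ≤ 2 * B := by
      rw [div_le_iff₀ (by linarith)]
      have := abs_nonneg l
      nlinarith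
    linarith
  have ht1 : (1 - t : ℂ) ≠ 1 := by
    intro h
    have : (t : ℂ) = 0 := by linear_combination -h
    exact ht0.ne' (by exact_mod_cast this)
  obtain ⟨hS, hE⟩ := estermann (M := 7 * B) (l := l) hG hsum (fun s hs => by
    have hs1 : s ≠ 1 := fun h => by rw [h, one_re] at hs; exact lt_irrefl _ hs
    rw [hL s hs, hGs s hs1]; ring) hM ht0 ht m
  refine ⟨hS, ?_⟩
  convert hE using 2
  rw [hGs _ ht1]
  have ht0' : (t : ℂ) ≠ 0 := by exact_mod_cast ht0.ne'
  push_cast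
  have : (1 - t - 1 : ℂ) = -t := by ring
  rw [this]
  field_simp
  ring

end IntegralRep

end ExponentTwo

namespace ExponentTwo

open Complex Filter Topology Nat in
theorem hasDerivAt_sum_pow_div_factorial (m : ℕ) (x : ℝ) :
    HasDerivAt (fun x : ℝ => ∑ j ∈ Finset.range (m + 1), x ^ j / (j ! : ℝ))
      (∑ j ∈ Finset.range m, x ^ j / (j ! : ℝ)) x := by
  induction m with
  | zero => simpa using hasDerivAt_const x (1 : ℝ)
  | succ m ih =>
    have h := ih.add ((hasDerivAt_pow (m + 1) x).div_const ((m + 1)! : ℝ))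
    rw [Finset.sum_range_succ _ m]
    refine (h.congr_deriv ?_).congr_of_eventuallyEq (Eventually.of_forall fun y => ?_)
    · congr 1
      rw [Nat.factorial_succ]
      have : (m ! : ℝ) ≠ 0 := by positivity
      push_cast
      field_simp
    · simp only [Pi.add_apply]
      rw [Finset.sum_range_succ _ (m + 1)]

open Nat in
theorem exp_neg_mul_sum_antitone (m : ℕ) {x y : ℝ} (hx : 0 ≤ x) (hxy : x ≤ y) :
    Real.exp (-y) * ∑ j ∈ Finset.range m, y ^ j / (j ! : ℝ) ≤
      Real.exp (-x) * ∑ j ∈ Finset.range m, x ^ j / (j ! : ℝ) := by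
  obtain _ | m := m
  · simp
  have hd : ∀ z : ℝ, HasDerivAt
      (fun z : ℝ => Real.exp (-z) * ∑ j ∈ Finset.range (m + 1), z ^ j / (j ! : ℝ))
      (-(Real.exp (-z) * (z ^ m / (m ! : ℝ)))) z := fun z => by
    have h := ((hasDerivAt_neg z).exp).mul (hasDerivAt_sum_pow_div_factorial m z)
    refine h.congr_deriv ?_
    rw [Finset.sum_range_succ]
    ring
  refine antitoneOn_of_deriv_nonpos (convex_Ici (0 : ℝ))
    (fun z _ => (hd z).continuousAt.continuousWithinAt)
    (fun z _ => (hd z).differentiableAt.differentiableWithinAt) (fun z hz => ?_)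
    (Set.mem_Ici.2 hx) (Set.mem_Ici.2 (hx.trans hxy)) hxy
  rw [(hd z).deriv]
  rw [interior_Ici, Set.mem_Ioi] at hz
  have : 0 ≤ Real.exp (-z) * (z ^ m / (m ! : ℝ)) := by positivity
  linarith

theorem weight_nonneg (m : ℕ) {t : ℝ} (ht : 0 < t) (n : ℕ) : 0 ≤ weight m t n := by
  unfold weight
  have := Real.log_natCast_nonneg n
  positivity

theorem weight_zero (m : ℕ) (t : ℝ) : weight m t 0 = 0 := by
  unfold weight
  rw [Nat.cast_zero, Real.zero_rpow (by norm_num), zero_mul]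

theorem weight_le (m : ℕ) {t : ℝ} (ht : 0 < t) {n : ℕ} (hn : n ≠ 0) :
    weight m t n ≤ (n : ℝ) ^ (-(1 - t)) := by
  have h0 : (0 : ℝ) < n := by positivity
  have hl := Real.log_natCast_nonneg n
  have h := Real.sum_le_exp_of_nonneg (x := (1 / 2 + t) * Real.log n) (by positivity) m
  have he : Real.exp ((1 / 2 + t) * Real.log n) = (n : ℝ) ^ (1 / 2 + t) := by
    rw [Real.rpow_def_of_pos h0, mul_comm]
  rw [he] at h
  calc weight m t n ≤ (n : ℝ) ^ (-(3 / 2) : ℝ) * (n : ℝ) ^ (1 / 2 + t) := by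
        unfold weight; gcongr
    _ = _ := by rw [← Real.rpow_add h0]; congr 1; ring

theorem weight_succ_le (m : ℕ) {t : ℝ} (ht0 : 0 < t) (ht : t ≤ 1) {n : ℕ} (hn : n ≠ 0) :
    weight m t (n + 1) ≤ weight m t n := by
  have h0 : (0 : ℝ) < n := by positivity
  have h1 : (0 : ℝ) < (n + 1 : ℕ) := by positivity
  have key : ∀ k : ℕ, (0 : ℝ) < k → weight m t k = (k : ℝ) ^ (-(1 - t)) *
      (Real.exp (-((1 / 2 + t) * Real.log k)) *
        ∑ j ∈ Finset.range m, ((1 / 2 + t) * Real.log k) ^ j / (j.factorial : ℝ)) := by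
    intro k hk
    have he : Real.exp (-((1 / 2 + t) * Real.log k)) = (k : ℝ) ^ (-(1 / 2 + t)) := by
      rw [Real.rpow_def_of_pos hk]; ring_nf
    rw [he, ← mul_assoc, ← Real.rpow_add hk, weight]
    ring_nf
  have hl : Real.log n ≤ Real.log (n + 1 : ℕ) := Real.log_le_log h0 (by push_cast; linarith)
  have hl0 := Real.log_natCast_nonneg n
  rw [key _ h0, key _ h1]
  have hl1 := Real.log_natCast_nonneg (n + 1)
  refine mul_le_mul ?_ (exp_neg_mul_sum_antitone m (by positivity) (by gcongr)) (by positivity)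
    (by positivity)
  exact Real.rpow_le_rpow_of_nonpos h0 (by push_cast; linarith) (by linarith)

open Nat in
/-- The weight at a square, bounded below uniformly in the truncation order and the exponent. -/
theorem weight_sq_ge {m m' : ℕ} (hm : m' ≤ m) {t : ℝ} (ht : 0 < t) {k : ℕ} (hk : k ≠ 0) :
    (∑ j ∈ Finset.range m', Real.log k ^ j / (j ! : ℝ)) / (k : ℝ) ^ 3 ≤ weight m t (k ^ 2) := by
  have h0 : (0 : ℝ) < k := by positivity
  have hl := Real.log_natCast_nonneg k
  have e1 : ((k ^ 2 : ℕ) : ℝ) ^ (-(3 / 2) : ℝ) = ((k : ℝ) ^ 3)⁻¹ := by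
    push_cast
    rw [← Real.rpow_natCast, ← Real.rpow_natCast, ← Real.rpow_mul h0.le, ← Real.rpow_neg h0.le]
    norm_num
  have e2 : Real.log ((k ^ 2 : ℕ) : ℝ) = 2 * Real.log k := by push_cast; rw [Real.log_pow]; simp
  unfold weight
  rw [e1, e2, div_eq_inv_mul]
  gcongr ?_ * ?_
  refine (Finset.sum_le_sum fun j _ => ?_).trans (Finset.sum_le_sum_of_subset_of_nonneg
    (Finset.range_subset_range.2 hm) fun j _ _ => by positivity)
  gcongr
  nlinarith

open Nat in
/-- The contribution of the squares `1`, `4`, `9`, `16`. -/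
theorem weight_squares_ge {m : ℕ} (hm : 10 ≤ m) {t : ℝ} (ht : 0 < t) :
    1.42 ≤ weight m t (1 ^ 2) + weight m t (2 ^ 2) + weight m t (3 ^ 2) + weight m t (4 ^ 2) := by
  have h1 := weight_sq_ge hm ht (k := 1) one_ne_zero
  have h2 := weight_sq_ge hm ht (k := 2) two_ne_zero
  have h3 := weight_sq_ge hm ht (k := 3) three_ne_zero
  have h4 := weight_sq_ge hm ht (k := 4) four_ne_zero
  have l2 : (0.693 : ℝ) ≤ Real.log 2 := by linarith [Real.log_two_gt_d9]
  have l3 : (1.098 : ℝ) ≤ Real.log 3 := by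
    rw [Real.le_log_iff_exp_le (by norm_num)]
    have : Real.exp 1.098 = Real.exp 1 * Real.exp 0.098 := by rw [← Real.exp_add]; norm_num
    rw [this]
    have e1 := Real.exp_one_lt_d9
    have e2 := Real.exp_bound' (x := 0.098) (by norm_num) (by norm_num) (n := 4) (by norm_num)
    norm_num [Finset.sum_range_succ, Nat.factorial] at e2
    nlinarith [Real.exp_pos 0.098]
  have l4 : (1.386 : ℝ) ≤ Real.log 4 := by
    rw [show (4 : ℝ) = 2 ^ 2 by norm_num, Real.log_pow]
    push_cast
    linarith
  have mono : ∀ {x y : ℝ}, 0 ≤ x → x ≤ y →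
      ∑ j ∈ Finset.range 10, x ^ j / (j ! : ℝ) ≤ ∑ j ∈ Finset.range 10, y ^ j / (j ! : ℝ) :=
    fun hx hxy => Finset.sum_le_sum fun j _ => by gcongr
  have m2 := mono (by norm_num) l2
  have m3 := mono (by norm_num) l3
  have m4 := mono (by norm_num) l4
  have k2 : (1.999 : ℝ) ≤ ∑ j ∈ Finset.range 10, (0.693 : ℝ) ^ j / (j ! : ℝ) := by
    norm_num [Finset.sum_range_succ, Nat.factorial]
  have k3 : (2.997 : ℝ) ≤ ∑ j ∈ Finset.range 10, (1.098 : ℝ) ^ j / (j ! : ℝ) := by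
    norm_num [Finset.sum_range_succ, Nat.factorial]
  have k4 : (3.99 : ℝ) ≤ ∑ j ∈ Finset.range 10, (1.386 : ℝ) ^ j / (j ! : ℝ) := by
    norm_num [Finset.sum_range_succ, Nat.factorial]
  have g1 : (1 : ℝ) ≤ weight m t (1 ^ 2) := by
    refine le_trans ?_ h1
    norm_num [Finset.sum_range_succ, Nat.factorial]
  have g2 : (1.999 / 8 : ℝ) ≤ weight m t (2 ^ 2) := by
    refine le_trans ?_ h2
    push_cast at m2 ⊢
    rw [show (2 : ℝ) ^ 3 = 8 by norm_num]
    gcongr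
    exact k2.trans m2
  have g3 : (2.997 / 27 : ℝ) ≤ weight m t (3 ^ 2) := by
    refine le_trans ?_ h3
    push_cast at m3 ⊢
    rw [show (3 : ℝ) ^ 3 = 27 by norm_num]
    gcongr
    exact k3.trans m3
  have g4 : (3.99 / 64 : ℝ) ≤ weight m t (4 ^ 2) := by
    refine le_trans ?_ h4
    push_cast at m4 ⊢
    rw [show (4 : ℝ) ^ 3 = 64 by norm_num]
    gcongr
    exact k4.trans m4
  norm_num at g1 g2 g3 g4 ⊢
  linarith

/-- A sequence that is at least one on nonzero squares has weighted sum at least `1.42`. -/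
theorem le_tsum_mul_weight {m : ℕ} (hm : 10 ≤ m) {t : ℝ} (ht : 0 < t) {r : ℕ → ℝ}
    (hr : ∀ n, 0 ≤ r n) (hsq : ∀ k, k ≠ 0 → 1 ≤ r (k ^ 2))
    (hs : Summable fun n => r n * weight m t n) : 1.42 ≤ ∑' n, r n * weight m t n := by
  have h := hs.sum_le_tsum ({1 ^ 2, 2 ^ 2, 3 ^ 2, 4 ^ 2} : Finset ℕ)
    (fun n _ => mul_nonneg (hr n) (weight_nonneg m ht n))
  have hw := weight_squares_ge hm ht
  have key : ∀ k, k ≠ 0 → weight m t (k ^ 2) ≤ r (k ^ 2) * weight m t (k ^ 2) := fun k hk =>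
    le_mul_of_one_le_left (weight_nonneg m ht _) (hsq k hk)
  have k1 := key 1 one_ne_zero
  have k2 := key 2 two_ne_zero
  have k3 := key 3 three_ne_zero
  have k4 := key 4 four_ne_zero
  rw [Finset.sum_insert (by decide), Finset.sum_insert (by decide), Finset.sum_insert (by decide),
    Finset.sum_singleton] at h
  refine hw.trans (le_trans ?_ h)
  rw [add_assoc, add_assoc]
  exact add_le_add k1 (add_le_add k2 (add_le_add k3 k4))

end ExponentTwo

namespace ExponentTwo

section Zero

open Complex Filter Topology MeasureTheory Set

/-- A nonnegative sequence whose Dirichlet series is `ζ R` with `R` entire, bounded by `B` on the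
disc used in Estermann's argument, and which is at least one on nonzero squares. -/
structure IsEstermann (r : ℕ → ℝ) (R : ℂ → ℂ) (B : ℝ) : Prop where
  differentiable : Differentiable ℂ R
  summable : ∀ s : ℂ, 1 < s.re → LSeriesSummable (fun n => (r n : ℂ)) s
  lseries : ∀ s : ℂ, 1 < s.re → LSeries (fun n => (r n : ℂ)) s = riemannZeta s * R s
  bound : ∀ s : ℂ, 1 / 2 ≤ s.re → ‖s‖ ≤ 5 / 2 → ‖R s‖ ≤ B
  nonneg : ∀ n, 0 ≤ r n
  one_le_sq : ∀ k, k ≠ 0 → 1 ≤ r (k ^ 2)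

open ComplexOrder in
theorem IsEstermann.one_nonneg {r : ℕ → ℝ} {R : ℂ → ℂ} {B : ℝ} (h : IsEstermann r R B) :
    0 ≤ R 1 := by
  have hc : Tendsto (fun x : ℝ => entireZeta x * R x) (𝓝[>] 1) (𝓝 (entireZeta 1 * R 1)) := by
    have : Continuous fun x : ℝ => entireZeta x * R x :=
      (differentiable_entireZeta.mul h.differentiable).continuous.comp continuous_ofReal
    simpa using (this.tendsto 1).mono_left nhdsWithin_le_nhds
  rw [entireZeta_one, one_mul] at hc
  refine ge_of_tendsto hc ?_
  filter_upwards [self_mem_nhdsWithin] with x hx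
  have hx : (1 : ℝ) < x := hx
  have hne : (x : ℂ) ≠ 1 := by exact_mod_cast hx.ne'
  rw [entireZeta_of_ne hne, mul_assoc, ← h.lseries x (by simpa using hx)]
  refine mul_nonneg ?_ (tsum_nonneg fun n => LSeries.term_nonneg ?_ x)
  · have : (0 : ℝ) ≤ x - 1 := by linarith
    exact_mod_cast this
  · exact_mod_cast h.nonneg n

theorem IsEstermann.ofReal_re_one {r : ℕ → ℝ} {R : ℂ → ℂ} {B : ℝ} (h : IsEstermann r R B) :
    R 1 = ((R 1).re : ℂ) ∧ 0 ≤ (R 1).re := by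
  have := Complex.nonneg_iff.1 h.one_nonneg
  exact ⟨Complex.ext rfl (by simpa using this.2.symm), this.1⟩

theorem IsEstermann.main {r : ℕ → ℝ} {R : ℂ → ℂ} {B : ℝ} (h : IsEstermann r R B) {t : ℝ}
    (ht0 : 0 < t) (ht : t < 1 / 2) (m : ℕ) :
    Summable (fun n => r n * weight m t n) ∧
    ‖riemannZeta (1 - t) * R (1 - t) -
        ((∑' n, r n * weight m t n - (R 1).re / t * (1 + 2 * t) ^ m : ℝ) : ℂ)‖ ≤
      7 * B * (1 / 2 + t) ^ m / (1 / 2 - t) :=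
  estermann_zeta_mul h.differentiable h.summable h.lseries h.ofReal_re_one.1 h.bound ht0 ht m

theorem im_eq_zero_of_estermann {z : ℂ} {C t : ℝ} (ht0 : 0 < t) (ht : t < 1 / 2) {x : ℕ → ℝ}
    (h : ∀ m, ‖z - (x m : ℂ)‖ ≤ C * (1 / 2 + t) ^ m / (1 / 2 - t)) : z.im = 0 := by
  have ht' : Tendsto (fun m : ℕ => C * (1 / 2 + t) ^ m / (1 / 2 - t)) atTop (𝓝 0) := by
    have := ((tendsto_pow_atTop_nhds_zero_of_lt_one (r := 1 / 2 + t) (by linarith)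
      (by linarith)).const_mul C).div_const (1 / 2 - t)
    simpa using this
  have : |z.im| ≤ 0 := by
    refine ge_of_tendsto ht' (Eventually.of_forall fun m => ?_)
    have h1 := abs_im_le_norm (z - (x m : ℂ))
    rw [sub_im, ofReal_im, sub_zero] at h1
    exact h1.trans (h m)
  exact abs_nonpos_iff.1 this

theorem IsEstermann.im_eq_zero {r : ℕ → ℝ} {R : ℂ → ℂ} {B : ℝ} (h : IsEstermann r R B) {t : ℝ}
    (ht0 : 0 < t) (ht : t < 1 / 2) : (riemannZeta (1 - t) * R (1 - t)).im = 0 :=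
  im_eq_zero_of_estermann ht0 ht fun m => (h.main ht0 ht m).2

/-- At a zero, the residue term is nearly the smoothed sum. -/
theorem IsEstermann.abs_sub_le_of_zero {r : ℕ → ℝ} {R : ℂ → ℂ} {B : ℝ} (h : IsEstermann r R B)
    {t : ℝ} (ht0 : 0 < t) (ht : t < 1 / 2) (hz : riemannZeta (1 - t) * R (1 - t) = 0) (m : ℕ) :
    |∑' n, r n * weight m t n - (R 1).re / t * (1 + 2 * t) ^ m| ≤
      7 * B * (1 / 2 + t) ^ m / (1 / 2 - t) := by
  have := (h.main ht0 ht m).2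
  rwa [hz, zero_sub, norm_neg, norm_real] at this

theorem IsEstermann.le_of_zero {r : ℕ → ℝ} {R : ℂ → ℂ} {B : ℝ} (h : IsEstermann r R B)
    {t : ℝ} (ht0 : 0 < t) (ht : t < 1 / 2) (hz : riemannZeta (1 - t) * R (1 - t) = 0) {m : ℕ}
    (hm : 10 ≤ m) : 1.42 ≤ (R 1).re / t * (1 + 2 * t) ^ m +
      7 * B * (1 / 2 + t) ^ m / (1 / 2 - t) := by
  have h1 := le_tsum_mul_weight hm ht0 h.nonneg h.one_le_sq (h.main ht0 ht m).1
  have h2 := abs_le.1 (h.abs_sub_le_of_zero ht0 ht hz m)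
  linarith [h2.2]

/-- If the residue is small, there is a real zero close to one. -/
theorem IsEstermann.exists_zero {r : ℕ → ℝ} {R : ℂ → ℂ} {B : ℝ} (h : IsEstermann r R B)
    (hR : R 1 ≠ 0) {t₀ : ℝ} (h0 : 0 < t₀) (h1 : t₀ < 1 / 2) {m : ℕ} (hm : 10 ≤ m)
    (hlt : (R 1).re / t₀ * (1 + 2 * t₀) ^ m +
      7 * B * (1 / 2 + t₀) ^ m / (1 / 2 - t₀) < 1.42) :
    ∃ t : ℝ, 0 < t ∧ t < t₀ ∧ riemannZeta (1 - t) * R (1 - t) = 0 := by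
  have hpos : 0 < (R 1).re := lt_of_le_of_ne h.ofReal_re_one.2 fun h' => hR <| by
    rw [h.ofReal_re_one.1, ← h', ofReal_zero]
  set g : ℝ → ℝ := fun t => (entireZeta ((1 - t : ℝ) : ℂ) * R ((1 - t : ℝ) : ℂ)).re with hg
  have hgc : Continuous g := continuous_re.comp
    ((differentiable_entireZeta.mul h.differentiable).continuous.comp
      (continuous_ofReal.comp (continuous_const.sub continuous_id)))
  have hg0 : 0 < g 0 := by simpa [hg, entireZeta_one] using hpos
  have hgt : ∀ t : ℝ, 0 < t → g t = -t * (riemannZeta (1 - t) * R (1 - t)).re := by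
    intro t ht
    have hne : ((1 - t : ℝ) : ℂ) ≠ 1 := by
      intro h'
      have : 1 - t = 1 := by exact_mod_cast h'
      linarith
    simp only [hg]
    rw [entireZeta_of_ne hne, mul_assoc]
    have : ((1 - t : ℝ) : ℂ) - 1 = ((-t : ℝ) : ℂ) := by push_cast; ring
    rw [this, re_ofReal_mul]
    push_cast
    rfl
  have hgt0 : g t₀ < 0 := by
    have ha := le_tsum_mul_weight hm h0 h.nonneg h.one_le_sq (h.main h0 h1 m).1
    have hb := (abs_re_le_norm _).trans (h.main h0 h1 m).2
    rw [sub_re, ofReal_re] at hb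
    have hc := (abs_le.1 hb).1
    rw [hgt _ h0]
    have : 0 < (riemannZeta (1 - t₀) * R (1 - t₀)).re := by linarith
    nlinarith
  obtain ⟨t, ⟨ht0, ht1⟩, htz⟩ := intermediate_value_Ioo' h0.le hgc.continuousOn
    (show (0 : ℝ) ∈ Ioo (g t₀) (g 0) from ⟨hgt0, hg0⟩)
  refine ⟨t, ht0, ht1, ?_⟩
  rw [hgt t ht0] at htz
  refine Complex.ext ?_ (by simpa using h.im_eq_zero ht0 (ht1.trans h1))
  rw [zero_re]
  rcases mul_eq_zero.1 htz with h' | h'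
  · linarith
  · exact h'

theorem riemannZeta_re_le {t : ℝ} (ht0 : 0 < t) (ht : t < 1) :
    (riemannZeta (1 - t)).re ≤ -(1 - t) / t := by
  have hne : (1 - t : ℂ) ≠ 1 := by
    intro h'
    have : (t : ℂ) = 0 := by linear_combination -h'
    exact ht0.ne' (by exact_mod_cast this)
  have h := entireZeta_eq (s := (1 - t : ℂ)) (by simpa using ht)
  rw [entireZeta_of_ne hne] at h
  have hi : ∫ u in Ioi (1 : ℝ), ((Int.fract u : ℝ) : ℂ) * (u : ℂ) ^ (-((1 - t : ℂ) + 1)) =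
      ((∫ u in Ioi (1 : ℝ), Int.fract u * u ^ (-((1 - t) + 1)) : ℝ) : ℂ) := by
    rw [← integral_complex_ofReal]
    refine setIntegral_congr_fun measurableSet_Ioi fun u hu => ?_
    have hu : (1 : ℝ) < u := hu
    push_cast [ofReal_cpow (by linarith : 0 ≤ u)]
    rfl
  have hi0 : 0 ≤ ∫ u in Ioi (1 : ℝ), Int.fract u * u ^ (-((1 - t) + 1)) :=
    setIntegral_nonneg measurableSet_Ioi fun u hu =>
      mul_nonneg (Int.fract_nonneg u) (Real.rpow_nonneg (by linarith [show (1 : ℝ) < u from hu]) _)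
  rw [hi] at h
  set I := ∫ u in Ioi (1 : ℝ), Int.fract u * u ^ (-((1 - t) + 1))
  have h2 : ((-t : ℝ) : ℂ) * riemannZeta (1 - t) = (((1 - t) + t * (1 - t) * I : ℝ) : ℂ) := by
    push_cast
    linear_combination h
  have h3 := congrArg re h2
  rw [re_ofReal_mul, ofReal_re] at h3
  rw [le_div_iff₀ ht0]
  have : 0 ≤ t * (1 - t) * I := mul_nonneg (mul_nonneg ht0.le (by linarith)) hi0
  nlinarith

/-- The total mass of the weights. -/
theorem summable_weight {t : ℝ} (ht0 : 0 < t) (ht : t < 1 / 2) (m : ℕ) :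
    Summable (weight m t) ∧ ∑' n, weight m t n ≤ ((1 + 2 * t) ^ m - 1) / t + 1 +
      7 * (1 / 2 + t) ^ m / (1 / 2 - t) := by
  have h := estermann_zeta_mul (r := fun _ => 1) (l := 1) (B := 1) (R := fun _ => 1)
    (differentiable_const _)
    (fun s hs => by simpa [Pi.one_def] using LSeriesSummable_one_iff.2 hs)
    (fun s hs => by simpa [Pi.one_def] using LSeries_one_eq_riemannZeta hs) (by simp)
    (fun s _ _ => by simp) ht0 ht m
  simp only [one_mul, mul_one] at h
  refine ⟨h.1, ?_⟩
  have hb := (abs_re_le_norm _).trans h.2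
  rw [sub_re, ofReal_re] at hb
  have hc := (abs_le.1 hb).1
  have hd := riemannZeta_re_le ht0 (by linarith)
  have e1 : ((1 + 2 * t) ^ m - 1) / t + 1 = 1 / t * (1 + 2 * t) ^ m + -(1 - t) / t := by
    field_simp
    ring
  rw [e1]
  linarith

open ComplexOrder in
theorem isEstermann_quadratic {q : ℕ} [NeZero q] {χ : DirichletCharacter ℂ q} (h2 : χ ^ 2 = 1)
    (hχ : χ ≠ 1) : IsEstermann (fun n => (χ.zetaMul n).re) χ.LFunction (10 * √q) := by
  have hre : (fun n : ℕ => (((χ.zetaMul n).re : ℝ) : ℂ)) = χ.zetaMul := by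
    ext n
    exact (zetaMul_eq_ofReal h2 n).symm
  refine ⟨DirichletCharacter.differentiable_LFunction hχ, fun s hs => ?_, fun s hs => ?_,
    fun s h h' => norm_LFunction_le hχ h h', zetaMul_re_nonneg h2, fun k hk => ?_⟩
  · rw [hre]
    exact DirichletCharacter.LSeriesSummable_zetaMul χ hs
  · rw [hre]
    exact LSeries_zetaMul χ hs
  · simpa using (Complex.le_def.1 (one_le_zetaMul_sq h2 hk)).1

open ComplexOrder in
theorem isEstermann_biquadratic {q₁ q₂ : ℕ} [NeZero q₁] [NeZero q₂] {χ₁ : DirichletCharacter ℂ q₁}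
    {χ₂ : DirichletCharacter ℂ q₂} (h1 : χ₁ ^ 2 = 1) (h2 : χ₂ ^ 2 = 1) (hχ₁ : χ₁ ≠ 1)
    (hχ₂ : χ₂ ≠ 1) (hχ : prodChar χ₁ χ₂ ≠ 1) :
    IsEstermann (fun n => (fourConv χ₁ χ₂ (prodChar χ₁ χ₂) n).re)
      (fun s => χ₁.LFunction s * (χ₂.LFunction s * (prodChar χ₁ χ₂).LFunction s))
      (1000 * (q₁ * q₂)) := by
  have hn := fourConv_nonneg (prodChar_apply χ₁ χ₂) h1 h2
  have hre : (fun n : ℕ => (((fourConv χ₁ χ₂ (prodChar χ₁ χ₂) n).re : ℝ) : ℂ)) =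
      fourConv χ₁ χ₂ (prodChar χ₁ χ₂) := by
    ext n
    exact Complex.ext (by simp) (by simpa using (Complex.nonneg_iff.1 (hn n)).2)
  refine ⟨(DirichletCharacter.differentiable_LFunction hχ₁).mul
    ((DirichletCharacter.differentiable_LFunction hχ₂).mul
      (DirichletCharacter.differentiable_LFunction hχ)), fun s hs => ?_, fun s hs => ?_,
    fun s h h' => ?_, fun n => (Complex.nonneg_iff.1 (hn n)).1, fun k hk => ?_⟩
  · rw [hre]
    exact LSeriesSummable_fourConv _ _ _ hs
  · rw [hre, LSeries_fourConv _ _ _ hs, mul_assoc]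
  · rw [norm_mul, norm_mul]
    have e : (1000 : ℝ) * (q₁ * q₂) = (10 * √q₁) * ((10 * √q₂) * (10 * √(q₁ * q₂ : ℕ))) := by
      push_cast
      rw [Real.sqrt_mul (by positivity)]
      have a := Real.mul_self_sqrt (Nat.cast_nonneg (α := ℝ) q₁)
      have b := Real.mul_self_sqrt (Nat.cast_nonneg (α := ℝ) q₂)
      linear_combination (-1000 * (√q₂ * √q₂)) * a - 1000 * (q₁ : ℝ) * b
    rw [e]
    gcongr
    · exact norm_LFunction_le hχ₁ h h'
    · exact norm_LFunction_le hχ₂ h h'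
    · exact norm_LFunction_le hχ h h'
  · simpa using (Complex.le_def.1 (one_le_fourConv_sq (prodChar_apply χ₁ χ₂) h1 h2 hk)).1

end Zero

end ExponentTwo

namespace ExponentTwo

theorem sum_inv_le_prod {q : ℕ} (hq : q ≠ 0) {Z : Finset ℕ}
    (hZ : ∀ w ∈ Z, Squarefree w ∧ w ∣ q) :
    ∑ w ∈ Z, (w : ℝ)⁻¹ ≤ ∏ p ∈ q.primeFactors, (1 + (p : ℝ)⁻¹) := by
  rw [Finset.prod_one_add]
  have h1 : ∑ w ∈ Z, (w : ℝ)⁻¹ = ∑ w ∈ Z, ∏ p ∈ w.primeFactors, (p : ℝ)⁻¹ := by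
    refine Finset.sum_congr rfl fun w hw => ?_
    rw [Finset.prod_inv_distrib]
    nth_rw 1 [← Nat.prod_primeFactors_of_squarefree (hZ w hw).1]
    push_cast
    rfl
  have hinj : Set.InjOn Nat.primeFactors (Z : Set ℕ) := by
    intro a ha b hb hab
    rw [← Nat.prod_primeFactors_of_squarefree (hZ a ha).1,
      ← Nat.prod_primeFactors_of_squarefree (hZ b hb).1, hab]
  rw [h1, ← Finset.sum_image (f := fun S : Finset ℕ => ∏ p ∈ S, (p : ℝ)⁻¹) hinj]
  refine Finset.sum_le_sum_of_subset_of_nonneg (fun S hS => ?_) fun S _ _ => by positivity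
  obtain ⟨w, hw, rfl⟩ := Finset.mem_image.1 hS
  exact Finset.mem_powerset.2 (Nat.primeFactors_mono (hZ w hw).2 hq)

theorem sum_rpow_three_half_le (N : ℕ) :
    ∑ k ∈ Finset.Icc 1 N, (k : ℝ) ^ (-(3 / 2) : ℝ) ≤ 3 := by
  suffices h : ∑ k ∈ Finset.Icc 1 (N + 1), (k : ℝ) ^ (-(3 / 2) : ℝ) ≤ 3 - 2 / √(N + 1 : ℝ) by
    refine le_trans (Finset.sum_le_sum_of_subset_of_nonneg
      (Finset.Icc_subset_Icc_right N.le_succ) fun k _ _ => by positivity) (h.trans ?_)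
    have : 0 ≤ 2 / √(N + 1 : ℝ) := by positivity
    linarith
  induction N with
  | zero => norm_num
  | succ N ih =>
    rw [Finset.sum_Icc_succ_top (by omega)]
    refine (add_le_add_left ih _).trans ?_
    have e : ((N + 1 + 1 : ℕ) : ℝ) ^ (-(3 / 2) : ℝ) = (√(N + 2 : ℝ) ^ 3)⁻¹ := by
      rw [Real.sqrt_eq_rpow, ← Real.rpow_natCast, ← Real.rpow_mul (by positivity),
        ← Real.rpow_neg (by positivity)]
      push_cast
      norm_num [add_assoc]
    rw [e]
    have e2 : √((N + 1 : ℕ) + 1 : ℝ) = √(N + 2 : ℝ) := by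
      push_cast
      ring_nf
    rw [e2]
    set x := √(N + 1 : ℝ)
    set y := √(N + 2 : ℝ)
    have hx : 0 < x := Real.sqrt_pos.2 (by positivity)
    have hy : 0 < y := Real.sqrt_pos.2 (by positivity)
    have hx2 : x ^ 2 = N + 1 := Real.sq_sqrt (by positivity)
    have hy2 : y ^ 2 = N + 2 := Real.sq_sqrt (by positivity)
    have hxy : x ≤ y := Real.sqrt_le_sqrt (by linarith)
    have key : (y ^ 3)⁻¹ + 2 / y ≤ 2 / x := by
      have h3 : (y - x) * (y + x) = 1 := by nlinarith
      have h4 : 1 ≤ 2 * y * (y - x) := by nlinarith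
      have : 2 / x - 2 / y - (y ^ 3)⁻¹ = (2 * y ^ 2 * (y - x) - x) / (x * y ^ 3) := by
        field_simp
      have h5 : 0 ≤ (2 * y ^ 2 * (y - x) - x) / (x * y ^ 3) :=
        div_nonneg (by nlinarith) (by positivity)
      linarith
    linarith

theorem sum_inv_sq_le (N : ℕ) : ∑ k ∈ Finset.Icc 1 N, ((k : ℝ) ^ 2)⁻¹ ≤ 1.645 := by
  have h := hasSum_zeta_two.summable.sum_le_tsum (Finset.Icc 1 N) (fun _ _ => by positivity)
  rw [hasSum_zeta_two.tsum_eq] at h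
  have := Real.pi_lt_d6
  have hp := Real.pi_pos
  simp only [one_div] at h
  refine h.trans ?_
  nlinarith

theorem sum_rpow_near_two_le {t : ℝ} (ht0 : 0 ≤ t) (ht : t ≤ 1 / 4) (N : ℕ) :
    ∑ k ∈ Finset.Icc 1 N, ((k : ℝ) ^ 2) ^ (-(1 - t)) ≤ 1.645 + 5.5 * t := by
  have hk : ∀ k ∈ Finset.Icc 1 N, ((k : ℝ) ^ 2) ^ (-(1 - t)) ≤
      (1 - 4 * t) * ((k : ℝ) ^ 2)⁻¹ + 4 * t * (k : ℝ) ^ (-(3 / 2) : ℝ) := by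
    intro k hk
    have h0 : (0 : ℝ) < k := by
      rw [Finset.mem_Icc] at hk
      exact_mod_cast (by omega : 0 < k)
    have h := Real.geom_mean_le_arith_mean2_weighted (w₁ := 1 - 4 * t) (w₂ := 4 * t)
      (p₁ := ((k : ℝ) ^ 2)⁻¹) (p₂ := (k : ℝ) ^ (-(3 / 2) : ℝ)) (by linarith) (by linarith)
      (by positivity) (by positivity) (by ring)
    refine le_trans (le_of_eq ?_) h
    rw [← Real.rpow_natCast, ← Real.rpow_neg h0.le, ← Real.rpow_mul h0.le, ← Real.rpow_mul h0.le,
      ← Real.rpow_mul h0.le, ← Real.rpow_add h0]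
    congr 1
    push_cast
    ring
  refine (Finset.sum_le_sum hk).trans ?_
  rw [Finset.sum_add_distrib, ← Finset.mul_sum, ← Finset.mul_sum]
  have h1 := sum_inv_sq_le N
  have h2 := sum_rpow_three_half_le N
  nlinarith

theorem sum_mul_nonneg_of_antitone {a W : ℕ → ℝ} (ha : ∀ N, 0 ≤ ∑ n ∈ Finset.Icc 1 N, a n)
    (hW : ∀ n, 0 ≤ W n) (hanti : ∀ n, n ≠ 0 → W (n + 1) ≤ W n) (N : ℕ) :
    0 ≤ ∑ n ∈ Finset.Icc 1 N, a n * W n := by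
  suffices h : W N * ∑ n ∈ Finset.Icc 1 N, a n ≤ ∑ n ∈ Finset.Icc 1 N, a n * W n from
    (mul_nonneg (hW N) (ha N)).trans h
  induction N with
  | zero => simp
  | succ N ih =>
    rw [Finset.sum_Icc_succ_top (by omega), Finset.sum_Icc_succ_top (by omega), mul_add]
    have : W (N + 1) * ∑ n ∈ Finset.Icc 1 N, a n ≤ W N * ∑ n ∈ Finset.Icc 1 N, a n := by
      rcases eq_or_ne N 0 with rfl | hN
      · simp
      · exact mul_le_mul_of_nonneg_right (hanti N hN) (ha N)
    linarith

open Classical in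
/-- Smoothed sums of a sequence supported, up to a part of small density, on a few square
classes. -/
theorem tsum_mul_weight_le {q : ℕ} (hq : q ≠ 0) {Z : Finset ℕ}
    (hZ : ∀ w ∈ Z, Squarefree w ∧ w ∣ q ∧ w ^ 2 ≤ q) {r g : ℕ → ℝ} {κ : ℝ} (hr : ∀ n, 0 ≤ r n)
    (hg : ∀ N : ℕ, ∑ n ∈ Finset.Icc 1 N, g n ≤ κ * N) (hκ : 0 ≤ κ)
    (hrg : ∀ n : ℕ, n ≠ 0 → r n ≤ {w ∈ Z | ∃ k, n = w * k ^ 2}.card + g n)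
    {t : ℝ} (ht0 : 0 < t) (ht : t ≤ 1 / 4) (m : ℕ) :
    ∑' n, r n * weight m t n ≤ (1.645 + 5.5 * t) * ((q : ℝ) ^ (t / 2) *
      ∏ p ∈ q.primeFactors, (1 + (p : ℝ)⁻¹)) + κ * ∑' n, weight m t n := by
  have hW := weight_nonneg m ht0
  have hsW := (summable_weight ht0 (by linarith) m).1
  have bound : ∀ N : ℕ, ∑ n ∈ Finset.Icc 1 N, r n * weight m t n ≤
      (1.645 + 5.5 * t) * ((q : ℝ) ^ (t / 2) *
      ∏ p ∈ q.primeFactors, (1 + (p : ℝ)⁻¹)) + κ * ∑' n, weight m t n := by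
    intro N
    have h1 : ∑ n ∈ Finset.Icc 1 N, r n * weight m t n ≤
        ∑ n ∈ Finset.Icc 1 N, ({w ∈ Z | ∃ k, n = w * k ^ 2}.card : ℝ) * weight m t n +
        ∑ n ∈ Finset.Icc 1 N, g n * weight m t n := by
      rw [← Finset.sum_add_distrib]
      refine Finset.sum_le_sum fun n hn => ?_
      rw [← add_mul]
      exact mul_le_mul_of_nonneg_right (hrg n (by simp at hn; omega)) (hW n)
    have h2 : ∑ n ∈ Finset.Icc 1 N, g n * weight m t n ≤ κ * ∑' n, weight m t n := by
      have := sum_mul_nonneg_of_antitone (a := fun n => κ - g n) (W := weight m t)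
        (fun N => by
          rw [Finset.sum_sub_distrib]
          have := hg N
          simp only [Finset.sum_const, Nat.card_Icc, Nat.add_sub_cancel, nsmul_eq_mul]
          linarith) hW
        (fun n hn => weight_succ_le m ht0 (by linarith) hn) N
      simp_rw [sub_mul] at this
      rw [Finset.sum_sub_distrib, ← Finset.mul_sum] at this
      have h3 := hsW.sum_le_tsum (Finset.Icc 1 N) (fun n _ => hW n)
      nlinarith
    have h3 : ∑ n ∈ Finset.Icc 1 N, ({w ∈ Z | ∃ k, n = w * k ^ 2}.card : ℝ) * weight m t n ≤
        ∑ w ∈ Z, ∑ k ∈ Finset.Icc 1 N, weight m t (w * k ^ 2) := by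
      have e1 : ∀ n ∈ Finset.Icc 1 N,
          ({w ∈ Z | ∃ k, n = w * k ^ 2}.card : ℝ) * weight m t n ≤
          ∑ w ∈ Z, ∑ k ∈ Finset.Icc 1 N, if n = w * k ^ 2 then weight m t n else 0 := by
        intro n hn
        rw [Finset.card_filter, Nat.cast_sum, Finset.sum_mul]
        refine Finset.sum_le_sum fun w hw => ?_
        have hpos : ∀ k ∈ Finset.Icc 1 N, 0 ≤ if n = w * k ^ 2 then weight m t n else 0 :=
          fun k _ => by split_ifs <;> simp [hW]
        split_ifs with hk
        · obtain ⟨k, hk⟩ := hk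
          have hn1 : 1 ≤ n ∧ n ≤ N := Finset.mem_Icc.1 hn
          have hw0 : w ≠ 0 := (hZ w hw).1.ne_zero
          have hk0 : k ≠ 0 := by rintro rfl; simp at hk; omega
          have hkN : k ∈ Finset.Icc 1 N := by
            rw [Finset.mem_Icc]
            refine ⟨Nat.one_le_iff_ne_zero.2 hk0, le_trans ?_ hn1.2⟩
            calc k ≤ k ^ 2 := Nat.le_self_pow two_ne_zero k
              _ ≤ w * k ^ 2 := Nat.le_mul_of_pos_left _ (Nat.pos_of_ne_zero hw0)
              _ = n := hk.symm
          refine le_trans (le_of_eq ?_) (Finset.single_le_sum hpos hkN)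
          rw [if_pos hk]
          simp
        · simpa using Finset.sum_nonneg hpos
      refine (Finset.sum_le_sum e1).trans ?_
      rw [Finset.sum_comm]
      refine Finset.sum_le_sum fun w _ => ?_
      rw [Finset.sum_comm]
      refine Finset.sum_le_sum fun k _ => ?_
      rw [Finset.sum_ite_eq']
      split_ifs <;> simp [hW]
    have h4 : ∑ w ∈ Z, ∑ k ∈ Finset.Icc 1 N, weight m t (w * k ^ 2) ≤
        ∑ w ∈ Z, ((q : ℝ) ^ (t / 2) * (w : ℝ)⁻¹) * (1.645 + 5.5 * t) := by
      refine Finset.sum_le_sum fun w hw => ?_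
      have hw0 : w ≠ 0 := (hZ w hw).1.ne_zero
      have hwp : (0 : ℝ) < w := by positivity
      have hwt : (w : ℝ) ^ (-(1 - t)) ≤ (q : ℝ) ^ (t / 2) * (w : ℝ)⁻¹ := by
        have : (w : ℝ) ^ t ≤ (q : ℝ) ^ (t / 2) := by
          calc (w : ℝ) ^ t = ((w : ℝ) ^ 2) ^ (t / 2) := by
                rw [← Real.rpow_natCast, ← Real.rpow_mul hwp.le]
                congr 1
                push_cast
                ring
            _ ≤ _ := Real.rpow_le_rpow (by positivity) (by exact_mod_cast (hZ w hw).2.2)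
              (by linarith)
        rw [neg_sub, Real.rpow_sub hwp, Real.rpow_one, div_eq_mul_inv]
        gcongr
      calc ∑ k ∈ Finset.Icc 1 N, weight m t (w * k ^ 2)
          ≤ ∑ k ∈ Finset.Icc 1 N, (w : ℝ) ^ (-(1 - t)) * ((k : ℝ) ^ 2) ^ (-(1 - t)) := by
            refine Finset.sum_le_sum fun k hk => ?_
            have hk0 : k ≠ 0 := by simp at hk; omega
            refine (weight_le m ht0 (by positivity)).trans (le_of_eq ?_)
            rw [← Real.mul_rpow hwp.le (by positivity)]
            push_cast
            rfl
        _ ≤ _ := by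
            rw [← Finset.mul_sum]
            gcongr
            exact sum_rpow_near_two_le ht0.le ht N
    rw [← Finset.sum_mul, ← Finset.mul_sum] at h4
    have h5 := sum_inv_le_prod hq fun w hw => ⟨(hZ w hw).1, (hZ w hw).2.1⟩
    have h6 : (q : ℝ) ^ (t / 2) * ∑ w ∈ Z, (w : ℝ)⁻¹ ≤
        (q : ℝ) ^ (t / 2) * ∏ p ∈ q.primeFactors, (1 + (p : ℝ)⁻¹) := by gcongr
    nlinarith
  refine Real.tsum_le_of_sum_range_le (fun n => mul_nonneg (hr n) (hW n)) fun N => ?_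
  refine le_trans ?_ (bound N)
  rw [← Finset.sum_subset_zero_on_sdiff (s₁ := (Finset.range N).erase 0) (s₂ := Finset.range N)
    (Finset.erase_subset _ _) ?_ fun _ _ => rfl]
  · refine Finset.sum_le_sum_of_subset_of_nonneg (fun n hn => ?_)
      fun n _ _ => mul_nonneg (hr n) (hW n)
    rw [Finset.mem_erase, Finset.mem_range] at hn
    rw [Finset.mem_Icc]
    omega
  · intro n hn
    have : n = 0 := by
      simp only [Finset.mem_sdiff, Finset.mem_erase] at hn
      tauto
    rw [this, weight_zero, mul_zero]

end ExponentTwo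

namespace ExponentTwo

section Truncation

open Complex Filter Topology MeasureTheory Set

theorem norm_LFunction_one_sub_sum_le {N : ℕ} [NeZero N] {χ : DirichletCharacter ℂ N}
    (hχ : χ ≠ 1) : ‖χ.LFunction 1 - ∑ n ∈ Finset.Icc 1 N, χ n * (n : ℂ)⁻¹‖ ≤ 1 := by
  have hN : (1 : ℝ) ≤ N := by exact_mod_cast NeZero.pos N
  set S : ℝ → ℂ := fun u => ∑ k ∈ Finset.Icc 1 ⌊u⌋₊, χ k with hS
  set c : ℕ → ℂ := fun n => if n = 0 then 0 else χ n with hc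
  have hcs : ∀ n : ℕ, ∑ k ∈ Finset.Icc 0 n, c k = ∑ k ∈ Finset.Icc 1 n, χ k := by
    intro n
    rw [Finset.Icc_eq_cons_Ioc (Nat.zero_le _), Finset.sum_cons, ← Finset.Icc_add_one_left_eq_Ioc]
    rw [show c 0 = 0 by simp [hc], zero_add]
    exact Finset.sum_congr rfl fun k hk => by
      rw [Finset.mem_Icc] at hk
      simp [hc, show k ≠ 0 by omega]
  have hSN : ∑ k ∈ Finset.Icc 1 N, χ k = 0 := by
    have := sum_Icc_character_add hχ 0
    simpa using this
  have hderiv : ∀ t : ℝ, 0 < t → HasDerivAt (fun u : ℝ => (u : ℂ)⁻¹) (-((t : ℂ) ^ 2)⁻¹) t :=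
    fun t ht => by
      have h := (hasDerivAt_inv (x := (t : ℂ)) (by exact_mod_cast ht.ne')).comp_ofReal
      exact h
  have hcont : ContinuousOn (fun u : ℝ => -((u : ℂ) ^ 2)⁻¹) (Icc 1 N) := by
    refine ContinuousOn.neg (ContinuousOn.inv₀ (by fun_prop) fun u hu => ?_)
    have : (0 : ℝ) < u := by linarith [hu.1]
    exact pow_ne_zero 2 (by exact_mod_cast this.ne')
  have habel := sum_mul_eq_sub_integral_mul₀' (f := fun u : ℝ => (u : ℂ)⁻¹) c (by simp [hc]) N
    (fun t ht => (hderiv t (by linarith [ht.1])).differentiableAt)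
    ((hcont.integrableOn_Icc).congr_fun (fun t ht => ((hderiv t (by linarith [ht.1])).deriv).symm)
      measurableSet_Icc)
  rw [hcs, hSN, mul_zero, zero_sub] at habel
  have e1 : ∑ k ∈ Finset.Icc 0 N, (((k : ℕ) : ℝ) : ℂ)⁻¹ * c k =
      ∑ n ∈ Finset.Icc 1 N, χ n * (n : ℂ)⁻¹ := by
    rw [Finset.Icc_eq_cons_Ioc (Nat.zero_le _), Finset.sum_cons, ← Finset.Icc_add_one_left_eq_Ioc]
    rw [show c 0 = 0 by simp [hc], mul_zero, zero_add]
    exact Finset.sum_congr rfl fun k hk => by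
      rw [Finset.mem_Icc] at hk
      simp [hc, show k ≠ 0 by omega, mul_comm]
  have e2 : ∫ t in Ioc (1 : ℝ) N, deriv (fun u : ℝ => (u : ℂ)⁻¹) t *
        ∑ k ∈ Finset.Icc 0 ⌊t⌋₊, c k = -∫ t in Ioc (1 : ℝ) N, S t * (t : ℂ) ^ (-((1 : ℂ) + 1)) := by
    rw [← integral_neg]
    refine setIntegral_congr_fun measurableSet_Ioc fun t ht => ?_
    rw [(hderiv t (by linarith [ht.1])).deriv, hcs]
    rw [show (-((1 : ℂ) + 1)) = -((2 : ℕ) : ℂ) by norm_num, cpow_neg, cpow_natCast]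
    ring
  rw [e1, e2, neg_neg] at habel
  have hfint : IntegrableOn (fun t : ℝ => S t * (t : ℂ) ^ (-((1 : ℂ) + 1))) (Ioi 1) := by
    have : IntegrableOn (fun u : ℝ => (u : ℂ) ^ (-((1 : ℂ) + 1))) (Ioi 1) :=
      integrableOn_Ioi_cpow_of_lt (by norm_num) zero_lt_one
    refine Integrable.bdd_mul this (c := N) ?_ (ae_of_all _ fun u => ?_)
    · exact (measurable_sum_Icc_floor fun n => χ n).aestronglyMeasurable
    · exact norm_sum_Icc_character_le hχ _
  have hsplit : ∫ t in Ioi (1 : ℝ), S t * (t : ℂ) ^ (-((1 : ℂ) + 1)) =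
      (∫ t in Ioc (1 : ℝ) N, S t * (t : ℂ) ^ (-((1 : ℂ) + 1))) +
        ∫ t in Ioi (N : ℝ), S t * (t : ℂ) ^ (-((1 : ℂ) + 1)) := by
    rw [← Ioc_union_Ioi_eq_Ioi hN]
    exact setIntegral_union (Ioc_disjoint_Ioi le_rfl) measurableSet_Ioi
      (hfint.mono_set Ioc_subset_Ioi_self) (hfint.mono_set (Ioi_subset_Ioi hN))
  rw [LFunction_eq_mul_integral hχ (by simp), one_mul, habel, hsplit, add_sub_cancel_left]
  have hg : IntegrableOn (fun t : ℝ => (N : ℝ) * t ^ (-2 : ℝ)) (Ioi N) :=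
    (integrableOn_Ioi_rpow_of_lt (by norm_num) (by linarith)).const_mul _
  refine (norm_integral_le_of_norm_le hg ?_).trans (le_of_eq ?_)
  · refine (ae_restrict_iff' measurableSet_Ioi).2 (ae_of_all _ fun t ht => ?_)
    have ht0 : (0 : ℝ) < t := by linarith [show (N : ℝ) < t from ht]
    rw [norm_mul, norm_cpow_eq_rpow_re_of_pos ht0]
    have : (-((1 : ℂ) + 1)).re = -2 := by norm_num
    rw [this]
    gcongr
    exact norm_sum_Icc_character_le hχ _
  · rw [integral_const_mul, integral_Ioi_rpow_of_lt (by norm_num) (by linarith)]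
    norm_num [Real.rpow_neg_one]

end Truncation

/-- The harmonic sum over integers up to `x` free of prime factors in `P`. -/
noncomputable def siftedHarmonic (P : Finset ℕ) (x : ℝ) : ℝ :=
  ∑ n ∈ (Finset.Icc 1 ⌊x⌋₊).filter (fun n => ∀ p ∈ P, ¬ p ∣ n), (n : ℝ)⁻¹

theorem siftedHarmonic_insert {P : Finset ℕ} {p : ℕ} (hp : p.Prime) (hP : ∀ r ∈ P, r.Prime)
    (hpP : p ∉ P) {x : ℝ} (hx : 0 < x) :
    siftedHarmonic (insert p P) x = siftedHarmonic P x - siftedHarmonic P (x / p) / p := by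
  have hp0 : (0 : ℝ) < p := by exact_mod_cast hp.pos
  rw [eq_sub_iff_add_eq]
  unfold siftedHarmonic
  rw [← Finset.sum_filter_add_sum_filter_not ((Finset.Icc 1 ⌊x⌋₊).filter
    (fun n => ∀ r ∈ P, ¬ r ∣ n)) (fun n => ¬ p ∣ n), Finset.filter_filter, Finset.filter_filter,
    Finset.sum_div]
  congr 1
  · refine Finset.sum_congr (Finset.filter_congr fun n _ => ?_) fun _ _ => rfl
    simp only [Finset.mem_insert, forall_eq_or_imp]
    tauto
  · refine Finset.sum_bij (fun m _ => p * m) (fun m hm => ?_)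
      (fun m _ m' _ h => Nat.eq_of_mul_eq_mul_left hp.pos h) (fun n hn => ?_) (fun m _ => ?_)
    · simp only [Finset.mem_filter, Finset.mem_Icc, not_not] at hm ⊢
      obtain ⟨⟨h1, h2⟩, h3⟩ := hm
      refine ⟨⟨Nat.mul_pos hp.pos h1, ?_⟩, fun r hr hd => ?_, dvd_mul_right _ _⟩
      · rw [Nat.le_floor_iff (by positivity), le_div_iff₀ hp0] at h2
        rw [Nat.le_floor_iff hx.le]
        push_cast
        linarith
      · rcases (hP r hr).dvd_mul.1 hd with h | h
        · rw [(Nat.prime_dvd_prime_iff_eq (hP r hr) hp).1 h] at hr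
          exact hpP hr
        · exact h3 r hr h
    · simp only [Finset.mem_filter, Finset.mem_Icc, not_not] at hn
      obtain ⟨⟨h1, h2⟩, h3, m, rfl⟩ := hn
      refine ⟨m, ?_, rfl⟩
      simp only [Finset.mem_filter, Finset.mem_Icc]
      refine ⟨⟨Nat.pos_of_ne_zero (by rintro rfl; simp at h1), ?_⟩,
        fun r hr hd => h3 r hr (hd.mul_left p)⟩
      rw [Nat.le_floor_iff hx.le] at h2
      rw [Nat.le_floor_iff (by positivity), le_div_iff₀ hp0]
      push_cast at h2
      linarith
    · push_cast
      field_simp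

theorem abs_siftedHarmonic_empty_sub_le {x : ℝ} (hx : 0 < x) :
    |siftedHarmonic ∅ x - (Real.log x + Real.eulerMascheroniConstant)| ≤ 2 / x := by
  have hγ0 := Real.one_half_lt_eulerMascheroniConstant
  have hγ1 := Real.eulerMascheroniConstant_lt_two_thirds
  have e : siftedHarmonic ∅ x = (harmonic ⌊x⌋₊ : ℝ) := by
    simp [siftedHarmonic, harmonic_eq_sum_Icc]
  rw [e]
  rcases lt_or_ge x 1 with h | h
  · rw [Nat.floor_eq_zero.2 h, harmonic_zero]
    have h1 := Real.log_le_sub_one_of_pos hx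
    have h2 := Real.one_sub_inv_le_log_of_pos hx
    have h3 : (1 : ℝ) ≤ x⁻¹ := (one_le_inv₀ hx).2 h.le
    have h4 : 2 / x = 2 * x⁻¹ := div_eq_mul_inv _ _
    rw [abs_le]
    push_cast
    constructor <;> linarith
  · set n := ⌊x⌋₊ with hn
    have hn1 : 1 ≤ n := Nat.one_le_floor_iff _ |>.2 h
    have hn0 : (0 : ℝ) < n := by exact_mod_cast hn1
    have hn1' : (1 : ℝ) ≤ n := by exact_mod_cast hn1
    have hnx : (n : ℝ) ≤ x := Nat.floor_le hx.le
    have hxn : x < n + 1 := Nat.lt_floor_add_one x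
    have a1 := Real.eulerMascheroniSeq_lt_eulerMascheroniConstant n
    have a2 := Real.eulerMascheroniConstant_lt_eulerMascheroniSeq' n
    rw [Real.eulerMascheroniSeq] at a1
    rw [Real.eulerMascheroniSeq', if_neg (by omega)] at a2
    have b1 : Real.log (n + 1) ≤ Real.log x + 2 / x := by
      have h1 := Real.log_le_sub_one_of_pos (x := (n + 1) / x) (by positivity)
      rw [Real.log_div (by positivity) hx.ne'] at h1
      have : (n + 1) / x - 1 ≤ 2 / x := by
        rw [div_sub_one hx.ne']
        gcongr
        linarith
      linarith
    have b2 : Real.log x ≤ Real.log n + 2 / x := by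
      have h1 := Real.log_le_sub_one_of_pos (x := x / n) (by positivity)
      rw [Real.log_div hx.ne' (by positivity)] at h1
      have : x / n - 1 ≤ 2 / x := by
        rw [div_sub_one hn0.ne', div_le_div_iff₀ hn0 hx]
        nlinarith
      linarith
    rw [abs_le]
    constructor <;> linarith

theorem abs_siftedHarmonic_sub_le {P : Finset ℕ} (hP : ∀ r ∈ P, r.Prime) {x : ℝ} (hx : 0 < x) :
    |siftedHarmonic P x - (∏ p ∈ P, (1 - (p : ℝ)⁻¹)) * (Real.log x +
      Real.eulerMascheroniConstant + ∑ p ∈ P, Real.log p / (p - 1))| ≤ 2 ^ P.card * (2 / x) := by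
  induction P using Finset.induction_on generalizing x with
  | empty => simpa using abs_siftedHarmonic_empty_sub_le hx
  | insert p P hpP ih =>
    have hP' : ∀ r ∈ P, r.Prime := fun r hr => hP r (Finset.mem_insert_of_mem hr)
    have hp : p.Prime := hP p (Finset.mem_insert_self _ _)
    have hp0 : (0 : ℝ) < p := by exact_mod_cast hp.pos
    have hp1 : (p : ℝ) - 1 ≠ 0 := by
      have : (1 : ℝ) < p := by exact_mod_cast hp.one_lt
      linarith
    rw [siftedHarmonic_insert hp hP' hpP hx, Finset.prod_insert hpP, Finset.sum_insert hpP,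
      Finset.card_insert_of_notMem hpP]
    have h1 := ih hP' hx
    have h2 := ih hP' (x := x / p) (by positivity)
    rw [Real.log_div hx.ne' hp0.ne'] at h2
    set Q := ∏ p ∈ P, (1 - (p : ℝ)⁻¹)
    set T := ∑ p ∈ P, Real.log p / ((p : ℝ) - 1)
    set γ := Real.eulerMascheroniConstant
    set A := siftedHarmonic P x
    set A' := siftedHarmonic P (x / p)
    have e : A - A' / p - (1 - (p : ℝ)⁻¹) * Q * (Real.log x + γ + (Real.log p / (p - 1) + T)) =
        (A - Q * (Real.log x + γ + T)) -
          (A' - Q * (Real.log x - Real.log p + γ + T)) / p := by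
      field_simp
      ring
    rw [e]
    refine (abs_sub _ _).trans ?_
    rw [abs_div, abs_of_pos hp0]
    have h3 : |A' - Q * (Real.log x - Real.log p + γ + T)| / p ≤ 2 ^ P.card * (2 / x) := by
      rw [div_le_iff₀ hp0]
      refine h2.trans (le_of_eq ?_)
      field_simp
    rw [pow_succ]
    linarith

end ExponentTwo

namespace ExponentTwo

theorem norm_LFunction_prodChar_one_le {q₁ q₂ : ℕ} [NeZero q₁] [NeZero q₂]
    {χ₁ : DirichletCharacter ℂ q₁} {χ₂ : DirichletCharacter ℂ q₂} (hχ : prodChar χ₁ χ₂ ≠ 1)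
    {P : Finset ℕ} (hP : ∀ p ∈ P, p.Prime ∧ p ∣ q₂) :
    ‖(prodChar χ₁ χ₂).LFunction 1‖ ≤ 1 + ((∏ p ∈ P, (1 - (p : ℝ)⁻¹)) *
      (Real.log (q₁ * q₂) + 2 / 3 + ∑ p ∈ P, Real.log p / (p - 1)) +
        2 ^ P.card * (2 / (q₁ * q₂))) := by
  have hN : (0 : ℝ) < (q₁ * q₂ : ℕ) := by exact_mod_cast NeZero.pos (q₁ * q₂)
  have h1 := norm_LFunction_one_sub_sum_le hχ
  have h2 : ‖∑ n ∈ Finset.Icc 1 (q₁ * q₂), prodChar χ₁ χ₂ n * (n : ℂ)⁻¹‖ ≤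
      siftedHarmonic P (q₁ * q₂ : ℕ) := by
    refine (norm_sum_le _ _).trans ?_
    rw [siftedHarmonic, Nat.floor_natCast, Finset.sum_filter]
    refine Finset.sum_le_sum fun n _ => ?_
    rw [norm_mul, norm_inv, Complex.norm_natCast]
    split_ifs with h
    · exact mul_le_of_le_one_left (by positivity) (DirichletCharacter.norm_le_one _ _)
    · push Not at h
      obtain ⟨p, hp, hpn⟩ := h
      have hu : ¬ IsUnit ((n : ℕ) : ZMod q₂) := by
        rw [ZMod.isUnit_iff_coprime]
        exact fun hc => (Nat.Prime.one_lt (hP p hp).1).ne'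
          (Nat.dvd_one.1 (hc ▸ Nat.dvd_gcd hpn (hP p hp).2))
      rw [prodChar_apply, MulChar.map_nonunit χ₂ hu, mul_zero, norm_zero, zero_mul]
  have h3 := (abs_le.1 (abs_siftedHarmonic_sub_le (P := P) (fun p hp => (hP p hp).1) hN)).2
  have h4 : 0 ≤ ∏ p ∈ P, (1 - (p : ℝ)⁻¹) := Finset.prod_nonneg fun p hp => by
    have : (1 : ℝ) ≤ p := by exact_mod_cast (hP p hp).1.one_lt.le
    have := inv_le_one_of_one_le₀ this
    linarith
  have h5 := Real.eulerMascheroniConstant_lt_two_thirds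
  have h6 := norm_le_norm_add_norm_sub' ((prodChar χ₁ χ₂).LFunction 1)
    (∑ n ∈ Finset.Icc 1 (q₁ * q₂), prodChar χ₁ χ₂ n * (n : ℂ)⁻¹)
  push_cast at h3 h2
  have h7 : (∏ p ∈ P, (1 - (p : ℝ)⁻¹)) * (Real.log (q₁ * q₂) +
      Real.eulerMascheroniConstant + ∑ p ∈ P, Real.log p / ((p : ℝ) - 1)) ≤
      (∏ p ∈ P, (1 - (p : ℝ)⁻¹)) * (Real.log (q₁ * q₂) + 2 / 3 +
        ∑ p ∈ P, Real.log p / ((p : ℝ) - 1)) := by gcongr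
  linarith

/-- The primes up to `31`. -/
def smallPrimes : Finset ℕ := {2, 3, 5, 7, 11, 13, 17, 19, 23, 29, 31}

theorem mem_smallPrimes {p : ℕ} (hp : p.Prime) : p ∈ smallPrimes ↔ p < 32 := by
  constructor
  · intro h
    simp only [smallPrimes, Finset.mem_insert, Finset.mem_singleton] at h
    omega
  · intro h
    revert hp
    interval_cases p <;> decide

theorem sum_log_div_le {P : Finset ℕ} (hP : P ⊆ smallPrimes) :
    ∑ p ∈ P, Real.log p / ((p : ℝ) - 1) ≤ 3.17 := by
  have hnn : ∀ p ∈ smallPrimes, 0 ≤ Real.log p / ((p : ℝ) - 1) := by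
    intro p hp
    have : 1 ≤ p := by
      simp only [smallPrimes, Finset.mem_insert, Finset.mem_singleton] at hp
      omega
    have : (1 : ℝ) ≤ p := by exact_mod_cast this
    exact div_nonneg (Real.log_nonneg this) (by linarith)
  refine (Finset.sum_le_sum_of_subset_of_nonneg hP fun p hp _ => hnn p hp).trans ?_
  have key : ∀ p i j : ℕ, 0 < p → 0 < i → p ^ i ≤ 2 ^ j →
      Real.log p ≤ j / i * 0.6931471808 := by
    intro p i j hp hi h
    have hp0 : (0 : ℝ) < p := by exact_mod_cast hp
    have h1 : Real.log ((p : ℝ) ^ i) ≤ Real.log ((2 : ℝ) ^ j) :=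
      Real.log_le_log (by positivity) (by exact_mod_cast h)
    rw [Real.log_pow, Real.log_pow] at h1
    have hi0 : (0 : ℝ) < i := by exact_mod_cast hi
    have hl := Real.log_two_lt_d9
    rw [div_mul_eq_mul_div, le_div_iff₀ hi0]
    have hj : (0 : ℝ) ≤ j := by positivity
    nlinarith
  have h2 := key 2 1 1 (by norm_num) (by norm_num) (by norm_num)
  have h3 := key 3 5 8 (by norm_num) (by norm_num) (by norm_num)
  have h5 := key 5 3 7 (by norm_num) (by norm_num) (by norm_num)
  have h7 := key 7 6 17 (by norm_num) (by norm_num) (by norm_num)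
  have h11 := key 11 2 7 (by norm_num) (by norm_num) (by norm_num)
  have h13 := key 13 4 15 (by norm_num) (by norm_num) (by norm_num)
  have h17 := key 17 10 41 (by norm_num) (by norm_num) (by norm_num)
  have h19 := key 19 4 17 (by norm_num) (by norm_num) (by norm_num)
  have h23 := key 23 7 32 (by norm_num) (by norm_num) (by norm_num)
  have h29 := key 29 1 5 (by norm_num) (by norm_num) (by norm_num)
  have h31 := key 31 1 5 (by norm_num) (by norm_num) (by norm_num)
  rw [smallPrimes]
  norm_num [Finset.sum_insert] at *
  linarith

theorem prod_primeFactors_le {q : ℕ} (hq : q ≠ 0) (h4 : 2 ∣ q → 4 ∣ q) {a : ℕ → ℝ}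
    (ha : ∀ p, 0 ≤ a p) {S : Finset ℕ} (hSp : ∀ p ∈ S, p.Prime)
    (hS : ∀ p ∈ S, (if p = 2 then 4 else p : ℝ) ≤ a p)
    (hS' : ∀ p : ℕ, p.Prime → p ∉ S → a p ≤ (if p = 2 then 4 else p : ℝ)) :
    ∏ p ∈ q.primeFactors, a p ≤ (∏ p ∈ S, a p / (if p = 2 then 4 else p : ℝ)) * q := by
  set b : ℕ → ℝ := fun p => if p = 2 then 4 else p with hb
  have hbpos : ∀ p, p.Prime → 0 < b p := by
    intro p hp
    have : (0 : ℝ) < p := by exact_mod_cast hp.pos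
    simp only [hb]
    split_ifs <;> linarith
  have h1 : ∏ p ∈ q.primeFactors, b p ≤ q := by
    nth_rw 2 [← Nat.prod_factorization_pow_eq_self hq]
    rw [Finsupp.prod, Nat.support_factorization]
    push_cast
    refine Finset.prod_le_prod (fun p hp => (hbpos p (Nat.prime_of_mem_primeFactors hp)).le)
      fun p hp => ?_
    have hpp := Nat.prime_of_mem_primeFactors hp
    have hpd := Nat.dvd_of_mem_primeFactors hp
    have hp1 : (1 : ℝ) ≤ p := by exact_mod_cast hpp.one_lt.le
    simp only [hb]
    split_ifs with h
    · subst h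
      have : 2 ≤ q.factorization 2 :=
        (Nat.prime_two.pow_dvd_iff_le_factorization hq).1 (h4 hpd)
      calc (4 : ℝ) = ((2 : ℕ) : ℝ) ^ 2 := by norm_num
        _ ≤ _ := pow_le_pow_right₀ hp1 this
    · have : 1 ≤ q.factorization p :=
        (hpp.pow_dvd_iff_le_factorization hq).1 (by simpa using hpd)
      calc (p : ℝ) = (p : ℝ) ^ 1 := (pow_one _).symm
        _ ≤ _ := pow_le_pow_right₀ hp1 this
  have h2 : ∏ p ∈ q.primeFactors, a p =
      (∏ p ∈ q.primeFactors, a p / b p) * ∏ p ∈ q.primeFactors, b p := by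
    rw [← Finset.prod_mul_distrib]
    refine Finset.prod_congr rfl fun p hp => ?_
    rw [div_mul_cancel₀ _ (hbpos p (Nat.prime_of_mem_primeFactors hp)).ne']
  have h3 : ∏ p ∈ q.primeFactors, a p / b p ≤ ∏ p ∈ S, a p / b p := by
    have hcard : ∀ p ∈ q.primeFactors, a p / b p ≤ if p ∈ S then a p / b p else 1 := by
      intro p hp
      have hpp := Nat.prime_of_mem_primeFactors hp
      split_ifs with h
      · exact le_rfl
      · exact div_le_one_of_le₀ (hS' p hpp h) (hbpos p hpp).le
    refine (Finset.prod_le_prod (fun p hp => div_nonneg (ha p)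
      (hbpos p (Nat.prime_of_mem_primeFactors hp)).le) hcard).trans ?_
    rw [Finset.prod_ite_mem, Finset.inter_comm]
    refine Finset.prod_le_prod_of_subset_of_one_le Finset.inter_subset_left
      (fun p hp => div_nonneg (ha p) (hbpos p (hSp p (Finset.mem_of_mem_inter_left hp))).le)
      fun p hp _ => ?_
    rw [one_le_div (hbpos p (hSp p hp))]
    exact hS p hp
  rw [h2]
  have h5 : 0 ≤ ∏ p ∈ S, a p / b p :=
    Finset.prod_nonneg fun p hp => div_nonneg (ha p) (hbpos p (hSp p hp)).le
  have h6 : 0 ≤ ∏ p ∈ q.primeFactors, b p :=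
    Finset.prod_nonneg fun p hp => (hbpos p (Nat.prime_of_mem_primeFactors hp)).le
  exact mul_le_mul h3 h1 h6 h5

theorem prime_of_mem_smallPrimes {p : ℕ} (hp : p ∈ smallPrimes) : p.Prime := by
  simp only [smallPrimes, Finset.mem_insert, Finset.mem_singleton] at hp
  rcases hp with rfl | rfl | rfl | rfl | rfl | rfl | rfl | rfl | rfl | rfl | rfl <;> norm_num

theorem two_pow_card_primeFactors_le {q : ℕ} (hq : q ≠ 0) (h4 : 2 ∣ q → 4 ∣ q) :
    ((2 : ℝ) ^ q.primeFactors.card) ^ 5 ≤ 89821 * q := by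
  have h := prod_primeFactors_le hq h4 (a := fun _ => 32) (fun _ => by norm_num)
    (S := smallPrimes) (fun p hp => prime_of_mem_smallPrimes hp) (fun p hp => ?_)
    (fun p hp hpS => ?_)
  · rw [Finset.prod_const] at h
    have e : ((2 : ℝ) ^ q.primeFactors.card) ^ 5 = 32 ^ q.primeFactors.card := by
      rw [← pow_mul, mul_comm, pow_mul]
      norm_num
    rw [e]
    refine h.trans ?_
    gcongr
    rw [smallPrimes]
    norm_num [Finset.prod_insert]
  · simp only [smallPrimes, Finset.mem_insert, Finset.mem_singleton] at hp
    rcases hp with rfl | rfl | rfl | rfl | rfl | rfl | rfl | rfl | rfl | rfl | rfl <;> norm_num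
  · rw [mem_smallPrimes hp, not_lt] at hpS
    rw [if_neg (by omega)]
    exact_mod_cast hpS

theorem two_pow_card_mul_prod_le {q : ℕ} (hq : q ≠ 0) (h4 : 2 ∣ q → 4 ∣ q) :
    ((2 : ℝ) ^ q.primeFactors.card * ∏ p ∈ q.primeFactors ∩ smallPrimes, (1 - (p : ℝ)⁻¹)) ^ 5 ≤
      37 * q := by
  have h := prod_primeFactors_le hq h4
    (a := fun p => (2 * if p ∈ smallPrimes then (1 - (p : ℝ)⁻¹) else 1) ^ 5) (fun p => ?_)
    (S := {3, 5, 7, 11, 13, 17, 19, 23}) (fun p hp => ?_) (fun p hp => ?_) (fun p hp hpS => ?_)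
  · rw [Finset.prod_pow, Finset.prod_mul_distrib, Finset.prod_const, Finset.prod_ite_mem] at h
    refine h.trans ?_
    gcongr
    simp only [smallPrimes]
    norm_num [Finset.prod_insert]
  · have : 0 ≤ if p ∈ smallPrimes then (1 - (p : ℝ)⁻¹) else 1 := by
      split_ifs with hp
      · have : (1 : ℝ) ≤ p := by exact_mod_cast (prime_of_mem_smallPrimes hp).one_lt.le
        have := inv_le_one_of_one_le₀ this
        linarith
      · exact zero_le_one
    positivity
  · simp only [Finset.mem_insert, Finset.mem_singleton] at hp
    rcases hp with rfl | rfl | rfl | rfl | rfl | rfl | rfl | rfl <;> norm_num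
  · simp only [Finset.mem_insert, Finset.mem_singleton] at hp
    rcases hp with rfl | rfl | rfl | rfl | rfl | rfl | rfl | rfl <;> norm_num [smallPrimes]
  · by_cases h : p ∈ smallPrimes
    · simp only [smallPrimes, Finset.mem_insert, Finset.mem_singleton] at h hpS
      have : p = 2 ∨ p = 29 ∨ p = 31 := by omega
      rcases this with rfl | rfl | rfl <;> norm_num [smallPrimes]
    · rw [if_neg h]
      rw [mem_smallPrimes hp, not_lt] at h
      rw [if_neg (by omega)]
      norm_num
      exact_mod_cast h

theorem prod_one_add_inv_le {q : ℕ} (hq : q ≠ 0) (h4 : 2 ∣ q → 4 ∣ q) :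
    (∏ p ∈ q.primeFactors, (1 + (p : ℝ)⁻¹)) ^ 100 ≤ 3.072 ^ 100 * q := by
  have h := prod_primeFactors_le hq h4 (a := fun p => (1 + (p : ℝ)⁻¹) ^ 100)
    (fun p => by positivity)
    (S := {2, 3, 5, 7, 11, 13, 17, 19, 23, 29}) (fun p hp => ?_) (fun p hp => ?_)
    (fun p hp hpS => ?_)
  · rw [Finset.prod_pow] at h
    refine h.trans ?_
    gcongr
    norm_num [Finset.prod_insert]
  · simp only [Finset.mem_insert, Finset.mem_singleton] at hp
    rcases hp with rfl | rfl | rfl | rfl | rfl | rfl | rfl | rfl | rfl | rfl <;> norm_num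
  · simp only [Finset.mem_insert, Finset.mem_singleton] at hp
    rcases hp with rfl | rfl | rfl | rfl | rfl | rfl | rfl | rfl | rfl | rfl <;> norm_num
  · have h31 : 31 ≤ p := by
      have := mem_smallPrimes hp
      simp only [smallPrimes, Finset.mem_insert, Finset.mem_singleton] at this hpS
      omega
    have hpr : (31 : ℝ) ≤ p := by exact_mod_cast h31
    rw [if_neg (by omega)]
    calc (1 + (p : ℝ)⁻¹) ^ 100 ≤ (1 + (31 : ℝ)⁻¹) ^ 100 := by gcongr
      _ ≤ 31 := by norm_num
      _ ≤ p := hpr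

theorem four_dvd_of_two_dvd {D : ℤ} (hD : IsFundamentalDiscriminant D) {q : ℕ}
    (hq : (q : ℤ) = -D) (h : 2 ∣ q) : 4 ∣ q := by
  rcases hD.2 with ⟨h1, -⟩ | ⟨m, h1, -⟩ <;> omega

end ExponentTwo

namespace ExponentTwo

open DirichletCharacter

theorem exp_neg_le : Real.exp (-(7.8 : ℝ)) ≤ 0.00041 := by
  have h1 : (2440 : ℝ) ≤ Real.exp 7.8 := by
    refine le_of_pow_le_pow_left₀ (n := 5) (by norm_num) (Real.exp_pos _).le ?_
    have h2 : Real.exp 7.8 ^ 5 = Real.exp 1 ^ 39 := by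
      rw [← Real.exp_nat_mul, ← Real.exp_nat_mul]; norm_num
    rw [h2]
    calc (2440 : ℝ) ^ 5 ≤ 2.7182818283 ^ 39 := by norm_num
      _ ≤ Real.exp 1 ^ 39 := by
        have := Real.exp_one_gt_d9.le
        gcongr
  rw [Real.exp_neg]
  calc (Real.exp 7.8)⁻¹ ≤ (2440 : ℝ)⁻¹ := by gcongr
    _ ≤ 0.00041 := by norm_num

theorem twentySix_le_log {q : ℝ} (hq : 200560490130 ≤ q) : 26 ≤ Real.log q := by
  rw [Real.le_log_iff_exp_le (by linarith)]
  refine le_trans ?_ hq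
  have h2 : Real.exp 26 = Real.exp 1 ^ 26 := by rw [← Real.exp_nat_mul]; norm_num
  rw [h2]
  calc Real.exp 1 ^ 26 ≤ (2.7182818286 : ℝ) ^ 26 := by
        have := Real.exp_one_lt_d9.le
        gcongr
    _ ≤ 200560490130 := by norm_num

theorem div_sqrt_le {q v c : ℝ} (hq : 0 < q) (hc : 0 ≤ c) (h : v ^ 5 ≤ c ^ 5 * q) :
    v / √q ≤ c * 0.00041 * Real.exp (-(0.3 * (Real.log q - 26))) := by
  have h1 : v ≤ c * Real.exp (Real.log q / 5) := by
    by_contra! hlt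
    have h2 : (c * Real.exp (Real.log q / 5)) ^ 5 < v ^ 5 :=
      pow_lt_pow_left₀ hlt (by positivity) (by norm_num)
    rw [mul_pow, ← Real.exp_nat_mul] at h2
    have h3 : ((5 : ℕ) : ℝ) * (Real.log q / 5) = Real.log q := by push_cast; ring
    rw [h3, Real.exp_log hq] at h2
    linarith
  have h4 : √q = Real.exp (Real.log q / 2) := by rw [Real.exp_half, Real.exp_log hq]
  rw [h4, div_eq_mul_inv, ← Real.exp_neg]
  calc v * Real.exp (-(Real.log q / 2))
      ≤ c * Real.exp (Real.log q / 5) * Real.exp (-(Real.log q / 2)) := by gcongr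
    _ = c * (Real.exp (-7.8) * Real.exp (-(0.3 * (Real.log q - 26)))) := by
        rw [mul_assoc, ← Real.exp_add, ← Real.exp_add]; ring_nf
    _ ≤ c * (0.00041 * Real.exp (-(0.3 * (Real.log q - 26)))) := by
        have := exp_neg_le
        gcongr
    _ = _ := by ring

open Classical in
theorem exists_isKronecker_bounds {D : ℤ} (hD : IsFundamentalDiscriminant D) (hneg : D < 0)
    (hlarge : 200560490130 ≤ -D)
    (hexp : ∀ (K : Type) [Field K] [NumberField K], Module.finrank ℚ K = 2 →
        NumberField.discr K = D → Monoid.exponent (ClassGroup (𝓞 K)) = 2)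
    {q : ℕ} [NeZero q] (hq : (q : ℤ) = -D) :
    ∃ χ : DirichletCharacter ℂ q, IsKronecker D χ ∧
      (χ.LFunction 1).re ≤ 0.00631 * Real.exp (-(0.3 * (Real.log q - 26))) ∧
      (χ.LFunction 1).re * ∏ p ∈ q.primeFactors ∩ smallPrimes, (1 - (p : ℝ)⁻¹) ≤
        0.001327 * Real.exp (-(0.3 * (Real.log q - 26))) ∧
      ∃ (Z : Finset ℕ) (g : ℕ → ℝ), (∀ w ∈ Z, Squarefree w ∧ w ∣ q ∧ w ^ 2 ≤ q) ∧
        (∀ N : ℕ, ∑ n ∈ Finset.Icc 1 N, g n ≤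
          0.01606 * Real.exp (-(0.3 * (Real.log q - 26))) * N) ∧
        ∀ n : ℕ, n ≠ 0 →
          (zetaMul χ n).re ≤ ({w ∈ Z | ∃ k, n = w * k ^ 2}.card : ℝ) + g n := by
  have hq0 : q ≠ 0 := NeZero.ne q
  have hqpos : (0 : ℝ) < q := by exact_mod_cast Nat.pos_of_ne_zero hq0
  obtain ⟨a, ha⟩ : ∃ a, D = (D % 2) ^ 2 + 4 * a := by
    rcases hD.2 with ⟨h4, -⟩ | ⟨m, hm, -, -⟩
    · have h : D % 2 = 1 := by omega
      rw [h]
      exact ⟨D / 4, by omega⟩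
    · have h : D % 2 = 0 := by omega
      rw [h]
      exact ⟨m, by omega⟩
  obtain ⟨K, _, _, ω, hω⟩ := exists_quadField hD hneg rfl ha
  have hex := hexp K hω.finrank_eq (hω.discr_eq.trans ha.symm)
  have hC : ∀ C : ClassGroup (𝓞 K), C * C = 1 := by
    intro C
    have := Monoid.pow_exponent_eq_one C
    rwa [hex, pow_two] at this
  have hq' : (q : ℤ) = -((D % 2) ^ 2 + 4 * a) := by rw [hq, ← ha]
  have hsq : ¬ IsSquare q := by
    rintro ⟨r, hr⟩
    refine not_isSquare_neg_of_fundamental hD (by omega) ⟨r, ?_⟩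
    rw [← hq, hr]; push_cast; ring
  obtain ⟨⟨J, z, hz, hJ⟩, hcard⟩ := hω.exists_ramified_system hq0 hq' hsq hC
  obtain ⟨Z, g, hZ, hg0, hg, hle⟩ := hω.idealCount_le hq' hC hz hJ
  obtain ⟨χ, hχ⟩ := exists_isKronecker hD hneg hq
  have h2 := hχ.sq_eq_one
  have hχ1 := hχ.ne_one hneg
  have hcount : ∀ n : ℕ, n ≠ 0 → (zetaMul χ n).re ≤ idealCount K n := fun n hn =>
    hω.zetaMul_le_idealCount hq0 hχ hq rfl ha hn
  have hres : (χ.LFunction 1).re ≤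
      Real.pi * Fintype.card (ClassGroup (𝓞 K)) / √q :=
    (LFunction_one_le_residue (K := K) h2 hχ1 hcount).trans (hω.residue_le hq0 hq')
  have h4 := four_dvd_of_two_dvd hD hq
  have hcard' : (2 : ℝ) * Fintype.card (ClassGroup (𝓞 K)) ≤ 2 ^ q.primeFactors.card := by
    exact_mod_cast hcard
  set H : ℝ := ((Fintype.card (ClassGroup (𝓞 K)) : ℕ) : ℝ)
  have hv : (2 : ℝ) ^ q.primeFactors.card / √q ≤
      9.79 * 0.00041 * Real.exp (-(0.3 * (Real.log q - 26))) :=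
    div_sqrt_le hqpos (by norm_num)
      ((two_pow_card_primeFactors_le hq0 h4).trans (by gcongr; norm_num))
  have hw : (2 : ℝ) ^ q.primeFactors.card *
      (∏ p ∈ q.primeFactors ∩ smallPrimes, (1 - (p : ℝ)⁻¹)) / √q ≤
      2.06 * 0.00041 * Real.exp (-(0.3 * (Real.log q - 26))) :=
    div_sqrt_le hqpos (by norm_num)
      ((two_pow_card_mul_prod_le hq0 h4).trans (by gcongr; norm_num))
  set e := Real.exp (-(0.3 * (Real.log q - 26)))
  have he : 0 < e := Real.exp_pos _
  set v : ℝ := 2 ^ q.primeFactors.card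
  have hsqrt : 0 < √(q : ℝ) := Real.sqrt_pos.2 hqpos
  have hprod : 0 ≤ ∏ p ∈ q.primeFactors ∩ smallPrimes, (1 - (p : ℝ)⁻¹) := by
    refine Finset.prod_nonneg fun p hp => ?_
    have hp1 : (1 : ℝ) ≤ p := by
      exact_mod_cast (Nat.prime_of_mem_primeFactors (Finset.mem_inter.1 hp).1).one_le
    have := inv_le_one_of_one_le₀ hp1
    linarith
  set P := ∏ p ∈ q.primeFactors ∩ smallPrimes, (1 - (p : ℝ)⁻¹)
  have hlam : (χ.LFunction 1).re ≤ 1.5708 * (v / √q) := by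
    refine hres.trans ?_
    rw [← mul_div_assoc]
    have := Real.pi_lt_d4
    have hH : 0 ≤ H := Nat.cast_nonneg _
    have : Real.pi * H ≤ 1.5708 * v := by nlinarith
    gcongr
  refine ⟨χ, hχ, ?_, ?_, Z, g, hZ, ?_, ?_⟩
  · nlinarith
  · calc (χ.LFunction 1).re * P ≤ 1.5708 * (v / √q) * P := by gcongr
      _ = 1.5708 * (v * P / √q) := by ring
      _ ≤ 1.5708 * (2.06 * 0.00041 * e) := by gcongr
      _ ≤ _ := by nlinarith
  · intro N
    refine (hg N).trans ?_
    gcongr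
    calc 8 * H / √q = 4 * (2 * H / √q) := by ring
      _ ≤ 4 * (v / √q) := by gcongr
      _ ≤ 0.01606 * e := by nlinarith
  · intro n hn
    exact (hcount n hn).trans (hle n hn)

end ExponentTwo

namespace ExponentTwo

theorem exp_le_taylor {x : ℝ} (h0 : 0 ≤ x) (h1 : x ≤ 1) :
    Real.exp x ≤ 1 + x + x ^ 2 / 2 + x ^ 3 / 6 + x ^ 4 / 24 + x ^ 5 / 100 := by
  refine (Real.exp_bound' h0 h1 (n := 5) (by norm_num)).trans (le_of_eq ?_)
  simp [Finset.sum_range_succ, Nat.factorial]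
  ring

theorem exists_two_pow_near {x : ℝ} (hx : 1 ≤ x) : ∃ m : ℕ, x ≤ 2 ^ m ∧ (2 : ℝ) ^ m ≤ 2 * x := by
  obtain ⟨n, h1, h2⟩ := exists_nat_pow_near hx (one_lt_two)
  exact ⟨n + 1, h2.le, by rw [pow_succ]; linarith⟩

theorem one_add_pow_le_exp {t : ℝ} (ht : 0 ≤ t) (m : ℕ) :
    (1 + 2 * t) ^ m ≤ Real.exp (2 * t * m) := by
  rw [mul_comm (2 * t) (m : ℝ), Real.exp_nat_mul]
  have := Real.add_one_le_exp (2 * t)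
  gcongr
  linarith

theorem one_add_pow_sub_one_le {t : ℝ} (ht : 0 ≤ t) (m : ℕ) :
    (1 + 2 * t) ^ m - 1 ≤ (1 + 2 * t) ^ m * (2 * t * m) := by
  have h1 := one_add_pow_le_exp ht m
  have h2 : (0 : ℝ) < (1 + 2 * t) ^ m := by positivity
  have h3 := Real.one_sub_le_exp_neg (2 * t * m)
  have h4 : Real.exp (2 * t * m) * Real.exp (-(2 * t * m)) = 1 := by
    rw [← Real.exp_add]; simp
  nlinarith [mul_le_mul_of_nonneg_right h1 (Real.exp_pos (-(2 * t * m))).le,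
    mul_le_mul_of_nonneg_left h3 h2.le, mul_nonneg ht (Nat.cast_nonneg (α := ℝ) m)]

theorem half_add_pow (t : ℝ) (m : ℕ) : (1 / 2 + t) ^ m = (1 + 2 * t) ^ m / 2 ^ m := by
  rw [← div_pow]; congr 1; ring

theorem linear_mul_exp_le {a b c y : ℝ} (ha : 0 ≤ a) (hb : b ≤ c * a) (hy : 0 ≤ y) :
    (a + b * y) * Real.exp (-(c * y)) ≤ a := by
  have h1 := Real.add_one_le_exp (c * y)
  have h2 : a + b * y ≤ a * Real.exp (c * y) := by nlinarith
  calc (a + b * y) * Real.exp (-(c * y)) ≤ a * Real.exp (c * y) * Real.exp (-(c * y)) := by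
        gcongr
    _ = a := by rw [mul_assoc, ← Real.exp_add]; simp

theorem log_le_of_pow_le {x : ℝ} (hx : 0 < x) {n k : ℕ} (hk : k ≠ 0)
    (h : x ^ k ≤ (2.7182818283 : ℝ) ^ n) : Real.log x ≤ n / k := by
  have h1 : x ^ k ≤ Real.exp 1 ^ n := by
    refine h.trans ?_
    have := Real.exp_one_gt_d9.le
    gcongr
  have h2 := Real.log_le_log (by positivity) h1
  rw [Real.log_pow, Real.log_pow, Real.log_exp, mul_one] at h2
  have : (0 : ℝ) < k := by positivity
  rw [le_div_iff₀ this]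
  linarith

/-- One improvement of the upper bound for the location of a zero near `1`. -/
theorem zero_le_step {lam t X k k' c m : ℝ} (hlam : 0 < lam) (ht0 : 0 < t)
    (hX : X ≤ Real.exp (2 * t * m)) (hX0 : 0 < X) (hm : 0 ≤ m) (hml : 2 * m * lam ≤ 0.4116)
    (hmain : 1.42 ≤ lam / t * X + 0.0212 * X) (htk : t ≤ k * lam) (hk : 0 ≤ k)
    (hk1 : 0.4116 * k ≤ 1)
    (hc : 1 + 0.4116 * k + (0.4116 * k) ^ 2 / 2 + (0.4116 * k) ^ 3 / 6 + (0.4116 * k) ^ 4 / 24 +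
      (0.4116 * k) ^ 5 / 100 ≤ c)
    (hk' : 0 < k') (hck : (1 / k' + 0.0212) * c ≤ 1.42) : t ≤ k' * lam := by
  have h1 : 2 * t * m ≤ 0.4116 * k := by nlinarith
  have hXc : X ≤ c :=
    (hX.trans (Real.exp_le_exp.2 h1)).trans ((exp_le_taylor (by positivity) hk1).trans hc)
  by_contra! hlt
  have h2 : lam / t < 1 / k' := by
    rw [div_lt_div_iff₀ ht0 hk']; linarith
  have h3 : (lam / t + 0.0212) * X < (1 / k' + 0.0212) * X := by gcongr
  have h4 : (1 / k' + 0.0212) * X ≤ (1 / k' + 0.0212) * c := by gcongr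
  nlinarith

end ExponentTwo

namespace ExponentTwo

theorem le_of_mul_log_two_le {L m : ℝ} (h : m * Real.log 2 ≤ 9.6 + L / 2) (hL : 26 ≤ L) :
    m ≤ 32.61 + 0.7214 * (L - 26) := by
  have := Real.log_two_gt_d9
  nlinarith

/-- A class number of size `√q / q ^ (1 / 5)` forces a real zero close to `1`. -/
theorem IsEstermann.exists_zero_near_one {r : ℕ → ℝ} {R : ℂ → ℂ} {q : ℕ}
    (h : IsEstermann r R (10 * √q)) (hR : R 1 ≠ 0) (hq : (200560490130 : ℝ) ≤ q)
    (hlam : (R 1).re ≤ 0.00631 * Real.exp (-(0.3 * (Real.log q - 26)))) :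
    ∃ (t : ℝ) (m : ℕ), 0 < t ∧ t ≤ 1.31 * (R 1).re ∧ t ≤ 1 / 20 ∧
      riemannZeta (1 - t) * R (1 - t) = 0 ∧ 7350 * √q ≤ 2 ^ m ∧
      (m : ℝ) ≤ 32.61 + 0.7214 * (Real.log q - 26) := by
  have hqpos : (0 : ℝ) < q := by linarith
  have hL := twentySix_le_log hq
  have hs1 : (1 : ℝ) ≤ √q := Real.one_le_sqrt.2 (by linarith)
  have hs0 : (0 : ℝ) < √q := by linarith
  obtain ⟨m, hm1, hm2⟩ := exists_two_pow_near (x := 7350 * √q) (by linarith)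
  have hm10 : 10 ≤ m := by
    by_contra! hlt
    have : (2 : ℝ) ^ m ≤ 2 ^ 9 := pow_le_pow_right₀ (by norm_num) (by omega)
    linarith
  have hm10' : (10 : ℝ) ≤ m := by exact_mod_cast hm10
  have hmL : (m : ℝ) ≤ 32.61 + 0.7214 * (Real.log q - 26) := by
    refine le_of_mul_log_two_le ?_ hL
    have h1 := Real.log_le_log (by positivity) hm2
    rw [Real.log_pow, ← mul_assoc, Real.log_mul (by norm_num) hs0.ne', Real.log_sqrt hqpos.le] at h1
    have h2 : Real.log (2 * 7350) ≤ (48 : ℕ) / (5 : ℕ) :=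
      log_le_of_pow_le (by norm_num) (by norm_num) (by norm_num)
    norm_num at h2 h1 ⊢
    linarith
  set lam := (R 1).re with hlamdef
  have hre := h.ofReal_re_one
  have hlam0 : 0 < lam := by
    refine lt_of_le_of_ne hre.2 fun h0 => hR ?_
    rw [hre.1, ← hlamdef, ← h0]; simp
  have hml : 2 * (m : ℝ) * lam ≤ 0.4116 := by
    have h1 := linear_mul_exp_le (a := 32.61) (b := 0.7214) (c := 0.3) (y := Real.log q - 26)
      (by norm_num) (by norm_num) (by linarith)
    set e := Real.exp (-(0.3 * (Real.log q - 26)))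
    have he : 0 < e := Real.exp_pos _
    calc 2 * (m : ℝ) * lam
        ≤ 2 * (32.61 + 0.7214 * (Real.log q - 26)) * (0.00631 * e) := by gcongr
      _ = 0.01262 * ((32.61 + 0.7214 * (Real.log q - 26)) * e) := by ring
      _ ≤ 0.01262 * 32.61 := by gcongr
      _ ≤ 0.4116 := by norm_num
  have hE : ∀ t : ℝ, 0 < t → t ≤ 1 / 20 →
      7 * (10 * √q) * (1 / 2 + t) ^ m / (1 / 2 - t) ≤ 0.0212 * (1 + 2 * t) ^ m := by
    intro t ht0 ht
    rw [half_add_pow, div_le_iff₀ (by linarith), ← mul_div_assoc, div_le_iff₀ (by positivity)]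
    have hX : (0 : ℝ) < (1 + 2 * t) ^ m := by positivity
    have h1 : 70 * √q ≤ 0.0212 * 0.45 * 2 ^ m := by linarith
    have h2 : (0.0212 : ℝ) * 0.45 * 2 ^ m ≤ 0.0212 * (1 / 2 - t) * 2 ^ m := by
      gcongr; linarith
    nlinarith
  obtain ⟨t, ht0, htlt, hz⟩ := h.exists_zero hR (t₀ := 1 / (2 * m)) (by positivity)
    (by rw [div_lt_div_iff₀ (by positivity) (by norm_num)]; linarith) hm10 (by
      have h20 : 1 / (2 * (m : ℝ)) ≤ 1 / 20 := by gcongr; linarith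
      have h1 := hE (1 / (2 * m)) (by positivity) h20
      have h2 := one_add_pow_le_exp (t := 1 / (2 * (m : ℝ))) (by positivity) m
      have h3 : 2 * (1 / (2 * (m : ℝ))) * m = 1 := by field_simp
      rw [h3] at h2
      have h4 := Real.exp_one_lt_d9
      set X := (1 + 2 * (1 / (2 * (m : ℝ)))) ^ m
      have h5 : lam / (1 / (2 * (m : ℝ))) = 2 * m * lam := by field_simp
      rw [h5]
      have hX : 0 < X := by positivity
      nlinarith)
  have h20 : t ≤ 1 / 20 := by
    refine htlt.le.trans ?_
    gcongr; linarith
  have hmain := h.le_of_zero ht0 (by linarith) hz hm10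
  have hX := one_add_pow_le_exp ht0.le m
  have hX0 : (0 : ℝ) < (1 + 2 * t) ^ m := by positivity
  have hmain' : 1.42 ≤ lam / t * (1 + 2 * t) ^ m + 0.0212 * (1 + 2 * t) ^ m := by
    linarith [hE t ht0 h20]
  set X := (1 + 2 * t) ^ m
  have ht2 : t ≤ 2 * lam := by
    have h1 : 2 * t * m ≤ 1 := by
      rw [lt_div_iff₀ (by positivity)] at htlt; linarith
    have h2 : X ≤ 2.7182818286 :=
      (hX.trans (Real.exp_le_exp.2 h1)).trans Real.exp_one_lt_d9.le
    by_contra! hlt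
    have h3 : lam / t < 1 / 2 := by
      rw [div_lt_div_iff₀ ht0 (by norm_num)]; linarith
    nlinarith
  have step := fun (k k' c : ℝ) => zero_le_step (k := k) (k' := k') (c := c) hlam0 ht0 hX hX0
    (Nat.cast_nonneg m) hml hmain'
  have ht3 : t ≤ 1.67 * lam :=
    step 2 1.67 2.29 ht2 (by norm_num) (by norm_num) (by norm_num) (by norm_num) (by norm_num)
  have ht4 : t ≤ 1.46 * lam :=
    step 1.67 1.46 2 ht3 (by norm_num) (by norm_num) (by norm_num) (by norm_num) (by norm_num)
  have ht5 : t ≤ 1.35 * lam :=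
    step 1.46 1.35 1.83 ht4 (by norm_num) (by norm_num) (by norm_num) (by norm_num) (by norm_num)
  have ht6 : t ≤ 1.31 * lam :=
    step 1.35 1.31 1.75 ht5 (by norm_num) (by norm_num) (by norm_num) (by norm_num) (by norm_num)
  exact ⟨t, m, ht0, ht6, h20, hz, hm1, hmL⟩

open Classical in
/-- The residue is not much larger than the distance of the zero from `1`. -/
theorem IsEstermann.residue_le_of_zero {r : ℕ → ℝ} {R : ℂ → ℂ} {q : ℕ}
    (h : IsEstermann r R (10 * √q)) (hq : (200560490130 : ℝ) ≤ q) (h4 : 2 ∣ q → 4 ∣ q)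
    {Z : Finset ℕ} {g : ℕ → ℝ} (hZ : ∀ w ∈ Z, Squarefree w ∧ w ∣ q ∧ w ^ 2 ≤ q)
    (hg : ∀ N : ℕ, ∑ n ∈ Finset.Icc 1 N, g n ≤
      0.01606 * Real.exp (-(0.3 * (Real.log q - 26))) * N)
    (hrg : ∀ n : ℕ, n ≠ 0 → r n ≤ ({w ∈ Z | ∃ k, n = w * k ^ 2}.card : ℝ) + g n)
    {t : ℝ} {m : ℕ} (ht0 : 0 < t) (ht20 : t ≤ 1 / 20)
    (ht : t ≤ 0.00827 * Real.exp (-(0.3 * (Real.log q - 26))))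
    (hz : riemannZeta (1 - t) * R (1 - t) = 0) (hm : 7350 * √q ≤ 2 ^ m)
    (hmL : (m : ℝ) ≤ 32.61 + 0.7214 * (Real.log q - 26)) :
    (R 1).re / t ≤ 8.61 * Real.exp (0.01 * (Real.log q - 26)) := by
  have hqpos : (0 : ℝ) < q := by linarith
  have hq0 : q ≠ 0 := by rintro rfl; norm_num at hqpos
  have hL := twentySix_le_log hq
  have hs : (400000 : ℝ) ≤ √q := Real.le_sqrt_of_sq_le (by linarith)
  set e := Real.exp (-(0.3 * (Real.log q - 26))) with hedef
  have he0 : 0 < e := Real.exp_pos _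
  have he1 : e ≤ 1 := by rw [hedef, Real.exp_le_one_iff]; linarith
  have hA := tsum_mul_weight_le hq0 hZ h.nonneg hg (by positivity) hrg ht0 (by linarith) m
  have hW := (summable_weight ht0 (by linarith) m).2
  have hB := h.abs_sub_le_of_zero ht0 (by linarith) hz m
  have hX0 : (0 : ℝ) < (1 + 2 * t) ^ m := by positivity
  have hX1 : (1 : ℝ) ≤ (1 + 2 * t) ^ m := one_le_pow₀ (by linarith)
  have hXs := one_add_pow_sub_one_le ht0.le m
  rw [half_add_pow] at hW hB
  set X := (1 + 2 * t) ^ m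
  have hE : 7 * (10 * √q) * (X / 2 ^ m) / (1 / 2 - t) ≤ 0.0212 * X := by
    rw [div_le_iff₀ (by linarith), ← mul_div_assoc, div_le_iff₀ (by positivity)]
    have h1 : 70 * √q ≤ 0.0212 * 0.45 * 2 ^ m := by linarith
    have h2 : (0.0212 : ℝ) * 0.45 * 2 ^ m ≤ 0.0212 * (1 / 2 - t) * 2 ^ m := by
      gcongr; linarith
    nlinarith
  have hE' : 7 * (X / 2 ^ m) / (1 / 2 - t) ≤ 0.01 * X := by
    refine le_trans ?_ (le_trans (mul_le_mul_of_nonneg_left hE (by norm_num : (0 : ℝ) ≤ 1 / 10))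
      (by linarith))
    have h3 : 0 < 1 / 2 - t := by linarith
    have h5 : 1 / 10 * (7 * (10 * √q) * (X / 2 ^ m) / (1 / 2 - t)) =
        √q * (7 * (X / 2 ^ m) / (1 / 2 - t)) := by ring
    rw [h5]
    exact le_mul_of_one_le_left (by positivity) (by linarith)
  set S := ∑' n, r n * weight m t n
  set W := ∑' n, weight m t n
  have hW' : W ≤ (2 * m + 1.01) * X := by
    have h1 : (X - 1) / t ≤ 2 * m * X := by
      rw [div_le_iff₀ ht0]; linarith
    linarith
  have hκW : 0.01606 * e * W ≤ 1.064 * X := by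
    have h1 := linear_mul_exp_le (a := 66.23) (b := 1.4428) (c := 0.3) (y := Real.log q - 26)
      (by norm_num) (by norm_num) (by linarith)
    calc 0.01606 * e * W ≤ 0.01606 * e * ((2 * (32.61 + 0.7214 * (Real.log q - 26)) + 1.01) * X) := by
          gcongr
          exact hW'.trans (by gcongr)
      _ = 0.01606 * ((66.23 + 1.4428 * (Real.log q - 26)) * e) * X := by ring
      _ ≤ 0.01606 * 66.23 * X := by gcongr
      _ ≤ 1.064 * X := by gcongr; norm_num
  have hprod : ∏ p ∈ q.primeFactors, (1 + (p : ℝ)⁻¹) ≤ 3.072 * Real.exp (Real.log q / 100) := by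
    refine le_of_pow_le_pow_left₀ (n := 100) (by norm_num) (by positivity) ?_
    refine (prod_one_add_inv_le hq0 h4).trans (le_of_eq ?_)
    rw [mul_pow, ← Real.exp_nat_mul]
    have h3 : ((100 : ℕ) : ℝ) * (Real.log q / 100) = Real.log q := by push_cast; ring
    rw [h3, Real.exp_log hqpos]
  have hpow : (q : ℝ) ^ (t / 2) ≤ 1.115 := by
    rw [Real.rpow_def_of_pos hqpos]
    have h1 := linear_mul_exp_le (a := 26) (b := 1) (c := 0.3) (y := Real.log q - 26)
      (by norm_num) (by norm_num) (by linarith)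
    have h2 : Real.log q * (t / 2) ≤ 0.1076 := by
      calc Real.log q * (t / 2) ≤ Real.log q * (0.00827 * e / 2) := by gcongr
        _ = 0.004135 * ((26 + 1 * (Real.log q - 26)) * e) := by ring
        _ ≤ 0.004135 * 26 := by gcongr
        _ ≤ 0.1076 := by norm_num
    refine (Real.exp_le_exp.2 h2).trans ((exp_le_taylor (by norm_num) (by norm_num)).trans ?_)
    norm_num
  have hsplit : Real.exp (Real.log q / 100) ≤ 1.2972 * Real.exp (0.01 * (Real.log q - 26)) := by
    have h1 : Real.exp (Real.log q / 100) =
        Real.exp 0.26 * Real.exp (0.01 * (Real.log q - 26)) := by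
      rw [← Real.exp_add]; ring_nf
    rw [h1]
    gcongr
    refine (exp_le_taylor (by norm_num) (by norm_num)).trans ?_
    norm_num
  set F := Real.exp (0.01 * (Real.log q - 26))
  have hF1 : 1 ≤ F := Real.one_le_exp (by linarith)
  have hA' : (1.645 + 5.5 * t) * ((q : ℝ) ^ (t / 2) * ∏ p ∈ q.primeFactors, (1 + (p : ℝ)⁻¹)) ≤
      7.515 * F := by
    calc (1.645 + 5.5 * t) * ((q : ℝ) ^ (t / 2) * ∏ p ∈ q.primeFactors, (1 + (p : ℝ)⁻¹))
        ≤ 1.6905 * (1.115 * (3.072 * (1.2972 * F))) := by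
          gcongr
          · nlinarith
          · exact hprod.trans (by gcongr)
      _ ≤ 7.515 * F := by linarith
  have hX3 := (abs_sub_le_iff.1 hB).2
  have hfin : (R 1).re / t * X ≤ 8.61 * F * X := by
    have h6 : F ≤ F * X := le_mul_of_one_le_right (by linarith) hX1
    have h7 : X ≤ F * X := le_mul_of_one_le_left hX0.le hF1
    linarith
  exact le_of_mul_le_mul_right hfin hX0

end ExponentTwo

namespace ExponentTwo

open DirichletCharacter

theorem IsEstermann.false_of_zero {r : ℕ → ℝ} {R : ℂ → ℂ} {q₁ q₂ lam G t : ℝ}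
    (h : IsEstermann r R (1000 * (q₁ * q₂))) (hq₁ : 200560490130 ≤ q₁) (hq : q₁ ≤ q₂)
    (ht0 : 0 < t) (ht : t ≤ 0.00827) (hz : riemannZeta (1 - t) * R (1 - t) = 0)
    (hlam0 : 0 ≤ lam) (hlam : lam ≤ 0.00631)
    (hlt : lam / t ≤ 8.61 * Real.exp (0.01 * (Real.log q₂ - 26)))
    (hR : (R 1).re ≤ lam * G) (hG : G ≤ 0.0806 * Real.exp (-(0.26 * (Real.log q₂ - 26)))) :
    False := by
  have hL₂ := twentySix_le_log (hq₁.trans hq)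
  have hL := Real.log_le_log (by linarith) hq
  have hq₁0 : 0 < q₁ := by linarith
  have hq₂0 : 0 < q₂ := by linarith
  have hQ : (1 : ℝ) ≤ q₁ * q₂ := by nlinarith
  set y := Real.log q₂ - 26 with hy
  have hy0 : 0 ≤ y := by linarith
  have hE1 : 1 ≤ Real.exp (0.06 * y) := Real.one_le_exp (by positivity)
  obtain ⟨m, hm1, hm2⟩ := exists_two_pow_near (x := 840000 * (q₁ * q₂) * Real.exp (0.06 * y))
    (by nlinarith)
  have hm10 : 10 ≤ m := by
    by_contra! hlt
    have : (2 : ℝ) ^ m ≤ 2 ^ 9 := pow_le_pow_right₀ (by norm_num) (by omega)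
    nlinarith
  have hmL : (m : ℝ) ≤ 95.8 + 2.973 * y := by
    have h1 := Real.log_le_log (by positivity) hm2
    rw [Real.log_pow, ← mul_assoc, ← mul_assoc, Real.log_mul (by positivity) (by positivity),
      Real.log_mul (by norm_num) (by positivity), Real.log_mul hq₁0.ne' hq₂0.ne',
      Real.log_exp] at h1
    have h2 : Real.log (2 * 840000) ≤ (72 : ℕ) / (5 : ℕ) :=
      log_le_of_pow_le (by norm_num) (by norm_num) (by norm_num)
    have h3 := Real.log_two_gt_d9
    norm_num at h2 h1 ⊢
    nlinarith
  have hmain := h.le_of_zero ht0 (by linarith) hz hm10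
  have hX := one_add_pow_le_exp ht0.le m
  have hXs := one_add_pow_sub_one_le ht0.le m
  rw [half_add_pow] at hmain
  have hX0 : (0 : ℝ) < (1 + 2 * t) ^ m := by positivity
  set X := (1 + 2 * t) ^ m
  have hXle : X ≤ 4.883 * Real.exp (0.0492 * y) := by
    have h1 : 2 * t * m ≤ 1.585 + 0.0492 * y := by
      calc 2 * t * m ≤ 2 * 0.00827 * (95.8 + 2.973 * y) := by gcongr
        _ ≤ _ := by linarith
    refine hX.trans ((Real.exp_le_exp.2 h1).trans ?_)
    rw [Real.exp_add]
    gcongr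
    have h2 : Real.exp 1.585 = Real.exp 0.7925 ^ 2 := by rw [← Real.exp_nat_mul]; norm_num
    rw [h2]
    have h3 := exp_le_taylor (x := 0.7925) (by norm_num) (by norm_num)
    have h4 : Real.exp 0.7925 ≤ 2.2095 := h3.trans (by norm_num)
    calc Real.exp 0.7925 ^ 2 ≤ 2.2095 ^ 2 := by gcongr
      _ ≤ 4.883 := by norm_num
  have hE : 7 * (1000 * (q₁ * q₂)) * (X / 2 ^ m) / (1 / 2 - t) ≤ 0.09 := by
    rw [div_le_iff₀ (by linarith), ← mul_div_assoc, div_le_iff₀ (by positivity)]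
    have h1 : Real.exp (0.0492 * y) ≤ Real.exp (0.06 * y) := Real.exp_le_exp.2 (by linarith)
    calc 7 * (1000 * (q₁ * q₂)) * X ≤ 7 * (1000 * (q₁ * q₂)) * (4.883 * Real.exp (0.06 * y)) := by
          gcongr
          exact hXle.trans (by gcongr)
      _ = 4.883 / 120 * (840000 * (q₁ * q₂) * Real.exp (0.06 * y)) := by ring
      _ ≤ 4.883 / 120 * 2 ^ m := by gcongr
      _ ≤ 0.09 * (1 / 2 - t) * 2 ^ m := by
          gcongr
          linarith
  have hlamX : lam / t * X ≤ 14.6 * Real.exp (0.26 * y) := by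
    have h1 : lam / t * (X - 1) ≤ 5.91 * Real.exp (0.26 * y) := by
      calc lam / t * (X - 1) ≤ lam / t * (X * (2 * t * m)) := by gcongr
        _ = 2 * lam * X * m := by field_simp
        _ ≤ 2 * 0.00631 * (4.883 * Real.exp (0.0492 * y)) * (95.8 + 2.973 * y) := by gcongr
        _ ≤ 2 * 0.00631 * (4.883 * Real.exp (0.0492 * y)) * (95.8 * Real.exp (0.2 * y)) := by
          have := Real.add_one_le_exp (0.2 * y)
          gcongr
          linarith
        _ = 2 * 0.00631 * 4.883 * 95.8 * Real.exp (0.0492 * y + 0.2 * y) := by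
          rw [Real.exp_add]; ring
        _ ≤ 5.91 * Real.exp (0.26 * y) := by
          gcongr
          · norm_num
          · linarith
    have h2 : Real.exp (0.01 * y) ≤ Real.exp (0.26 * y) := Real.exp_le_exp.2 (by linarith)
    have h3 := Real.exp_pos (0.26 * y)
    linarith
  have hfin : (R 1).re / t * X ≤ 1.18 := by
    have h1 : 0 ≤ lam / t * X := by positivity
    calc (R 1).re / t * X ≤ lam * G / t * X := by gcongr
      _ = lam / t * X * G := by ring
      _ ≤ lam / t * X * (0.0806 * Real.exp (-(0.26 * y))) := by gcongr
      _ ≤ 14.6 * Real.exp (0.26 * y) * (0.0806 * Real.exp (-(0.26 * y))) := by gcongr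
      _ = 14.6 * 0.0806 * (Real.exp (0.26 * y) * Real.exp (-(0.26 * y))) := by ring
      _ = 14.6 * 0.0806 := by rw [← Real.exp_add]; simp
      _ ≤ 1.18 := by norm_num
  linarith

theorem mul_norm_LFunction_prodChar_le {q₁ q₂ : ℕ} [NeZero q₁] [NeZero q₂]
    {χ₁ : DirichletCharacter ℂ q₁} {χ₂ : DirichletCharacter ℂ q₂} (hχ : prodChar χ₁ χ₂ ≠ 1)
    (hq₁ : (200560490130 : ℝ) ≤ q₁) (hq : (q₁ : ℝ) ≤ q₂) {lam : ℝ} (hlam0 : 0 ≤ lam)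
    (hlam : lam ≤ 0.00631 * Real.exp (-(0.3 * (Real.log q₂ - 26))))
    (hprod : lam * ∏ p ∈ q₂.primeFactors ∩ smallPrimes, (1 - (p : ℝ)⁻¹) ≤
      0.001327 * Real.exp (-(0.3 * (Real.log q₂ - 26)))) :
    lam * ‖(prodChar χ₁ χ₂).LFunction 1‖ ≤
      0.0806 * Real.exp (-(0.26 * (Real.log q₂ - 26))) := by
  have hL₂ := twentySix_le_log (hq₁.trans hq)
  have hq₁0 : (0 : ℝ) < q₁ := by linarith
  have hq₂0 : (0 : ℝ) < q₂ := by linarith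
  have hL := Real.log_le_log hq₁0 hq
  have hnorm := norm_LFunction_prodChar_one_le hχ (P := q₂.primeFactors ∩ smallPrimes)
    (fun p hp => ⟨Nat.prime_of_mem_primeFactors (Finset.mem_inter.1 hp).1,
      Nat.dvd_of_mem_primeFactors (Finset.mem_inter.1 hp).1⟩)
  have hsum := sum_log_div_le (P := q₂.primeFactors ∩ smallPrimes) Finset.inter_subset_right
  have hcard : (q₂.primeFactors ∩ smallPrimes).card ≤ 31 := by
    refine (Finset.card_le_card (t := Finset.Icc 1 31) fun p hp => ?_).trans (by simp)
    have hpp := Nat.prime_of_mem_primeFactors (Finset.mem_inter.1 hp).1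
    have := (mem_smallPrimes hpp).1 (Finset.mem_inter.1 hp).2
    have := hpp.one_le
    exact Finset.mem_Icc.2 ⟨by omega, by omega⟩
  have htiny : (2 : ℝ) ^ (q₂.primeFactors ∩ smallPrimes).card * (2 / (q₁ * q₂)) ≤ 0.00001 := by
    have h1 : (200560490130 : ℝ) * 200560490130 ≤ q₁ * q₂ := by gcongr; linarith
    calc (2 : ℝ) ^ (q₂.primeFactors ∩ smallPrimes).card * (2 / (q₁ * q₂))
        ≤ 2 ^ 31 * (2 / (200560490130 * 200560490130)) := by gcongr; norm_num
      _ ≤ 0.00001 := by norm_num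
  rw [Real.log_mul hq₁0.ne' hq₂0.ne'] at hnorm
  have hP0 : 0 ≤ ∏ p ∈ q₂.primeFactors ∩ smallPrimes, (1 - (p : ℝ)⁻¹) := by
    refine Finset.prod_nonneg fun p hp => ?_
    have hp1 : (1 : ℝ) ≤ p := by
      exact_mod_cast (Nat.prime_of_mem_primeFactors (Finset.mem_inter.1 hp).1).one_le
    have := inv_le_one_of_one_le₀ hp1
    linarith
  set P := ∏ p ∈ q₂.primeFactors ∩ smallPrimes, (1 - (p : ℝ)⁻¹)
  set y := Real.log q₂ - 26 with hy
  have hy0 : 0 ≤ y := by linarith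
  have he : Real.exp (-(0.3 * y)) = Real.exp (-(0.04 * y)) * Real.exp (-(0.26 * y)) := by
    rw [← Real.exp_add]; ring_nf
  have hlin := linear_mul_exp_le (a := 55.84) (b := 2) (c := 0.04) (y := y)
    (by norm_num) (by norm_num) hy0
  have he1 : Real.exp (-(0.04 * y)) ≤ 1 := Real.exp_le_one_iff.2 (by linarith)
  have hF : 0 < Real.exp (-(0.26 * y)) := Real.exp_pos _
  rw [he] at hlam hprod
  set f := Real.exp (-(0.04 * y))
  set F := Real.exp (-(0.26 * y))
  have hbr : Real.log q₁ + Real.log q₂ + 2 / 3 +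
      ∑ p ∈ q₂.primeFactors ∩ smallPrimes, Real.log p / ((p : ℝ) - 1) ≤ 55.84 + 2 * y := by
    linarith
  calc lam * ‖(prodChar χ₁ χ₂).LFunction 1‖
      ≤ lam * (1 + (P * (55.84 + 2 * y) + 0.00001)) := by
        refine mul_le_mul_of_nonneg_left (hnorm.trans ?_) hlam0
        gcongr
    _ = lam * 1.00001 + lam * P * (55.84 + 2 * y) := by ring
    _ ≤ 0.00631 * (f * F) * 1.00001 + 0.001327 * (f * F) * (55.84 + 2 * y) := by gcongr
    _ = (0.00631 * 1.00001 * f + 0.001327 * ((55.84 + 2 * y) * f)) * F := by ring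
    _ ≤ (0.00631 * 1.00001 * 1 + 0.001327 * 55.84) * F := by gcongr
    _ ≤ 0.0806 * F := by gcongr; norm_num

theorem eq_of_exponent_eq_two {D₁ D₂ : ℤ} (hD₁ : IsFundamentalDiscriminant D₁)
    (hD₂ : IsFundamentalDiscriminant D₂) (hlarge : 200560490130 ≤ -D₁) (hle : -D₁ ≤ -D₂)
    (hexp₁ : ∀ (K : Type) [Field K] [NumberField K], Module.finrank ℚ K = 2 →
        NumberField.discr K = D₁ → Monoid.exponent (ClassGroup (𝓞 K)) = 2)
    (hexp₂ : ∀ (K : Type) [Field K] [NumberField K], Module.finrank ℚ K = 2 →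
        NumberField.discr K = D₂ → Monoid.exponent (ClassGroup (𝓞 K)) = 2) : D₁ = D₂ := by
  classical
  by_contra hne
  obtain ⟨q₁, hq₁⟩ : ∃ q₁ : ℕ, (q₁ : ℤ) = -D₁ := ⟨(-D₁).toNat, by omega⟩
  obtain ⟨q₂, hq₂⟩ : ∃ q₂ : ℕ, (q₂ : ℤ) = -D₂ := ⟨(-D₂).toNat, by omega⟩
  have : NeZero q₁ := ⟨by omega⟩
  have : NeZero q₂ := ⟨by omega⟩
  obtain ⟨χ₁, hχ₁, hlam₁, -, Z, g, hZ, hg, hrg⟩ :=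
    exists_isKronecker_bounds hD₁ (by omega) hlarge hexp₁ hq₁
  obtain ⟨χ₂, hχ₂, hlam₂, hprod₂, -⟩ :=
    exists_isKronecker_bounds hD₂ (by omega) (hlarge.trans hle) hexp₂ hq₂
  have hs₁ := hχ₁.sq_eq_one
  have hs₂ := hχ₂.sq_eq_one
  have hn₁ : χ₁ ≠ 1 := hχ₁.ne_one (by omega)
  have hn₂ : χ₂ ≠ 1 := hχ₂.ne_one (by omega)
  have hn : prodChar χ₁ χ₂ ≠ 1 :=
    hχ₁.prodChar_ne_one hχ₂ (mul_ne_zero (by omega) (by omega))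
      (not_isSquare_mul_of_fundamental hD₁ hD₂ hne)
  have hQ₁ : (200560490130 : ℝ) ≤ q₁ := by
    have : 200560490130 ≤ q₁ := by omega
    exact_mod_cast this
  have hQ : (q₁ : ℝ) ≤ q₂ := by
    have : q₁ ≤ q₂ := by omega
    exact_mod_cast this
  have hL₁ := twentySix_le_log hQ₁
  have hL := Real.log_le_log (by linarith) hQ
  have hE₁ := isEstermann_quadratic hs₁ hn₁
  have hE₂ := isEstermann_quadratic hs₂ hn₂
  obtain ⟨t, m, ht0, htlam, ht20, hz, hm, hmL⟩ := hE₁.exists_zero_near_one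
    (DirichletCharacter.LFunction_apply_one_ne_zero hn₁) hQ₁ hlam₁
  have he₁ : Real.exp (-(0.3 * (Real.log q₁ - 26))) ≤ 1 :=
    Real.exp_le_one_iff.2 (by linarith)
  have hlt := hE₁.residue_le_of_zero hQ₁ (four_dvd_of_two_dvd hD₁ hq₁) hZ hg hrg ht0 ht20
    (by linarith) hz hm hmL
  refine (isEstermann_biquadratic hs₁ hs₂ hn₁ hn₂ hn).false_of_zero hQ₁ hQ ht0 (by linarith) ?_
    hE₁.ofReal_re_one.2 (by linarith) (hlt.trans ?_) ?_
    (mul_norm_LFunction_prodChar_le hn hQ₁ hQ hE₂.ofReal_re_one.2 hlam₂ hprod₂)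
  · rw [← mul_assoc, hz, zero_mul]
  · gcongr
  · have h1 := hE₁.ofReal_re_one
    have h2 := hE₂.ofReal_re_one
    rw [h1.1, h2.1, Complex.re_ofReal_mul, Complex.re_ofReal_mul]
    refine mul_le_mul_of_nonneg_left ?_ h1.2
    exact mul_le_mul_of_nonneg_left (Complex.re_le_norm _) h2.2

end ExponentTwo

/-- There is at most one fundamental discriminant `D < 0` with
`|D| ≥ 200560490130 = 2·3·5·7·11·13·17·19·23·29·31` whose class group has exponent `2`. -/
theorem at_most_one_exponent_two :
    {D : ℤ | IsFundamentalDiscriminant D ∧ D < 0 ∧ (200560490130 : ℤ) ≤ |D| ∧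
      ∀ (K : Type) [Field K] [NumberField K], Module.finrank ℚ K = 2 →
        NumberField.discr K = D →
          Monoid.exponent (ClassGroup (𝓞 K)) = 2}.Subsingleton := by
  rintro D₁ ⟨h1, hneg1, hl1, he1⟩ D₂ ⟨h2, hneg2, hl2, he2⟩
  rw [abs_of_neg hneg1] at hl1
  rw [abs_of_neg hneg2] at hl2
  rcases le_total (-D₁) (-D₂) with h | h
  · exact ExponentTwo.eq_of_exponent_eq_two h1 h2 hl1 h he1 he2
  · exact (ExponentTwo.eq_of_exponent_eq_two h2 h1 hl2 h he2 he1).symm
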